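/- In the normalized setting, assume in addition that β satisfies Hörmander's condition: there exists r ∈ ℕ such that Σ_{0≤|ζ|≤r} |D^ζ β(y)| > 0 for every y ∈ B_3(0) (the sum being over multi-indices ζ ∈ ℕ^{N−1} with |ζ| ≤ r). Then there exists C > 0, depending only on N, r and β (in particular, not on γ or u), such that sup_{[0,1]×B_1(0)} u ≤ C · inf_{[0,1]×B_1(0)} u. -/

import Mathlib

open MeasureTheory Set Metric

noncomputable section

/-- `ℝ^{N-1}`, the space of the variable `y`. -/
abbrev Euc (N : ℕ) : Type := EuclideanSpace ℝ (Fin (N - 1))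

/-- The partial derivative `∂φ/∂x` of a function on `ℝ × ℝ^{N-1}`. -/
def dX {N : ℕ} (φ : ℝ × Euc N → ℝ) (p : ℝ × Euc N) : ℝ :=
  fderiv ℝ φ p (1, 0)

/-- The Laplacian `Δ_y` in the `y`-variables. -/
def lapY {N : ℕ} (φ : ℝ × Euc N → ℝ) (p : ℝ × Euc N) : ℝ :=
  ∑ i : Fin (N - 1),
    fderiv ℝ (fun q => fderiv ℝ φ q ((0 : ℝ), EuclideanSpace.single i (1 : ℝ))) p
      ((0 : ℝ), EuclideanSpace.single i (1 : ℝ))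

/-- `u` is a distributional solution of `Δ_y u + β(y) u_x + γ(x,y) u = 0` on `S`. -/
def IsDistribSolution {N : ℕ} (S : Set (ℝ × Euc N)) (β : Euc N → ℝ)
    (γ u : ℝ × Euc N → ℝ) : Prop :=
  ∀ φ : ℝ × Euc N → ℝ, ContDiff ℝ (⊤ : ℕ∞) φ → HasCompactSupport φ → tsupport φ ⊆ S →
    ∫ p in S, u p * (lapY φ p - β p.2 * dX φ p + γ p * φ p) = 0

/-- The cylinder `(−5,6) × B_3(0)` of the normalized setting. -/
def cylD (N : ℕ) : Set (ℝ × Euc N) := Ioo (-5 : ℝ) 6 ×ˢ ball (0 : Euc N) 3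

/-- Iterated partial derivatives of `β` along a list of coordinate directions. -/
def partialsAlong {N : ℕ} (β : Euc N → ℝ) : List (Fin (N - 1)) → (Euc N → ℝ)
  | [] => β
  | i :: l => fun y => fderiv ℝ (partialsAlong β l) y (EuclideanSpace.single i (1 : ℝ))

/-- The list of directions encoded by a multi-index `ζ` (direction `i` repeated `ζ i` times). -/
def multiIndexList {N r : ℕ} (ζ : Fin (N - 1) → Fin (r + 1)) : List (Fin (N - 1)) :=
  (List.finRange (N - 1)).flatMap fun i => List.replicate (ζ i : ℕ) i

/-- `Σ_{0 ≤ |ζ| ≤ r} |D^ζ β(y)|`: the sum over all multi-indices `ζ ∈ ℕ^{N-1}` with `|ζ| ≤ r`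
of the absolute values of the corresponding partial derivatives of `β` at `y`. -/
def hormanderSum (N r : ℕ) (β : Euc N → ℝ) (y : Euc N) : ℝ :=
  ∑ ζ ∈ Finset.univ.filter (fun ζ : Fin (N - 1) → Fin (r + 1) => ∑ i, (ζ i : ℕ) ≤ r),
    |partialsAlong β (multiIndexList ζ) y|

open scoped ContDiff

/-! ### Directional derivatives and compactly supported functions -/

section Calculus

variable {F : Type*} [NormedAddCommGroup F] [NormedSpace ℝ F]

/-- The derivative of `f` in the direction `v`. -/
def dd (v : F) (f : F → ℝ) (p : F) : ℝ := fderiv ℝ f p v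

/-- Continuous functions with compact support. -/
structure IsCc {F : Type*} [TopologicalSpace F] (f : F → ℝ) : Prop where
  cont : Continuous f
  supp : HasCompactSupport f

/-- Smooth functions with compact support. -/
structure IsTest (f : F → ℝ) : Prop where
  smooth : ContDiff ℝ ∞ f
  supp : HasCompactSupport f

theorem IsTest.isCc {f : F → ℝ} (hf : IsTest f) : IsCc f := ⟨hf.smooth.continuous, hf.supp⟩

theorem ContDiff.dd {f : F → ℝ} (hf : ContDiff ℝ ∞ f) (v : F) : ContDiff ℝ ∞ (dd v f) :=
  (hf.fderiv_right (m := ∞) (by simp)).clm_apply contDiff_const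

theorem IsTest.dd {f : F → ℝ} (hf : IsTest f) (v : F) : IsTest (dd v f) :=
  ⟨hf.smooth.dd v, hf.supp.fderiv_apply (𝕜 := ℝ) v⟩

theorem dd_mul {f g : F → ℝ} (hf : ContDiff ℝ ∞ f) (hg : ContDiff ℝ ∞ g) (v p : F) :
    dd v (fun q => f q * g q) p = dd v f p * g p + f p * dd v g p := by
  have h1 := (hf.differentiable (by simp)) p
  have h2 := (hg.differentiable (by simp)) p
  unfold dd
  rw [fderiv_fun_mul h1 h2]
  simp; ring

theorem dd_add {f g : F → ℝ} (hf : ContDiff ℝ ∞ f) (hg : ContDiff ℝ ∞ g) (v p : F) :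
    dd v (fun q => f q + g q) p = dd v f p + dd v g p := by
  have h1 := (hf.differentiable (by simp)) p
  have h2 := (hg.differentiable (by simp)) p
  unfold dd
  rw [fderiv_fun_add h1 h2]
  simp

theorem dd_const_mul {f : F → ℝ} (hf : ContDiff ℝ ∞ f) (c : ℝ) (v p : F) :
    dd v (fun q => c * f q) p = c * dd v f p := by
  have h1 := (hf.differentiable (by simp)) p
  unfold dd
  rw [fderiv_const_mul h1]
  simp

theorem dd_exp {f : F → ℝ} (hf : ContDiff ℝ ∞ f) (v p : F) :
    dd v (fun q => Real.exp (f q)) p = Real.exp (f p) * dd v f p := by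
  have h1 := (hf.differentiable (by simp)) p
  unfold dd
  rw [fderiv_exp h1]
  simp

theorem dd_comp_add (f : F → ℝ) (v h p : F) :
    dd v (fun q => f (q + h)) p = dd v f (p + h) := by
  unfold dd
  rw [fderiv_comp_add_right]

theorem dd_eq_zero_of_notMem {f : F → ℝ} {v p : F} (hp : p ∉ tsupport f) : dd v f p = 0 := by
  unfold dd
  rw [fderiv_of_notMem_tsupport ℝ hp]
  rfl

namespace IsCc

variable {F : Type*} [TopologicalSpace F] {f g : F → ℝ}

theorem mul_left (hf : IsCc f) {a : F → ℝ} (ha : Continuous a) : IsCc fun p => a p * f p :=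
  ⟨ha.mul hf.cont, hf.supp.mul_left⟩

theorem mul_right (hf : IsCc f) {a : F → ℝ} (ha : Continuous a) : IsCc fun p => f p * a p :=
  ⟨hf.cont.mul ha, hf.supp.mul_right⟩

theorem add (hf : IsCc f) (hg : IsCc g) : IsCc fun p => f p + g p :=
  ⟨hf.cont.add hg.cont, hf.supp.add hg.supp⟩

theorem neg (hf : IsCc f) : IsCc fun p => - f p := by
  simpa using hf.mul_left (a := fun _ => -1) continuous_const

theorem sub (hf : IsCc f) (hg : IsCc g) : IsCc fun p => f p - g p := by
  simpa [sub_eq_add_neg] using hf.add hg.neg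

theorem const_mul (hf : IsCc f) (c : ℝ) : IsCc fun p => c * f p :=
  hf.mul_left continuous_const

theorem sq (hf : IsCc f) : IsCc fun p => f p ^ 2 := by
  simpa [_root_.sq] using hf.mul_left hf.cont

theorem abs (hf : IsCc f) : IsCc fun p => |f p| :=
  ⟨hf.cont.abs, hf.supp.comp_left (g := fun x : ℝ => |x|) (by simp)⟩

theorem sum {ι : Type*} (s : Finset ι) {f : ι → F → ℝ} (hf : ∀ i ∈ s, IsCc (f i)) :
    IsCc fun p => ∑ i ∈ s, f i p := by
  classical
  induction s using Finset.induction_on with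
  | empty =>
    simp only [Finset.sum_empty]
    exact ⟨continuous_const, HasCompactSupport.zero⟩
  | insert a s ha ih =>
    simp only [Finset.sum_insert ha]
    exact (hf a (by simp)).add (ih fun i hi => hf i (by simp [hi]))

theorem of_compact [R1Space F] (hf : Continuous f) {K : Set F} (hK : IsCompact K)
    (h0 : ∀ p, p ∉ K → f p = 0) : IsCc f :=
  ⟨hf, HasCompactSupport.intro hK fun p hp => h0 p hp⟩

theorem comp_add [AddGroup F] [IsTopologicalAddGroup F] (hf : IsCc f) (h : F) :
    IsCc fun p => f (p + h) :=
  ⟨hf.cont.comp (continuous_add_const h), hf.supp.comp_homeomorph (Homeomorph.addRight h)⟩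

theorem integrable [MeasurableSpace F] [OpensMeasurableSpace F] {μ : Measure F}
    [IsFiniteMeasureOnCompacts μ] (hf : IsCc f) : Integrable f μ :=
  hf.cont.integrable_of_hasCompactSupport hf.supp

end IsCc

theorem IsTest.comp_add {f : F → ℝ} (hf : IsTest f) (h : F) : IsTest fun p => f (p + h) :=
  ⟨hf.smooth.comp (contDiff_id.add contDiff_const), (hf.isCc.comp_add h).supp⟩

theorem IsTest.mul_left {f a : F → ℝ} (hf : IsTest f) (ha : ContDiff ℝ ∞ a) :
    IsTest fun p => a p * f p :=
  ⟨ha.mul hf.smooth, hf.supp.mul_left⟩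

variable [MeasurableSpace F] [BorelSpace F] {μ : Measure F}

/-- The correlation `t ↦ ∫ a w τ_{tv} w` is differentiable. -/
theorem hasDerivAt_correlation [IsFiniteMeasureOnCompacts μ] {a w : F → ℝ} (ha : Continuous a)
    (hw : IsTest w) (v : F) (t : ℝ) :
    HasDerivAt (fun s : ℝ => ∫ p, a p * w p * w (p + s • v) ∂μ)
      (∫ p, a p * w p * dd v w (p + t • v) ∂μ) t := by
  obtain ⟨M, hM⟩ := (hw.dd v).isCc.supp.exists_bound_of_continuous (hw.dd v).isCc.cont
  have hc : ∀ s : ℝ, Continuous fun p : F => p + s • v := fun s => by fun_prop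
  refine (hasDerivAt_integral_of_dominated_loc_of_deriv_le (𝕜 := ℝ) (μ := μ) (x₀ := t) (s := univ)
    (F := fun s p => a p * w p * w (p + s • v))
    (F' := fun s p => a p * w p * dd v w (p + s • v))
    (bound := fun p => |a p * w p| * M) Filter.univ_mem ?_ ?_ ?_ ?_ ?_ ?_).2
  · exact Filter.Eventually.of_forall fun s =>
      ((ha.mul hw.isCc.cont).mul (hw.isCc.cont.comp (hc s))).aestronglyMeasurable
  · exact ((hw.isCc.mul_left ha).mul_right (hw.isCc.cont.comp (hc t))).integrable
  · exact ((ha.mul hw.isCc.cont).mul ((hw.dd v).isCc.cont.comp (hc t))).aestronglyMeasurable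
  · refine Filter.Eventually.of_forall fun p s _ => ?_
    rw [norm_mul, Real.norm_eq_abs]
    exact mul_le_mul_of_nonneg_left (hM _) (abs_nonneg _)
  · exact ((hw.isCc.mul_left ha).abs.mul_right continuous_const).integrable
  · refine Filter.Eventually.of_forall fun p s _ => ?_
    have h1 : HasFDerivAt w (fderiv ℝ w (p + s • v)) (p + s • v) :=
      (hw.smooth.differentiable (by simp) _).hasFDerivAt
    have h2 : HasDerivAt (fun s : ℝ => p + s • v) v s := by
      simpa using ((hasDerivAt_id s).smul_const v).const_add p
    exact (h1.comp_hasDerivAt s h2).const_mul (a p * w p)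

variable [FiniteDimensional ℝ F] [μ.IsAddHaarMeasure]

/-- Integration by parts when the first factor has compact support. -/
theorem integral_mul_dd {f g : F → ℝ} (hf : IsTest f) (hg : ContDiff ℝ ∞ g) (v : F) :
    ∫ p, f p * dd v g p ∂μ = - ∫ p, dd v f p * g p ∂μ :=
  integral_mul_fderiv_eq_neg_fderiv_mul_of_integrable
    ((hf.dd v).isCc.mul_right hg.continuous).integrable
    (hf.isCc.mul_right (hg.dd v).continuous).integrable
    (hf.isCc.mul_right hg.continuous).integrable
    (fun x _ => hf.smooth.differentiable (by simp) x)
    (fun x _ => hg.differentiable (by simp) x)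

end Calculus

/-! ### The operator `Δ_y + β ∂_x` and functions with a one-signed defect -/

/-- The unit vector in the `x`-direction. -/
def eX (N : ℕ) : ℝ × Euc N := (1, 0)

/-- The `i`-th unit vector in the `y`-directions. -/
def eY {N : ℕ} (i : Fin (N - 1)) : ℝ × Euc N := (0, EuclideanSpace.single i 1)

/-- The squared length of the gradient in the `y`-variables. -/
def gradSq {N : ℕ} (φ : ℝ × Euc N → ℝ) (p : ℝ × Euc N) : ℝ :=
  ∑ i : Fin (N - 1), dd (eY i) φ p ^ 2

section Operator

variable {N : ℕ}

instance : (volume : Measure (ℝ × Euc N)).IsAddHaarMeasure :=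
  inferInstanceAs (((volume : Measure ℝ).prod (volume : Measure (Euc N))).IsAddHaarMeasure)

theorem dX_eq_dd (φ : ℝ × Euc N → ℝ) : dX φ = dd (eX N) φ := rfl

theorem lapY_eq_sum (φ : ℝ × Euc N → ℝ) (p : ℝ × Euc N) :
    lapY φ p = ∑ i, dd (eY i) (dd (eY i) φ) p := rfl

theorem gradSq_nonneg (φ : ℝ × Euc N → ℝ) (p : ℝ × Euc N) : 0 ≤ gradSq φ p :=
  Finset.sum_nonneg fun _ _ => sq_nonneg _

theorem IsTest.gradSq {φ : ℝ × Euc N → ℝ} (hφ : IsTest φ) : IsCc (gradSq φ) :=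
  IsCc.sum _ fun i _ => (hφ.dd (eY i)).isCc.sq

theorem ContDiff.continuous_gradSq {φ : ℝ × Euc N → ℝ} (hφ : ContDiff ℝ ∞ φ) :
    Continuous (gradSq φ) :=
  continuous_finsetSum _ fun i _ => (hφ.dd (eY i)).continuous.pow 2

theorem ContDiff.lapY {φ : ℝ × Euc N → ℝ} (hφ : ContDiff ℝ ∞ φ) : ContDiff ℝ ∞ (lapY φ) :=
  ContDiff.sum fun i _ => (hφ.dd (eY i)).dd (eY i)

theorem IsTest.lapY {φ : ℝ × Euc N → ℝ} (hφ : IsTest φ) : IsCc (lapY φ) :=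
  IsCc.sum _ fun i _ => ((hφ.dd (eY i)).dd (eY i)).isCc

theorem ContDiff.comp_snd_euc {a : Euc N → ℝ} (ha : ContDiff ℝ ∞ a) :
    ContDiff ℝ ∞ fun p : ℝ × Euc N => a p.2 := ha.comp contDiff_snd

theorem dd_eY_comp_snd {a : Euc N → ℝ} (ha : ContDiff ℝ ∞ a) (i : Fin (N - 1)) (p : ℝ × Euc N) :
    dd (eY i) (fun q : ℝ × Euc N => a q.2) p = dd (EuclideanSpace.single i 1) a p.2 := by
  unfold dd
  have h := ((ha.differentiable (by simp)) p.2).hasFDerivAt.comp p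
    (hasFDerivAt_snd (𝕜 := ℝ) (E := ℝ) (F := Euc N) (p := p))
  rw [show (fun q : ℝ × Euc N => a q.2) = a ∘ Prod.snd from rfl, h.fderiv]
  simp [eY]

theorem dd_eX_comp_snd {a : Euc N → ℝ} (ha : ContDiff ℝ ∞ a) (p : ℝ × Euc N) :
    dd (eX N) (fun q : ℝ × Euc N => a q.2) p = 0 := by
  unfold dd
  have h := ((ha.differentiable (by simp)) p.2).hasFDerivAt.comp p
    (hasFDerivAt_snd (𝕜 := ℝ) (E := ℝ) (F := Euc N) (p := p))
  rw [show (fun q : ℝ × Euc N => a q.2) = a ∘ Prod.snd from rfl, h.fderiv]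
  simp [eX]

theorem abs_integral_mul_le {F : Type*} [TopologicalSpace F] [MeasurableSpace F]
    [OpensMeasurableSpace F] {μ : Measure F} [IsFiniteMeasureOnCompacts μ]
    {f g : F → ℝ} (hf : IsCc f) (hg : IsCc g) :
    |∫ p, f p * g p ∂μ| ≤ (∫ p, f p ^ 2 ∂μ + ∫ p, g p ^ 2 ∂μ) / 2 := by
  have h1 := hf.sq.integrable (μ := μ)
  have h2 := hg.sq.integrable (μ := μ)
  have h3 := (hg.mul_left hf.cont).abs.integrable (μ := μ)
  calc |∫ p, f p * g p ∂μ| ≤ ∫ p, |f p * g p| ∂μ := abs_integral_le_integral_abs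
    _ ≤ ∫ p, (f p ^ 2 + g p ^ 2) / 2 ∂μ := by
        refine integral_mono h3 ((h1.add h2).div_const 2) fun p => ?_
        simp only [abs_mul]
        nlinarith [sq_nonneg (|f p| - |g p|), sq_abs (f p), sq_abs (g p)]
    _ = _ := by rw [integral_div, integral_add h1 h2]

theorem integral_mul_lapY {f φ : ℝ × Euc N → ℝ} (hf : IsTest f) (hφ : ContDiff ℝ ∞ φ) :
    ∫ p, f p * lapY φ p = - ∑ i, ∫ p, dd (eY i) f p * dd (eY i) φ p := by
  simp_rw [lapY_eq_sum, Finset.mul_sum]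
  rw [integral_finsetSum _ fun i _ =>
    (hf.isCc.mul_right ((hφ.dd (eY i)).dd (eY i)).continuous).integrable, ← Finset.sum_neg_distrib]
  exact Finset.sum_congr rfl fun i _ => integral_mul_dd hf (hφ.dd _) _

theorem integral_gradSq {φ : ℝ × Euc N → ℝ} (hφ : IsTest φ) :
    ∫ p, gradSq φ p = ∑ i, ∫ p, dd (eY i) φ p ^ 2 :=
  integral_finsetSum _ fun i _ => (hφ.dd (eY i)).isCc.sq.integrable

/-- `w ≥ 0` is a test function with `Δ_y w + β w_x = μ + g`, where `μ` has a constant sign. -/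
structure DefectEq (β : Euc N → ℝ) (w μ g : ℝ × Euc N → ℝ) : Prop where
  test : IsTest w
  nonneg : ∀ p, 0 ≤ w p
  defect : IsCc μ
  rhs : IsCc g
  eq : ∀ p, lapY w p + β p.2 * dX w p = μ p + g p
  sign : (∀ p, 0 ≤ μ p) ∨ ∀ p, μ p ≤ 0

/-- The energy controlling `w`. -/
def energy (w g : ℝ × Euc N → ℝ) : ℝ :=
  (∫ p, gradSq w p) + (∫ p, w p ^ 2) + ∫ p, g p ^ 2


theorem energy_nonneg (w g : ℝ × Euc N → ℝ) : 0 ≤ energy w g :=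
  add_nonneg (add_nonneg (integral_nonneg (gradSq_nonneg w)) (integral_nonneg fun _ => sq_nonneg _))
    (integral_nonneg fun _ => sq_nonneg _)

theorem integral_sq_le_energy (w g : ℝ × Euc N → ℝ) : ∫ p, w p ^ 2 ≤ energy w g := by
  have h1 : 0 ≤ ∫ p, gradSq w p := integral_nonneg (gradSq_nonneg w)
  have h2 : 0 ≤ ∫ p, g p ^ 2 := integral_nonneg fun _ => sq_nonneg _
  unfold energy; linarith

theorem integral_dd_sq_le_energy {w : ℝ × Euc N → ℝ} (hw : IsTest w) (g : ℝ × Euc N → ℝ)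
    (i : Fin (N - 1)) : ∫ p, dd (eY i) w p ^ 2 ≤ energy w g := by
  have h1 : 0 ≤ ∫ p, w p ^ 2 := integral_nonneg fun _ => sq_nonneg _
  have h2 : 0 ≤ ∫ p, g p ^ 2 := integral_nonneg fun _ => sq_nonneg _
  have h3 : ∫ p, dd (eY i) w p ^ 2 ≤ ∫ p, gradSq w p := by
    rw [integral_gradSq hw]
    exact Finset.single_le_sum (f := fun i => ∫ p, dd (eY i) w p ^ 2)
      (fun _ _ => integral_nonneg fun _ => sq_nonneg _) (Finset.mem_univ i)
  unfold energy; linarith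

theorem abs_integral_mul_translate_le {f w : ℝ × Euc N → ℝ} (hf : IsCc f) (hw : IsCc w)
    (h : ℝ × Euc N) :
    |∫ p, f p * w (p + h)| ≤ ((∫ p, f p ^ 2) + ∫ p, w p ^ 2) / 2 := by
  have := abs_integral_mul_le (μ := volume) hf (hw.comp_add h)
  rwa [integral_add_right_eq_self (fun p => w p ^ 2) h] at this

theorem abs_integral_translate_mul_lapY_le {w : ℝ × Euc N → ℝ} (hw : IsTest w)
    (h : ℝ × Euc N) :
    |∫ p, w (p + h) * lapY w p| ≤ ∫ p, gradSq w p := by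
  rw [integral_mul_lapY (hw.comp_add h) hw.smooth, abs_neg, integral_gradSq hw]
  refine (Finset.abs_sum_le_sum_abs _ _).trans (Finset.sum_le_sum fun i _ => ?_)
  have := abs_integral_mul_translate_le (hw.dd (eY i)).isCc (hw.dd (eY i)).isCc h
  simp_rw [dd_comp_add, mul_comm (dd _ w (_ + h))]
  linarith

/-- The transport term is antisymmetric under the symmetrized translation. -/
theorem integral_transport_translate {a : Euc N → ℝ} (ha : ContDiff ℝ ∞ a) {w : ℝ × Euc N → ℝ}
    (hw : IsTest w) (s : ℝ) :
    ∫ p, a p.2 * dX w p * w (p + (-s) • eX N) = - ∫ p, a p.2 * dX w p * w (p + s • eX N) := by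
  have h1 : ∫ p, a p.2 * dX w p * w (p + (-s) • eX N)
      = ∫ p, a p.2 * w p * dd (eX N) (fun q => w (q + s • eX N)) p := by
    rw [← integral_add_right_eq_self _ (s • eX N)]
    refine integral_congr_ae (Filter.Eventually.of_forall fun p => ?_)
    simp only [dd_comp_add, dX_eq_dd]
    have : (p + s • eX N).2 = p.2 := by simp [eX]
    rw [this, add_assoc, ← add_smul, add_neg_cancel, zero_smul, add_zero]
    ring
  rw [h1, integral_mul_dd (hw.mul_left ha.comp_snd_euc) (hw.comp_add _).smooth]
  congr 1
  refine integral_congr_ae (Filter.Eventually.of_forall fun p => ?_)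
  simp only [dd_mul ha.comp_snd_euc hw.smooth, dd_eX_comp_snd ha, dX_eq_dd]
  ring

namespace DefectEq

variable {β : Euc N → ℝ} {w μ g : ℝ × Euc N → ℝ}

/-- The mass of the defect against translates of `w` is bounded by the energy. -/
theorem integral_abs_defect_mul_le (hβ : ContDiff ℝ ∞ β) (h : DefectEq β w μ g) (s : ℝ) :
    ∫ p, |μ p| * w (p + s • eX N) ≤ 2 * energy w g := by
  have hw := h.test
  have key : ∀ s : ℝ, ∫ p, μ p * w (p + s • eX N)
      = (∫ p, w (p + s • eX N) * lapY w p) + (∫ p, β p.2 * dX w p * w (p + s • eX N))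
        - ∫ p, g p * w (p + s • eX N) := by
    intro s
    have i1 := (hw.lapY.mul_left (hw.comp_add (s • eX N)).isCc.cont).integrable (μ := volume)
    have i2 := (((hw.dd (eX N)).isCc.mul_left hβ.comp_snd_euc.continuous).mul_right
      (hw.comp_add (s • eX N)).isCc.cont).integrable (μ := volume)
    have i3 := (h.rhs.mul_right (hw.comp_add (s • eX N)).isCc.cont).integrable (μ := volume)
    rw [dX_eq_dd, ← integral_add i1 i2, ← integral_sub (i1.fun_add i2) i3]
    refine integral_congr_ae (Filter.Eventually.of_forall fun p => ?_)
    have := h.eq p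
    simp only [dX_eq_dd] at this ⊢
    linear_combination -(w (p + s • eX N)) * this
  have hsum : |(∫ p, μ p * w (p + s • eX N)) + ∫ p, μ p * w (p + (-s) • eX N)|
      ≤ 2 * energy w g := by
    rw [key s, key (-s), integral_transport_translate hβ hw s]
    have e1 := abs_integral_translate_mul_lapY_le hw (s • eX N)
    have e2 := abs_integral_translate_mul_lapY_le hw ((-s) • eX N)
    have e3 := abs_integral_mul_translate_le h.rhs hw.isCc (s • eX N)
    have e4 := abs_integral_mul_translate_le h.rhs hw.isCc ((-s) • eX N)
    have e5 : 0 ≤ ∫ p, w p ^ 2 := integral_nonneg fun _ => sq_nonneg _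
    have e6 : 0 ≤ ∫ p, g p ^ 2 := integral_nonneg fun _ => sq_nonneg _
    unfold energy
    rw [abs_le] at *
    constructor <;> linarith [e1.1, e1.2, e2.1, e2.2, e3.1, e3.2, e4.1, e4.2]
  rcases h.sign with hs | hs
  · have h2 : 0 ≤ ∫ p, μ p * w (p + (-s) • eX N) :=
      integral_nonneg fun p => mul_nonneg (hs p) (h.nonneg _)
    simp_rw [abs_of_nonneg (hs _)]
    linarith [le_abs_self ((∫ p, μ p * w (p + s • eX N)) + ∫ p, μ p * w (p + (-s) • eX N))]
  · have h2 : ∫ p, μ p * w (p + (-s) • eX N) ≤ 0 :=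
      integral_nonpos fun p => mul_nonpos_of_nonpos_of_nonneg (hs p) (h.nonneg _)
    simp_rw [abs_of_nonpos (hs _), neg_mul]
    rw [integral_neg]
    linarith [neg_abs_le ((∫ p, μ p * w (p + s • eX N)) + ∫ p, μ p * w (p + (-s) • eX N))]

end DefectEq

end Operator

/-! ### Fractional regularity in `x` and a Nash inequality -/

section Regularity

variable {N : ℕ}

theorem integral_translate_sub_sq {a : ℝ × Euc N → ℝ} (ha : Continuous a) {w : ℝ × Euc N → ℝ}
    (hw : IsCc w) {h : ℝ × Euc N} (hinv : ∀ p, a (p + h) = a p) :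
    ∫ p, a p * (w (p + h) - w p) ^ 2
      = 2 * (∫ p, a p * w p * w p) - 2 * ∫ p, a p * w p * w (p + h) := by
  have hwh := hw.comp_add h
  have i1 := ((hw.mul_left ha).mul_right hw.cont).integrable (μ := volume)
  have i2 := ((hw.mul_left ha).mul_right hwh.cont).integrable (μ := volume)
  have i3 := ((hwh.mul_left ha).mul_right hwh.cont).integrable (μ := volume)
  have e : ∫ p, a p * w (p + h) * w (p + h) = ∫ p, a p * w p * w p := by
    rw [← integral_add_right_eq_self (fun p => a p * w p * w p) h]
    simp_rw [hinv]
  calc ∫ p, a p * (w (p + h) - w p) ^ 2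
      = ∫ p, (a p * w (p + h) * w (p + h) + a p * w p * w p) - 2 * (a p * w p * w (p + h)) := by
        refine integral_congr_ae (Filter.Eventually.of_forall fun p => ?_)
        simp only
        ring
    _ = _ := by
        rw [integral_sub (i3.fun_add i1) (i2.const_mul 2), integral_add i3 i1,
          integral_const_mul, e]
        ring

/-- A bound on the derivative of the correlation controls translation differences. -/
theorem integral_translate_sub_sq_le {a : ℝ × Euc N → ℝ} (ha : Continuous a) {w : ℝ × Euc N → ℝ}
    (hw : IsTest w) {v : ℝ × Euc N} (hinv : ∀ (s : ℝ) p, a (p + s • v) = a p) {A : ℝ}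
    (hA : ∀ s : ℝ, |∫ p, a p * w p * dd v w (p + s • v)| ≤ A) {s : ℝ} (hs : 0 ≤ s) :
    ∫ p, a p * (w (p + s • v) - w p) ^ 2 ≤ 2 * A * s := by
  have h1 := (convex_univ (𝕜 := ℝ) (E := ℝ)).norm_image_sub_le_of_norm_hasDerivWithin_le
    (f := fun s : ℝ => ∫ p, a p * w p * w (p + s • v)) (C := A)
    (fun t _ => (hasDerivAt_correlation ha hw v t).hasDerivWithinAt) (fun t _ => hA t)
    (mem_univ 0) (mem_univ s)
  rw [integral_translate_sub_sq ha hw.isCc (hinv s)]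
  simp only [zero_smul, add_zero, sub_zero, Real.norm_eq_abs, abs_of_nonneg hs] at h1
  linarith [(abs_le.1 h1).1]

theorem integral_translate_y_sub_sq_le {w g : ℝ × Euc N → ℝ} (hw : IsTest w) (y : Euc N)
    (hy : ‖y‖ ≤ 1) {s : ℝ} (hs : 0 ≤ s) :
    ∫ p, (w (p + s • ((0 : ℝ), y)) - w p) ^ 2 ≤ 2 * energy w g * s := by
  have hdd : ∀ p, dd ((0 : ℝ), y) w p ^ 2 ≤ gradSq w p := by
    intro p
    have : dd ((0 : ℝ), y) w p = ∑ i, y i * dd (eY i) w p := by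
      have hy' : ((0 : ℝ), y) = ∑ i, y i • (eY i : ℝ × Euc N) := by
        ext j
        · simp [eY, Prod.fst_sum]
        · simp [eY, Prod.snd_sum, Pi.single_apply]
      unfold dd
      rw [hy', map_sum]
      simp
    rw [this]
    have h2 := Finset.sum_mul_sq_le_sq_mul_sq Finset.univ (fun i => y i) fun i => dd (eY i) w p
    have h3 : ∑ i, y i ^ 2 ≤ 1 := by
      have := EuclideanSpace.real_norm_sq_eq y
      rw [← this]
      nlinarith [norm_nonneg y]
    exact h2.trans (mul_le_of_le_one_left (gradSq_nonneg w p) h3)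
  have := integral_translate_sub_sq_le (a := fun _ => 1) continuous_const hw
    (v := ((0 : ℝ), y)) (A := energy w g) (fun _ _ => rfl) ?_ hs
  · simpa using this
  intro t
  simp only [one_mul]
  have h1 := abs_integral_mul_translate_le hw.isCc (hw.dd ((0 : ℝ), y)).isCc (t • ((0 : ℝ), y))
  have h2 : ∫ p, dd ((0 : ℝ), y) w p ^ 2 ≤ ∫ p, gradSq w p :=
    integral_mono (hw.dd _).isCc.sq.integrable hw.gradSq.integrable hdd
  have e6 : 0 ≤ ∫ p, g p ^ 2 := integral_nonneg fun _ => sq_nonneg _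
  have e5 : 0 ≤ ∫ p, w p ^ 2 := integral_nonneg fun _ => sq_nonneg _
  have e7 : 0 ≤ ∫ p, gradSq w p := integral_nonneg (gradSq_nonneg w)
  unfold energy
  linarith

theorem IsTest.exists_abs_le {F : Type*} [NormedAddCommGroup F] [NormedSpace ℝ F] {f : F → ℝ}
    (hf : IsTest f) : ∃ M : ℝ, 0 ≤ M ∧ ∀ p, |f p| ≤ M := by
  obtain ⟨M, hM⟩ := hf.supp.exists_bound_of_continuous hf.smooth.continuous
  exact ⟨|M|, abs_nonneg _, fun p => (hM p).trans (le_abs_self M)⟩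

theorem IsTest.partialsAlong {β : Euc N → ℝ} (hβ : IsTest β) :
    ∀ l, IsTest (partialsAlong β l)
  | [] => hβ
  | i :: l => (IsTest.partialsAlong hβ l).dd (EuclideanSpace.single i 1)

/-- The `β`-weighted translation estimate. -/
theorem exists_weighted_translate_bound {β : Euc N → ℝ} (hβ : IsTest β) :
    ∃ C : ℝ, 0 ≤ C ∧ ∀ w μ g, DefectEq β w μ g → ∀ s : ℝ, 0 ≤ s →
      ∫ p : ℝ × Euc N, (β p.2 * (w (p + s • eX N) - w p)) ^ 2 ≤ C * s * energy w g := by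
  obtain ⟨M₀, hM₀, hβM₀⟩ := hβ.exists_abs_le
  choose M₁ hM₁ hβM₁ using fun i : Fin (N - 1) => (hβ.dd (EuclideanSpace.single i 1)).exists_abs_le
  set M := M₀ + ∑ i, M₁ i with hM
  have hMnn : 0 ≤ M := add_nonneg hM₀ (Finset.sum_nonneg fun i _ => hM₁ i)
  have hβM : ∀ y, |β y| ≤ M := fun y =>
    (hβM₀ y).trans (le_add_of_nonneg_right (Finset.sum_nonneg fun i _ => hM₁ i))
  have hdβM : ∀ i y, |dd (EuclideanSpace.single i 1) β y| ≤ M := fun i y =>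
    (hβM₁ i y).trans ((Finset.single_le_sum (f := M₁) (fun j _ => hM₁ j) (Finset.mem_univ i)).trans
      (le_add_of_nonneg_left hM₀))
  have hβs := hβ.smooth
  have hβc : Continuous fun p : ℝ × Euc N => β p.2 := hβs.comp_snd_euc.continuous
  set n : ℝ := ((N - 1 : ℕ) : ℝ) with hn
  refine ⟨2 * (M * (n + 5)), by positivity, fun w μ g h s hs => ?_⟩
  have hw := h.test
  have hbound : ∀ s : ℝ, |∫ p, β p.2 ^ 2 * w p * dd (eX N) w (p + s • eX N)|
      ≤ M * (n + 5) * energy w g := by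
    intro s
    have hτ := hw.comp_add ((-s) • eX N)
    have e0 : ∫ p, β p.2 ^ 2 * w p * dd (eX N) w (p + s • eX N)
        = ∫ p, β p.2 * w (p + (-s) • eX N) * (β p.2 * dX w p) := by
      rw [← integral_add_right_eq_self _ ((-s) • eX N)]
      refine integral_congr_ae (Filter.Eventually.of_forall fun p => ?_)
      have : (p + (-s) • eX N).2 = p.2 := by simp [eX]
      simp only [this]
      rw [add_assoc, ← add_smul, neg_add_cancel, zero_smul, add_zero, dX_eq_dd]
      ring
    have hβτ := hτ.mul_left hβs.comp_snd_euc
    have i1 := (h.defect.mul_left hβτ.isCc.cont).integrable (μ := volume)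
    have i2 := (h.rhs.mul_left hβτ.isCc.cont).integrable (μ := volume)
    have i3 := (hw.lapY.mul_left hβτ.isCc.cont).integrable (μ := volume)
    have e1 : ∫ p, β p.2 * w (p + (-s) • eX N) * (β p.2 * dX w p)
        = (∫ p, β p.2 * w (p + (-s) • eX N) * μ p) + (∫ p, β p.2 * w (p + (-s) • eX N) * g p)
          - ∫ p, β p.2 * w (p + (-s) • eX N) * lapY w p := by
      rw [← integral_add i1 i2, ← integral_sub (i1.fun_add i2) i3]
      refine integral_congr_ae (Filter.Eventually.of_forall fun p => ?_)
      simp only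
      linear_combination β p.2 * w (p + (-s) • eX N) * h.eq p
    have b1 : |∫ p, β p.2 * w (p + (-s) • eX N) * μ p| ≤ M * (2 * energy w g) := by
      refine (abs_integral_le_integral_abs).trans ?_
      refine le_trans ?_ (mul_le_mul_of_nonneg_left (h.integral_abs_defect_mul_le hβs (-s)) hMnn)
      rw [← integral_const_mul]
      refine integral_mono i1.abs ((h.defect.abs.mul_right hτ.isCc.cont).integrable.const_mul M)
        fun p => ?_
      simp only [abs_mul, abs_of_nonneg (h.nonneg _)]
      nlinarith [mul_le_mul_of_nonneg_right (hβM p.2) (mul_nonneg (h.nonneg (p + (-s) • eX N))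
        (abs_nonneg (μ p)))]
    have bE : ∀ {f k : ℝ × Euc N → ℝ} {A B : ℝ} (a : ℝ × Euc N → ℝ), Continuous a →
        (∀ p, |a p| ≤ M) → IsCc f → IsCc k →
        (∫ p, f p ^ 2) ≤ A → (∫ p, k p ^ 2) ≤ B →
        |∫ p, a p * f (p + (-s) • eX N) * k p| ≤ M * ((A + B) / 2) := by
      intro f k A B a ha haM hf hk hA hB
      have hfτ := hf.comp_add ((-s) • eX N)
      have hA' : ∫ p, f (p + (-s) • eX N) ^ 2 ≤ A := by
        rwa [integral_add_right_eq_self (fun p => f p ^ 2)]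
      refine (abs_integral_le_integral_abs).trans ?_
      have j1 := hfτ.sq.integrable (μ := volume)
      have j2 := hk.sq.integrable (μ := volume)
      calc ∫ p, |a p * f (p + (-s) • eX N) * k p|
          ≤ ∫ p, M * ((f (p + (-s) • eX N) ^ 2 + k p ^ 2) / 2) := by
            refine integral_mono ((hk.mul_left (ha.mul hfτ.cont)).abs.integrable)
              (((j1.add j2).div_const 2).const_mul M) fun p => ?_
            simp only [abs_mul]
            rw [mul_assoc]
            refine mul_le_mul (haM p) ?_ (by positivity) hMnn
            nlinarith [sq_nonneg (|f (p + (-s) • eX N)| - |k p|), sq_abs (f (p + (-s) • eX N)),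
              sq_abs (k p)]
        _ ≤ _ := by
            rw [integral_const_mul, integral_div, integral_add j1 j2]
            gcongr
    have b2 := bE (fun p => β p.2) hβc (fun p => hβM p.2) hw.isCc h.rhs le_rfl le_rfl
    have b3 : |∫ p, β p.2 * w (p + (-s) • eX N) * lapY w p|
        ≤ ∑ i, (M * (((∫ p, w p ^ 2) + ∫ p, dd (eY i) w p ^ 2) / 2)
          + M * (((∫ p, dd (eY i) w p ^ 2) + ∫ p, dd (eY i) w p ^ 2) / 2)) := by
      rw [integral_mul_lapY hβτ hw.smooth, abs_neg]
      refine (Finset.abs_sum_le_sum_abs _ _).trans (Finset.sum_le_sum fun i _ => ?_)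
      have c1 := bE (fun p => dd (EuclideanSpace.single i 1) β p.2)
        (hβs.dd _).comp_snd_euc.continuous (fun p => hdβM i p.2) hw.isCc (hw.dd (eY i)).isCc
        le_rfl le_rfl
      have c2 := bE (fun p => β p.2) hβc (fun p => hβM p.2) (hw.dd (eY i)).isCc
        (hw.dd (eY i)).isCc le_rfl le_rfl
      have k1 : Integrable (fun p : ℝ × Euc N => dd (EuclideanSpace.single i 1) β p.2
          * w (p + (-s) • eX N) * dd (eY i) w p) := ((hw.dd (eY i)).isCc.mul_left ((hβs.dd (EuclideanSpace.single i
        1)).comp_snd_euc.continuous.mul hτ.isCc.cont)).integrable (μ := volume)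
      have k2 : Integrable (fun p : ℝ × Euc N => β p.2 * dd (eY i) w (p + (-s) • eX N)
          * dd (eY i) w p) := ((hw.dd (eY i)).isCc.mul_left (hβc.mul
        ((hw.dd (eY i)).comp_add ((-s) • eX N)).isCc.cont)).integrable (μ := volume)
      have c3 : ∫ p, dd (eY i) (fun p => β p.2 * w (p + (-s) • eX N)) p * dd (eY i) w p
          = (∫ p, dd (EuclideanSpace.single i 1) β p.2 * w (p + (-s) • eX N) * dd (eY i) w p)
            + ∫ p, β p.2 * dd (eY i) w (p + (-s) • eX N) * dd (eY i) w p := by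
        rw [← integral_add k1 k2]
        refine integral_congr_ae (Filter.Eventually.of_forall fun p => ?_)
        simp only [dd_mul hβs.comp_snd_euc hτ.smooth, dd_eY_comp_snd hβs, dd_comp_add]
        ring
      rw [c3]
      exact (abs_add_le _ _).trans (add_le_add c1 c2)
    have b4 : ∑ i : Fin (N - 1), (M * (((∫ p, w p ^ 2) + ∫ p, dd (eY i) w p ^ 2) / 2)
          + M * (((∫ p, dd (eY i) w p ^ 2) + ∫ p, dd (eY i) w p ^ 2) / 2))
        = M * (n / 2 * (∫ p, w p ^ 2) + 3 / 2 * ∫ p, gradSq w p) := by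
      rw [integral_gradSq hw]
      rw [Finset.sum_congr rfl (g := fun i => M * ((∫ p, w p ^ 2) / 2)
        + M * (3 / 2) * ∫ p, dd (eY i) w p ^ 2) (fun i _ => by ring), Finset.sum_add_distrib,
        Finset.sum_const, Finset.card_univ, Fintype.card_fin, nsmul_eq_mul, ← hn,
        ← Finset.mul_sum]
      ring
    rw [b4] at b3
    rw [e0, e1]
    have e5 : 0 ≤ ∫ p, w p ^ 2 := integral_nonneg fun _ => sq_nonneg _
    have e6 : 0 ≤ ∫ p, g p ^ 2 := integral_nonneg fun _ => sq_nonneg _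
    have e7 : 0 ≤ ∫ p, gradSq w p := integral_nonneg (gradSq_nonneg w)
    have hn0 : 0 ≤ n := Nat.cast_nonneg _
    have fin : M * (2 * energy w g) + M * (((∫ p, w p ^ 2) + ∫ p, g p ^ 2) / 2)
        + M * (n / 2 * (∫ p, w p ^ 2) + 3 / 2 * ∫ p, gradSq w p) ≤ M * (n + 5) * energy w g := by
      rw [← mul_add, ← mul_add, mul_assoc]
      refine mul_le_mul_of_nonneg_left ?_ hMnn
      unfold energy
      nlinarith [mul_nonneg hn0 e5, mul_nonneg hn0 e6, mul_nonneg hn0 e7]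
    refine le_trans ?_ fin
    rw [abs_le] at b1 b2 b3 ⊢
    constructor <;> linarith [b1.1, b1.2, b2.1, b2.2, b3.1, b3.2]
  have := integral_translate_sub_sq_le (a := fun p => β p.2 ^ 2) (hβc.pow 2) hw (v := eX N)
    (fun t p => by simp [eX]) hbound hs
  simp_rw [mul_pow]
  linarith

end Regularity

section Chain

variable {N : ℕ}

theorem IsTest.sub {F : Type*} [NormedAddCommGroup F] [NormedSpace ℝ F] {f g : F → ℝ}
    (hf : IsTest f) (hg : IsTest g) : IsTest fun p => f p - g p :=
  ⟨hf.smooth.sub hg.smooth, (hf.isCc.sub hg.isCc).supp⟩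

theorem dd_sub {F : Type*} [NormedAddCommGroup F] [NormedSpace ℝ F] {f g : F → ℝ}
    (hf : ContDiff ℝ ∞ f) (hg : ContDiff ℝ ∞ g) (v p : F) :
    dd v (fun q => f q - g q) p = dd v f p - dd v g p := by
  have h1 := (hf.differentiable (by simp)) p
  have h2 := (hg.differentiable (by simp)) p
  unfold dd
  rw [fderiv_fun_sub h1 h2]
  rfl

theorem IsCc.integral_translate_sub_sq_le {f : ℝ × Euc N → ℝ} (hf : IsCc f) (h : ℝ × Euc N) :
    ∫ p, (f (p + h) - f p) ^ 2 ≤ 4 * ∫ p, f p ^ 2 := by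
  have e := integral_add_right_eq_self (μ := volume) (fun p => f p ^ 2) h
  have i1 := (hf.comp_add h).sq.integrable (μ := volume)
  have i2 := hf.sq.integrable (μ := volume)
  calc ∫ p, (f (p + h) - f p) ^ 2 ≤ ∫ p, 2 * (f (p + h) ^ 2 + f p ^ 2) := by
        refine integral_mono ((hf.comp_add h).sub hf).sq.integrable
          ((i1.fun_add i2).const_mul 2) fun p => ?_
        nlinarith [sq_nonneg (f (p + h) + f p)]
    _ = _ := by
        rw [integral_const_mul, integral_add i1 i2, e]; ring

/-- Control of `a D` and of the gradient of `D` yields control of `(∂_i a) D`. -/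
theorem integral_dd_mul_sq_le {a : Euc N → ℝ} (ha : IsTest a) {D : ℝ × Euc N → ℝ}
    (hD : IsTest D) (i : Fin (N - 1)) {M lam A B : ℝ}
    (hM1 : ∀ y, |dd (EuclideanSpace.single i 1) a y| ≤ M)
    (hM2 : ∀ y, |dd (EuclideanSpace.single i 1) (dd (EuclideanSpace.single i 1) a) y| ≤ M)
    (hl : 0 < lam) (hA : ∫ p, (a p.2 * D p) ^ 2 ≤ lam ^ 2 * A) (hB : ∫ p, D p ^ 2 ≤ B)
    (hB' : ∫ p, dd (eY i) D p ^ 2 ≤ B) :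
    ∫ p, (dd (EuclideanSpace.single i 1) a p.2 * D p) ^ 2 ≤ 3 / 2 * M * lam * (A + B) := by
  have hMnn : 0 ≤ M := (abs_nonneg _).trans (hM1 0)
  have has := ha.smooth
  set b : Euc N → ℝ := dd (EuclideanSpace.single i 1) a with hb
  have hbs : ContDiff ℝ ∞ b := has.dd _
  have hac := has.comp_snd_euc
  have hbc := hbs.comp_snd_euc
  have hDD : IsTest fun p => D p * D p := hD.mul_left hD.smooth
  have hbDD : IsTest fun p : ℝ × Euc N => b p.2 * (D p * D p) := hDD.mul_left hbc
  have e1 : ∫ p, (b p.2 * D p) ^ 2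
      = - ∫ p, dd (eY i) (fun p : ℝ × Euc N => b p.2 * (D p * D p)) p * a p.2 := by
    rw [← integral_mul_dd hbDD hac]
    refine integral_congr_ae (Filter.Eventually.of_forall fun p => ?_)
    simp only [dd_eY_comp_snd has, ← hb]
    ring
  have i1 : Integrable (fun p : ℝ × Euc N => (a p.2 * D p) ^ 2) :=
    (hD.isCc.mul_left hac.continuous).sq.integrable
  have i2 := hD.isCc.sq.integrable (μ := volume)
  have i3 := (hD.dd (eY i)).isCc.sq.integrable (μ := volume)
  rw [e1, ← integral_neg]
  calc ∫ p, -(dd (eY i) (fun p : ℝ × Euc N => b p.2 * (D p * D p)) p * a p.2)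
      ≤ ∫ p, M * (3 / 2 * (lam⁻¹ * (a p.2 * D p) ^ 2) + lam / 2 * D p ^ 2
          + lam * dd (eY i) D p ^ 2) := by
        refine integral_mono ((hbDD.dd (eY i)).isCc.mul_right hac.continuous).integrable.neg
          (((((i1.const_mul _).const_mul _).fun_add (i2.const_mul _)).fun_add
            (i3.const_mul _)).const_mul _) fun p => ?_
        simp only [dd_mul hbc hDD.smooth, dd_mul hD.smooth hD.smooth, dd_eY_comp_snd hbs]
        set P := a p.2 * D p with hP
        set d := dd (eY i) D p
        set b' := dd (EuclideanSpace.single i 1) b p.2 with hb'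
        have key : ∀ x z : ℝ, |x * z| ≤ (lam⁻¹ * x ^ 2 + lam * z ^ 2) / 2 := by
          intro x z
          have : 0 ≤ lam⁻¹ * (|x| - lam * |z|) ^ 2 := by positivity
          have h2 : lam⁻¹ * (|x| - lam * |z|) ^ 2
              = lam⁻¹ * |x| ^ 2 - 2 * (|x| * |z|) + lam * |z| ^ 2 := by field_simp; ring
          rw [abs_mul]
          rw [h2, sq_abs, sq_abs] at this
          linarith
        have k1 : |b' * (P * D p)| ≤ M * ((lam⁻¹ * P ^ 2 + lam * D p ^ 2) / 2) := by
          rw [abs_mul]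
          exact mul_le_mul (hM2 _) (key _ _) (abs_nonneg _) hMnn
        have k2 : |b p.2 * (P * d)| ≤ M * ((lam⁻¹ * P ^ 2 + lam * d ^ 2) / 2) := by
          rw [abs_mul]
          exact mul_le_mul (hM1 _) (key _ _) (abs_nonneg _) hMnn
        have h : -((b' * (D p * D p) + b p.2 * (d * D p + D p * d)) * a p.2)
            = -(b' * (P * D p)) - 2 * (b p.2 * (P * d)) := by rw [hP]; ring
        rw [h]
        linarith [(abs_le.1 k1).1, (abs_le.1 k2).1]
    _ ≤ M * (3 / 2 * (lam * A) + lam / 2 * B + lam * B) := by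
        rw [integral_const_mul, integral_add (((i1.const_mul _).const_mul _).fun_add
          (i2.const_mul _)) (i3.const_mul _), integral_add ((i1.const_mul _).const_mul _)
          (i2.const_mul _), integral_const_mul, integral_const_mul, integral_const_mul,
          integral_const_mul]
        have : lam⁻¹ * ∫ p : ℝ × Euc N, (a p.2 * D p) ^ 2 ≤ lam * A := by
          calc _ ≤ lam⁻¹ * (lam ^ 2 * A) := by gcongr
            _ = lam * A := by field_simp
        gcongr
    _ = _ := by ring

/-- Translation estimates weighted by iterated derivatives of `β`. -/
theorem exists_partials_translate_bound {β : Euc N → ℝ} (hβ : IsTest β) (r : ℕ) :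
    ∀ l : List (Fin (N - 1)), l.length ≤ r → ∃ C : ℝ, 0 ≤ C ∧ ∀ w μ g, DefectEq β w μ g →
      ∀ t : ℝ, 0 < t →
      ∫ p : ℝ × Euc N, (partialsAlong β l p.2 * (w (p + t ^ 2 ^ r • eX N) - w p)) ^ 2
        ≤ C * t ^ 2 ^ (r - l.length) * energy w g := by
  intro l
  induction l with
  | nil =>
    intro _
    obtain ⟨C, hC, h⟩ := exists_weighted_translate_bound hβ
    exact ⟨C, hC, fun w μ g hw t ht => h w μ g hw _ (by positivity)⟩
  | cons i l ih =>
    intro hl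
    rw [List.length_cons] at hl
    obtain ⟨C, hC, h⟩ := ih (by omega)
    have ha := hβ.partialsAlong l
    obtain ⟨M₁, hM₁, h₁⟩ := (ha.dd (EuclideanSpace.single i 1)).exists_abs_le
    obtain ⟨M₂, hM₂, h₂⟩ :=
      ((ha.dd (EuclideanSpace.single i 1)).dd (EuclideanSpace.single i 1)).exists_abs_le
    refine ⟨3 / 2 * (M₁ + M₂) * (C + 4), by positivity, fun w μ g hw t ht => ?_⟩
    set s := t ^ 2 ^ r
    have hD : IsTest fun p => w (p + s • eX N) - w p := (hw.test.comp_add _).sub hw.test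
    have hE := energy_nonneg w g
    have hp : t ^ 2 ^ (r - l.length) = (t ^ 2 ^ (r - (i :: l).length)) ^ 2 := by
      rw [← pow_mul, ← pow_succ, List.length_cons]
      congr 2
      omega
    have := integral_dd_mul_sq_le ha hD i (M := M₁ + M₂) (A := C * energy w g)
      (B := 4 * energy w g) (lam := t ^ 2 ^ (r - (i :: l).length))
      (fun y => (h₁ y).trans (by linarith)) (fun y => (h₂ y).trans (by linarith))
      (by positivity) (by
        have := h w μ g hw t ht
        rw [hp] at this
        linarith) ?_ ?_
    · refine this.trans (le_of_eq ?_)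
      ring
    · exact (hw.test.isCc.integral_translate_sub_sq_le _).trans
        (by linarith [integral_sq_le_energy w g])
    · simp_rw [dd_sub (hw.test.comp_add _).smooth hw.test.smooth, dd_comp_add]
      exact ((hw.test.dd (eY i)).isCc.integral_translate_sub_sq_le _).trans
        (by linarith [integral_dd_sq_le_energy hw.test g i])

end Chain

section Nash

variable {N : ℕ}

/-- A quantitative form of Hörmander's condition on the ball of radius two. -/
structure HormanderBound (β : Euc N → ℝ) (r : ℕ) (Ls : Finset (List (Fin (N - 1)))) (c : ℝ) :
    Prop where
  test : IsTest β
  length_le : ∀ l ∈ Ls, l.length ≤ r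
  pos : 0 < c
  le_sum : ∀ y ∈ closedBall (0 : Euc N) 2, c ≤ ∑ l ∈ Ls, partialsAlong β l y ^ 2

theorem HormanderBound.exists_translate_bound {β : Euc N → ℝ} {r : ℕ}
    {Ls : Finset (List (Fin (N - 1)))} {c : ℝ} (hH : HormanderBound β r Ls c) :
    ∃ C : ℝ, 0 ≤ C ∧ ∀ w μ g, DefectEq β w μ g →
      (∀ p, p.2 ∉ closedBall (0 : Euc N) 2 → w p = 0) → ∀ t : ℝ, 0 < t → t ≤ 1 →
      ∫ p : ℝ × Euc N, (w (p + t ^ 2 ^ r • eX N) - w p) ^ 2 ≤ C * t * energy w g := by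
  have hch : ∀ l : Ls, ∃ C : ℝ, 0 ≤ C ∧ ∀ w μ g, DefectEq β w μ g →
      ∀ t : ℝ, 0 < t →
      ∫ p : ℝ × Euc N, (partialsAlong β l.1 p.2 * (w (p + t ^ 2 ^ r • eX N) - w p)) ^ 2
        ≤ C * t ^ 2 ^ (r - l.1.length) * energy w g := fun l =>
    exists_partials_translate_bound hH.test r l.1 (hH.length_le l.1 l.2)
  choose C hC h using hch
  have hc := hH.pos
  have hS : 0 ≤ ∑ l, C l := Finset.sum_nonneg fun l _ => hC l
  refine ⟨c⁻¹ * ∑ l, C l, by positivity, fun w μ g hw hsupp t ht ht1 => ?_⟩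
  set s := t ^ 2 ^ r
  have hE := energy_nonneg w g
  have hD : IsCc fun p => w (p + s • eX N) - w p := (hw.test.isCc.comp_add _).sub hw.test.isCc
  have hi : ∀ l : Ls, IsCc fun p : ℝ × Euc N =>
      (partialsAlong β l.1 p.2 * (w (p + s • eX N) - w p)) ^ 2 := fun l =>
    (hD.mul_left (hH.test.partialsAlong l.1).smooth.comp_snd_euc.continuous).sq
  have key : c * ∫ p, (w (p + s • eX N) - w p) ^ 2
      ≤ ∑ l : Ls, ∫ p : ℝ × Euc N, (partialsAlong β l.1 p.2 * (w (p + s • eX N) - w p)) ^ 2 := by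
    rw [← integral_const_mul, ← integral_finsetSum _ fun l _ => (hi l).integrable]
    refine integral_mono (hD.sq.integrable.const_mul c) (IsCc.sum _ fun l _ => hi l).integrable
      fun p => ?_
    by_cases hp : p.2 ∈ closedBall (0 : Euc N) 2
    · have := hH.le_sum _ hp
      rw [← Finset.sum_coe_sort] at this
      simp_rw [mul_pow, ← Finset.sum_mul]
      exact mul_le_mul_of_nonneg_right this (sq_nonneg _)
    · have h2 : (p + s • eX N).2 ∉ closedBall (0 : Euc N) 2 := by simpa [eX] using hp
      simp [hsupp _ hp, hsupp _ h2]
  have key2 : ∑ l : Ls, ∫ p : ℝ × Euc N,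
      (partialsAlong β l.1 p.2 * (w (p + s • eX N) - w p)) ^ 2
      ≤ (∑ l, C l) * t * energy w g := by
    rw [Finset.sum_mul, Finset.sum_mul]
    refine Finset.sum_le_sum fun l _ => (h l w μ g hw t ht).trans ?_
    have : t ^ 2 ^ (r - l.1.length) ≤ t :=
      pow_le_of_le_one ht.le ht1 (by positivity)
    have := hC l
    gcongr
  calc _ = c⁻¹ * (c * ∫ p, (w (p + s • eX N) - w p) ^ 2) := by field_simp
    _ ≤ c⁻¹ * ((∑ l, C l) * t * energy w g) := by
        exact mul_le_mul_of_nonneg_left (key.trans key2) (inv_nonneg.2 hc.le)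
    _ = _ := by ring

/-- Integrating the correlation over a set of translations. -/
theorem setIntegral_correlation_le {w : ℝ × Euc N → ℝ} (hw : IsCc w) (h0 : ∀ p, 0 ≤ w p)
    (S : Set (ℝ × Euc N)) :
    IntegrableOn (fun h => ∫ p, w p * w (p + h)) S ∧
      ∫ h in S, ∫ p, w p * w (p + h) ≤ (∫ p, w p) ^ 2 := by
  have hi := hw.integrable (μ := volume)
  have h1 : Integrable (fun z : (ℝ × Euc N) × (ℝ × Euc N) => w z.1 * w (z.1 + z.2))
      (volume.prod volume) :=
    ((measurePreserving_prod_add (volume : Measure (ℝ × Euc N)) volume).integrable_comp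
      (hi.mul_prod hi).aestronglyMeasurable).2 (hi.mul_prod hi)
  have h2 := h1.integral_prod_right
  refine ⟨h2.integrableOn, ?_⟩
  calc ∫ h in S, ∫ p, w p * w (p + h) ≤ ∫ h, ∫ p, w p * w (p + h) :=
        setIntegral_le_integral h2 (Filter.Eventually.of_forall fun h =>
          integral_nonneg fun p => mul_nonneg (h0 _) (h0 _))
    _ = ∫ p, ∫ h, w p * w (p + h) := by
        rw [← integral_prod_symm _ h1, integral_prod _ h1]
    _ = _ := by
        simp_rw [integral_const_mul, integral_add_left_eq_self]
        rw [integral_mul_const]; ring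

/-- A Nash-type inequality. -/
theorem HormanderBound.exists_nash {β : Euc N → ℝ} {r : ℕ}
    {Ls : Finset (List (Fin (N - 1)))} {c : ℝ} (hH : HormanderBound β r Ls c) :
    ∃ C : ℝ, 1 ≤ C ∧ ∃ b : ℕ, ∀ w μ g, DefectEq β w μ g →
      (∀ p, p.2 ∉ closedBall (0 : Euc N) 2 → w p = 0) → ∀ t : ℝ, 0 < t → t ≤ 1 →
      ∫ p : ℝ × Euc N, w p ^ 2 ≤ C * t * energy w g + C * (t⁻¹) ^ b * (∫ p, w p) ^ 2 := by
  obtain ⟨C, hC, hT⟩ := hH.exists_translate_bound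
  set κ := (volume (ball (0 : Euc N) 1)).toReal with hκ
  have hκpos : 0 < κ := ENNReal.toReal_pos (measure_ball_pos _ _ one_pos).ne' measure_ball_lt_top.ne
  refine ⟨C + 2 + κ⁻¹, by linarith [inv_pos.2 hκpos], 2 ^ r * (N - 1 + 1),
    fun w μ g hw hsupp t ht ht1 => ?_⟩
  set ε := t ^ 2 ^ r with hε
  have hεpos : 0 < ε := by positivity
  have hεt : ε ≤ t := pow_le_of_le_one ht.le ht1 (by positivity)
  have hE := energy_nonneg w g
  set S : Set (ℝ × Euc N) := Ioo 0 ε ×ˢ ball 0 ε with hS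
  have hpt : ∀ h ∈ S, (∫ p, w p ^ 2) - (C + 2) * t * energy w g ≤ ∫ p, w p * w (p + h) := by
    rintro ⟨s, y⟩ ⟨⟨hs0, hs1⟩, hy⟩
    simp only at hs0 hs1 hy
    set t' := s ^ ((2 ^ r : ℕ) : ℝ)⁻¹ with ht'
    have hs' : t' ^ 2 ^ r = s := Real.rpow_inv_natCast_pow hs0.le (by positivity)
    have ht'pos : 0 < t' := Real.rpow_pos_of_pos hs0 _
    have ht't : t' ≤ t := by
      by_contra hcon
      push Not at hcon
      have : t ^ 2 ^ r < t' ^ 2 ^ r := pow_lt_pow_left₀ hcon ht.le (by positivity)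
      rw [hs'] at this
      linarith
    have h1 := hT w μ g hw hsupp t' ht'pos (ht't.trans ht1)
    rw [hs'] at h1
    have hy1 : ‖ε⁻¹ • y‖ ≤ 1 := by
      rw [norm_smul, norm_inv, Real.norm_of_nonneg hεpos.le]
      rw [mem_ball_zero_iff] at hy
      rw [inv_mul_le_iff₀ hεpos]
      linarith
    have h2 := integral_translate_y_sub_sq_le (g := g) hw.test _ hy1 hεpos.le
    have hsm : ε • ((0 : ℝ), ε⁻¹ • y) = ((0 : ℝ), y) := by
      simp [smul_smul, hεpos.ne']
    rw [hsm] at h2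
    have h3 : ∫ p, (w (p + (s, y)) - w (p + s • eX N)) ^ 2 = ∫ p, (w (p + (0, y)) - w p) ^ 2 := by
      rw [← integral_add_right_eq_self (fun p => (w (p + (0, y)) - w p) ^ 2) (s • eX N)]
      refine integral_congr_ae (Filter.Eventually.of_forall fun p => ?_)
      simp only [add_assoc]
      congr 4
      simp [eX]
    have hwc := hw.test.isCc
    have i1 := ((hwc.comp_add (s, y)).sub (hwc.comp_add (s • eX N))).sq.integrable (μ := volume)
    have i2 := ((hwc.comp_add (s • eX N)).sub hwc).sq.integrable (μ := volume)
    have h4 : ∫ p, (w (p + (s, y)) - w p) ^ 2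
        ≤ 2 * (∫ p, (w (p + (s, y)) - w (p + s • eX N)) ^ 2)
          + 2 * ∫ p, (w (p + s • eX N) - w p) ^ 2 := by
      rw [← integral_const_mul, ← integral_const_mul,
        ← integral_add (i1.const_mul 2) (i2.const_mul 2)]
      refine integral_mono ((hwc.comp_add (s, y)).sub hwc).sq.integrable
        ((i1.const_mul 2).add (i2.const_mul 2)) fun p => ?_
      simp only
      nlinarith [sq_nonneg ((w (p + (s, y)) - w (p + s • eX N)) - (w (p + s • eX N) - w p))]
    have h5 := integral_translate_sub_sq (a := fun _ => (1 : ℝ)) continuous_const hwc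
      (h := (s, y)) fun _ => rfl
    simp only [one_mul, ← sq] at h5
    have h6 : C * t' * energy w g ≤ C * t * energy w g := by gcongr
    have h7 : 2 * energy w g * ε ≤ 2 * energy w g * t := by gcongr
    linarith
  have hvol : volume.real S = κ * ε ^ (N - 1 + 1) := by
    rw [hS, Measure.volume_eq_prod, Measure.real, Measure.prod_prod, Real.volume_Ioo,
      Measure.addHaar_ball_of_pos _ _ hεpos, ENNReal.toReal_mul, ENNReal.toReal_mul,
      ENNReal.toReal_ofReal (by linarith), ENNReal.toReal_ofReal (by positivity), finrank_euclideanSpace,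
      Fintype.card_fin, ← hκ, pow_succ]
    ring
  have hSm : MeasurableSet S := measurableSet_Ioo.prod measurableSet_ball
  have hSfin : volume S ≠ ⊤ := by
    rw [hS, Measure.volume_eq_prod, Measure.prod_prod]
    exact ENNReal.mul_ne_top (by simp) measure_ball_lt_top.ne
  obtain ⟨j1, j2⟩ := setIntegral_correlation_le hw.test.isCc hw.nonneg S
  have j3 := setIntegral_mono_on (integrableOn_const (C := (∫ p, w p ^ 2)
    - (C + 2) * t * energy w g) hSfin) j1 hSm hpt
  rw [setIntegral_const, hvol, smul_eq_mul] at j3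
  have hεb : (t⁻¹) ^ (2 ^ r * (N - 1 + 1)) = (ε ^ (N - 1 + 1))⁻¹ := by
    rw [hε, ← pow_mul, inv_pow]
  rw [hεb]
  have hV : 0 < κ * ε ^ (N - 1 + 1) := by positivity
  have j4 : (∫ p, w p ^ 2) - (C + 2) * t * energy w g
      ≤ κ⁻¹ * (ε ^ (N - 1 + 1))⁻¹ * (∫ p, w p) ^ 2 := by
    rw [← mul_inv, inv_mul_eq_div, le_div_iff₀ hV, mul_comm]
    exact j3.trans j2
  have hκi : 0 < κ⁻¹ := inv_pos.2 hκpos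
  have j5 : 0 ≤ (C + 2) * ((ε ^ (N - 1 + 1))⁻¹ * (∫ p, w p) ^ 2) := by positivity
  have j6 : 0 ≤ κ⁻¹ * (t * energy w g) := by positivity
  linarith

end Nash

/-! ### Cutoff functions -/

section Cutoff

variable {N : ℕ}

/-- The nested cylinders shrinking to `[0,1] × B̄_1`. -/
def cyl (N : ℕ) (θ : ℝ) : Set (ℝ × Euc N) := Icc (-θ) (1 + θ) ×ˢ closedBall 0 (1 + θ)

theorem isCompact_cyl (θ : ℝ) : IsCompact (cyl N θ) :=
  isCompact_Icc.prod (isCompact_closedBall _ _)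

theorem measurableSet_cyl (θ : ℝ) : MeasurableSet (cyl N θ) :=
  measurableSet_Icc.prod measurableSet_closedBall

theorem cyl_mono {θ θ' : ℝ} (h : θ ≤ θ') : cyl N θ ⊆ cyl N θ' :=
  prod_mono (Icc_subset_Icc (by linarith) (by linarith)) (closedBall_subset_closedBall (by linarith))

/-- `η` is a cutoff function between two cylinders with derivatives bounded by `Λ`. -/
structure IsCutoff (θ θ' Λ : ℝ) (η : ℝ × Euc N → ℝ) : Prop where
  smooth : ContDiff ℝ ∞ η
  nonneg : ∀ p, 0 ≤ η p
  le_one : ∀ p, η p ≤ 1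
  eq_one : ∀ p ∈ cyl N θ, η p = 1
  tsupport_subset : tsupport η ⊆ cyl N θ'
  dX_le : ∀ p, |dd (eX N) η p| ≤ Λ
  dY_le : ∀ i p, |dd (eY i) η p| ≤ Λ
  lap_le : ∀ p, |lapY η p| ≤ Λ

theorem dd_comp_real {F : Type*} [NormedAddCommGroup F] [NormedSpace ℝ F] {S : ℝ → ℝ} {k : F → ℝ}
    (hS : ContDiff ℝ ∞ S) (hk : ContDiff ℝ ∞ k) (v p : F) :
    dd v (fun q => S (k q)) p = dd 1 S (k p) * dd v k p := by
  have h1 := (hS.differentiable (by simp)) (k p)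
  have h2 := (hk.differentiable (by simp)) p
  unfold dd
  have h3 := (h1.hasFDerivAt.comp p h2.hasFDerivAt).fderiv
  rw [show (fun q => S (k q)) = S ∘ k from rfl, h3]
  simp only [ContinuousLinearMap.comp_apply]
  rw [show (fderiv ℝ k p) v = (fderiv ℝ k p) v • (1 : ℝ) by simp, map_smul]
  simp [mul_comm]

theorem isTest_dd_smoothTransition : IsTest (dd (1 : ℝ) Real.smoothTransition) := by
  refine ⟨Real.smoothTransition.contDiff.dd 1, HasCompactSupport.intro (isCompact_Icc (a := 0)
    (b := 1)) fun x hx => ?_⟩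
  unfold dd
  rw [mem_Icc, not_and_or, not_le, not_le] at hx
  rcases hx with hx | hx
  · rw [Filter.EventuallyEq.fderiv_eq (f := fun _ => (0 : ℝ))]
    · simp
    · filter_upwards [Iio_mem_nhds hx] with y hy
      exact Real.smoothTransition.zero_of_nonpos (le_of_lt hy)
  · rw [Filter.EventuallyEq.fderiv_eq (f := fun _ => (1 : ℝ))]
    · simp
    · filter_upwards [Ioi_mem_nhds hx] with y hy
      exact Real.smoothTransition.one_of_one_le (le_of_lt hy)

theorem dd_eY_snd_apply (i : Fin (N - 1)) (p : ℝ × Euc N) :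
    dd (eY i) (fun q : ℝ × Euc N => q.2 i) p = 1 := by
  unfold dd
  have : (fun q : ℝ × Euc N => q.2 i)
      = ((EuclideanSpace.proj i : Euc N →L[ℝ] ℝ) ∘L ContinuousLinearMap.snd ℝ ℝ (Euc N)) := rfl
  rw [this, ContinuousLinearMap.fderiv]
  simp [eY]

theorem dd_eY_norm_sq (i : Fin (N - 1)) (p : ℝ × Euc N) :
    dd (eY i) (fun q : ℝ × Euc N => ‖q.2‖ ^ 2) p = 2 * p.2 i := by
  have h : ContDiff ℝ ∞ fun y : Euc N => ‖y‖ ^ 2 := contDiff_norm_sq ℝ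
  rw [dd_eY_comp_snd h]
  unfold dd
  rw [fderiv_norm_sq_apply]
  simp [EuclideanSpace.inner_single_right]

theorem dd_eX_fst (p : ℝ × Euc N) : dd (eX N) (fun q : ℝ × Euc N => q.1) p = 1 := by
  unfold dd
  have : (fun q : ℝ × Euc N => q.1) = ContinuousLinearMap.fst ℝ ℝ (Euc N) := rfl
  rw [this, ContinuousLinearMap.fderiv]
  simp [eX]

theorem dd_eY_comp_fst {a : ℝ → ℝ} (ha : ContDiff ℝ ∞ a) (i : Fin (N - 1)) (p : ℝ × Euc N) :
    dd (eY i) (fun q : ℝ × Euc N => a q.1) p = 0 := by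
  rw [dd_comp_real (k := fun q : ℝ × Euc N => q.1) ha contDiff_fst]
  have : dd (eY i) (fun q : ℝ × Euc N => q.1) p = 0 := by
    unfold dd
    rw [show (fun q : ℝ × Euc N => q.1) = ContinuousLinearMap.fst ℝ ℝ (Euc N) from rfl,
      ContinuousLinearMap.fderiv]
    simp [eY]
  rw [this, mul_zero]

theorem lapY_eq_zero_of_notMem {φ : ℝ × Euc N → ℝ} {p : ℝ × Euc N} (hp : p ∉ tsupport φ) :
    lapY φ p = 0 := by
  rw [lapY_eq_sum]
  refine Finset.sum_eq_zero fun i _ => dd_eq_zero_of_notMem fun h => hp ?_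
  exact tsupport_fderiv_apply_subset ℝ (eY i) h

theorem dd_const {F : Type*} [NormedAddCommGroup F] [NormedSpace ℝ F] (c : ℝ) (v p : F) :
    dd v (fun _ => c) p = 0 := by simp [dd]

theorem exists_cutoff (N : ℕ) : ∃ K : ℝ, 1 ≤ K ∧ ∀ θ θ' : ℝ, 0 ≤ θ → θ < θ' → θ' ≤ 1 / 2 →
    ∃ η : ℝ × Euc N → ℝ, IsCutoff θ θ' (K / (θ' - θ) ^ 2) η := by
  set S := Real.smoothTransition with hS
  have hSs : ContDiff ℝ ∞ S := Real.smoothTransition.contDiff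
  obtain ⟨K₁, hK₁, hS₁⟩ := isTest_dd_smoothTransition.exists_abs_le
  obtain ⟨K₂, hK₂, hS₂⟩ := (isTest_dd_smoothTransition.dd 1).exists_abs_le
  have hS01 : ∀ x, |S x| ≤ 1 := fun x => by
    rw [abs_of_nonneg (Real.smoothTransition.nonneg x)]; exact Real.smoothTransition.le_one x
  refine ⟨1 + 3 * K₁ + (N - 1 : ℕ) * (9 * K₂ + 2 * K₁), ?_, fun θ θ' h0 h1 h2 => ?_⟩
  · have : (0 : ℝ) ≤ (N - 1 : ℕ) * (9 * K₂ + 2 * K₁) := by positivity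
    linarith
  set K := 1 + 3 * K₁ + (N - 1 : ℕ) * (9 * K₂ + 2 * K₁) with hK
  set δ := θ' - θ with hδ
  have hδ0 : 0 < δ := by linarith
  have hδ1 : δ ≤ 1 := by linarith
  set a : ℝ → ℝ := fun x => S (δ⁻¹ * (x + θ')) * S (δ⁻¹ * (1 + θ' - x)) with ha
  set k : ℝ × Euc N → ℝ := fun p => δ⁻¹ * ((1 + θ') ^ 2 - ‖p.2‖ ^ 2) with hk
  have hks : ContDiff ℝ ∞ k := by
    have : ContDiff ℝ ∞ fun p : ℝ × Euc N => ‖p.2‖ ^ 2 := contDiff_snd.norm_sq ℝ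
    exact contDiff_const.mul (contDiff_const.sub this)
  have has : ContDiff ℝ ∞ a := by
    refine (hSs.comp (?_ : ContDiff ℝ ∞ fun x : ℝ => δ⁻¹ * (x + θ'))).mul
      (hSs.comp (?_ : ContDiff ℝ ∞ fun x : ℝ => δ⁻¹ * (1 + θ' - x)))
    · fun_prop
    · fun_prop
  have hac : ContDiff ℝ ∞ fun p : ℝ × Euc N => a p.1 := has.comp contDiff_fst
  have hbc : ContDiff ℝ ∞ fun p : ℝ × Euc N => S (k p) := hSs.comp hks
  have hS'c : ContDiff ℝ ∞ fun p : ℝ × Euc N => dd 1 S (k p) := (hSs.dd 1).comp hks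
  have hηs := hac.mul hbc
  have ha1 : ∀ x, |a x| ≤ 1 := fun x => by
    rw [ha, abs_mul]
    exact mul_le_one₀ (hS01 _) (abs_nonneg _) (hS01 _)
  have hsupp : tsupport (fun p : ℝ × Euc N => a p.1 * S (k p)) ⊆ cyl N θ' := by
    refine closure_minimal (fun p hp => ?_) (isCompact_cyl θ').isClosed
    by_contra hcon
    refine hp ?_
    have hz : ∀ x, x ≤ 0 → S (δ⁻¹ * x) = 0 := fun x hx =>
      Real.smoothTransition.zero_of_nonpos (mul_nonpos_of_nonneg_of_nonpos (by positivity) hx)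
    rw [cyl, mem_prod, mem_Icc, mem_closedBall_zero_iff, not_and_or, not_and_or] at hcon
    rcases hcon with (hcon | hcon) | hcon
    · simp only [ha]; rw [hz _ (by linarith)]; ring
    · simp only [ha]; rw [hz (1 + θ' - p.1) (by linarith)]; ring
    · simp only [hk]; rw [hz _ (by nlinarith)]; ring
  have hdk : ∀ i p, dd (eY i) k p = δ⁻¹ * (-(2 * p.2 i)) := fun i p => by
    have hn : ContDiff ℝ ∞ fun p : ℝ × Euc N => ‖p.2‖ ^ 2 := contDiff_snd.norm_sq ℝ
    rw [hk, dd_const_mul (contDiff_const.sub hn), dd_sub contDiff_const hn, dd_eY_norm_sq,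
      dd_const, zero_sub]
  have hdY : ∀ i p, dd (eY i) (fun p : ℝ × Euc N => a p.1 * S (k p)) p
      = a p.1 * (dd 1 S (k p) * (δ⁻¹ * (-(2 * p.2 i)))) := fun i p => by
    rw [dd_mul hac hbc, dd_eY_comp_fst has, dd_comp_real hSs hks, hdk]; ring
  have hco : ∀ i : Fin (N - 1), ContDiff ℝ ∞ fun p : ℝ × Euc N => p.2 i := fun i => by fun_prop
  have hddY : ∀ i p, dd (eY i) (dd (eY i) (fun p : ℝ × Euc N => a p.1 * S (k p))) p
      = a p.1 * (dd 1 (dd 1 S) (k p) * (δ⁻¹ * (-(2 * p.2 i))) ^ 2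
        + dd 1 S (k p) * (δ⁻¹ * (-2))) := fun i p => by
    rw [show dd (eY i) (fun p : ℝ × Euc N => a p.1 * S (k p))
      = fun p => a p.1 * (dd 1 S (k p) * (-2 * δ⁻¹ * p.2 i)) from
        funext fun p => (hdY i p).trans (by ring)]
    have hl : ContDiff ℝ ∞ fun p : ℝ × Euc N => -2 * δ⁻¹ * p.2 i := contDiff_const.mul (hco i)
    rw [dd_mul hac (hS'c.mul hl), dd_mul hS'c hl, dd_eY_comp_fst has, dd_comp_real (hSs.dd 1) hks,
      hdk, dd_const_mul (hco i), dd_eY_snd_apply]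
    ring
  have hiδ : 1 ≤ δ⁻¹ := (one_le_inv₀ hδ0).2 hδ1
  have hyi : ∀ p ∈ cyl N θ', ∀ i, |p.2 i| ≤ 3 / 2 := fun p hp i => by
    have h3 : ‖p.2‖ ≤ 1 + θ' := by simpa using hp.2
    have := PiLp.norm_apply_le p.2 i
    rw [Real.norm_eq_abs] at this
    linarith
  have hKδ : K / δ ^ 2 = K * δ⁻¹ * δ⁻¹ := by field_simp
  have hK0 : 0 ≤ K := by rw [hK]; positivity
  have hKδ' : K * δ⁻¹ ≤ K / δ ^ 2 := by
    rw [hKδ]; exact le_mul_of_one_le_right (by positivity) hiδ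
  have hN0 : (0 : ℝ) ≤ (N - 1 : ℕ) * (9 * K₂ + 2 * K₁) := by positivity
  refine ⟨fun p => a p.1 * S (k p), hηs, fun p => ?_, fun p => ?_, fun p hp => ?_, hsupp,
    fun p => ?_, fun i p => ?_, fun p => ?_⟩
  · exact mul_nonneg (mul_nonneg (Real.smoothTransition.nonneg _) (Real.smoothTransition.nonneg _))
      (Real.smoothTransition.nonneg _)
  · refine (le_abs_self _).trans ?_
    rw [abs_mul]
    exact mul_le_one₀ (ha1 _) (abs_nonneg _) (hS01 _)
  · have ho : ∀ x, δ ≤ x → S (δ⁻¹ * x) = 1 := fun x hx =>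
      Real.smoothTransition.one_of_one_le (by rwa [inv_mul_eq_div, one_le_div hδ0])
    obtain ⟨⟨h3, h4⟩, h5⟩ := hp
    rw [mem_closedBall_zero_iff] at h5
    simp only [ha, hk]
    rw [ho _ (by linarith), ho _ (by linarith), ho _ (by nlinarith [norm_nonneg p.2])]
    norm_num
  · have hl1 : ContDiff ℝ ∞ fun p : ℝ × Euc N => δ⁻¹ * (p.1 + θ') := by fun_prop
    have hl2 : ContDiff ℝ ∞ fun p : ℝ × Euc N => δ⁻¹ * (1 + θ' - p.1) := by fun_prop
    have e1 : dd (eX N) (fun p : ℝ × Euc N => δ⁻¹ * (p.1 + θ')) p = δ⁻¹ := by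
      rw [dd_const_mul (by fun_prop), dd_add contDiff_fst contDiff_const, dd_eX_fst, dd_const]
      ring
    have e2 : dd (eX N) (fun p : ℝ × Euc N => δ⁻¹ * (1 + θ' - p.1)) p = -δ⁻¹ := by
      rw [dd_const_mul (by fun_prop), dd_sub contDiff_const contDiff_fst, dd_eX_fst, dd_const]
      ring
    have e3 : dd (eX N) (fun p : ℝ × Euc N => S (k p)) p = 0 := by
      have : ContDiff ℝ ∞ fun y : Euc N => S (δ⁻¹ * ((1 + θ') ^ 2 - ‖y‖ ^ 2)) :=
        hSs.comp (contDiff_const.mul (contDiff_const.sub (contDiff_norm_sq ℝ)))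
      exact dd_eX_comp_snd this p
    rw [dd_mul hac hbc, e3, mul_zero, add_zero]
    simp only [ha]
    rw [dd_mul (f := fun p : ℝ × Euc N => S (δ⁻¹ * (p.1 + θ')))
      (g := fun p : ℝ × Euc N => S (δ⁻¹ * (1 + θ' - p.1))) (hSs.comp hl1) (hSs.comp hl2),
      dd_comp_real hSs hl1, dd_comp_real hSs hl2, e1, e2]
    have hb : ∀ x y z : ℝ, |dd 1 S x * δ⁻¹ * S y * S z| ≤ K₁ * δ⁻¹ := by
      intro x y z
      rw [abs_mul, abs_mul, abs_mul, abs_of_pos (inv_pos.2 hδ0)]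
      calc |dd 1 S x| * δ⁻¹ * |S y| * |S z| ≤ K₁ * δ⁻¹ * 1 * 1 := by
            gcongr
            · exact hS₁ x
            · exact hS01 y
            · exact hS01 z
        _ = _ := by ring
    refine le_trans ?_ hKδ'
    have b1 := abs_le.1 (hb (δ⁻¹ * (p.1 + θ')) (δ⁻¹ * (1 + θ' - p.1)) (k p))
    have b2 := abs_le.1 (hb (δ⁻¹ * (1 + θ' - p.1)) (δ⁻¹ * (p.1 + θ')) (k p))
    have b3 : 2 * K₁ * δ⁻¹ ≤ K * δ⁻¹ := by gcongr; rw [hK]; linarith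
    rw [abs_le]
    constructor <;> nlinarith [b1.1, b1.2, b2.1, b2.2]
  · by_cases hp : p ∈ tsupport (fun p : ℝ × Euc N => a p.1 * S (k p))
    · rw [hdY]
      refine le_trans ?_ hKδ'
      have h3 := hyi p (hsupp hp) i
      rw [abs_mul (a p.1), abs_mul (dd 1 S (k p)), abs_mul δ⁻¹, abs_neg, abs_mul 2,
        abs_of_pos (inv_pos.2 hδ0), abs_two]
      calc |a p.1| * (|dd 1 S (k p)| * (δ⁻¹ * (2 * |p.2 i|)))
          ≤ 1 * (K₁ * (δ⁻¹ * (2 * (3 / 2)))) := by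
            gcongr
            · exact ha1 _
            · exact hS₁ _
        _ = 3 * K₁ * δ⁻¹ := by ring
        _ ≤ K * δ⁻¹ := by gcongr; rw [hK]; linarith
    · rw [dd_eq_zero_of_notMem hp, abs_zero]; positivity
  · by_cases hp : p ∈ tsupport (fun p : ℝ × Euc N => a p.1 * S (k p))
    · rw [lapY_eq_sum]
      refine (Finset.abs_sum_le_sum_abs _ _).trans ?_
      have : ∀ i ∈ (Finset.univ : Finset (Fin (N - 1))),
          |dd (eY i) (dd (eY i) (fun p : ℝ × Euc N => a p.1 * S (k p))) p|
          ≤ (9 * K₂ + 2 * K₁) * δ⁻¹ * δ⁻¹ := fun i _ => by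
        rw [hddY, abs_mul]
        have h3 := hyi p (hsupp hp) i
        have h4 : |dd 1 (dd 1 S) (k p) * (δ⁻¹ * (-(2 * p.2 i))) ^ 2
            + dd 1 S (k p) * (δ⁻¹ * (-2))| ≤ (9 * K₂ + 2 * K₁) * δ⁻¹ * δ⁻¹ := by
          refine (abs_add_le _ _).trans ?_
          rw [abs_mul, abs_mul (dd 1 S (k p)), abs_mul δ⁻¹ (-2), abs_neg, abs_two, abs_pow,
            abs_mul, abs_neg, abs_mul, abs_two, abs_of_pos (inv_pos.2 hδ0)]
          calc |dd 1 (dd 1 S) (k p)| * (δ⁻¹ * (2 * |p.2 i|)) ^ 2 + |dd 1 S (k p)| * (δ⁻¹ * 2)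
              ≤ K₂ * (δ⁻¹ * (2 * (3 / 2))) ^ 2 + K₁ * (δ⁻¹ * 2) * δ⁻¹ := by
                refine add_le_add ?_ ?_
                · gcongr
                  exact hS₂ _
                · calc |dd 1 S (k p)| * (δ⁻¹ * 2) ≤ K₁ * (δ⁻¹ * 2) := by gcongr; exact hS₁ _
                    _ ≤ _ := le_mul_of_one_le_right (by positivity) hiδ
            _ = _ := by ring
        calc _ ≤ 1 * ((9 * K₂ + 2 * K₁) * δ⁻¹ * δ⁻¹) :=
              mul_le_mul (ha1 _) h4 (abs_nonneg _) zero_le_one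
          _ = _ := one_mul _
      refine (Finset.sum_le_sum this).trans ?_
      rw [Finset.sum_const, Finset.card_univ, Fintype.card_fin, nsmul_eq_mul, hKδ, ← mul_assoc,
        ← mul_assoc]
      gcongr
      rw [hK]; linarith
    · rw [lapY_eq_zero_of_notMem hp, abs_zero]; positivity

end Cutoff

/-! ### Energy estimates for powers of a positive solution -/

section Energy

variable {N : ℕ}

/-- For `W = log u` this is `(Δ_y u + β u_x) / u`. -/
def logOp (β : Euc N → ℝ) (W : ℝ × Euc N → ℝ) (p : ℝ × Euc N) : ℝ :=
  lapY W p + β p.2 * dX W p + gradSq W p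

theorem lapY_mul {f g : ℝ × Euc N → ℝ} (hf : ContDiff ℝ ∞ f) (hg : ContDiff ℝ ∞ g)
    (p : ℝ × Euc N) :
    lapY (fun q => f q * g q) p
      = f p * lapY g p + 2 * (∑ i, dd (eY i) f p * dd (eY i) g p) + g p * lapY f p := by
  simp_rw [lapY_eq_sum, Finset.mul_sum, ← Finset.sum_add_distrib]
  refine Finset.sum_congr rfl fun i _ => ?_
  rw [show dd (eY i) (fun q => f q * g q) = fun q => dd (eY i) f q * g q + f q * dd (eY i) g q from
    funext fun q => dd_mul hf hg _ q, dd_add ((hf.dd _).mul hg) (hf.mul (hg.dd _)),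
    dd_mul (hf.dd _) hg, dd_mul hf (hg.dd _)]
  ring

theorem ContDiff.exp_const_mul {W : ℝ × Euc N → ℝ} (hW : ContDiff ℝ ∞ W) (q : ℝ) :
    ContDiff ℝ ∞ fun p => Real.exp (q * W p) := (contDiff_const.mul hW).exp

theorem dd_exp_const_mul {W : ℝ × Euc N → ℝ} (hW : ContDiff ℝ ∞ W) (q : ℝ) (v p : ℝ × Euc N) :
    dd v (fun p => Real.exp (q * W p)) p = q * Real.exp (q * W p) * dd v W p := by
  rw [dd_exp (contDiff_const.mul hW), dd_const_mul hW]
  ring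

theorem lapY_exp_const_mul {W : ℝ × Euc N → ℝ} (hW : ContDiff ℝ ∞ W) (q : ℝ) (p : ℝ × Euc N) :
    lapY (fun p => Real.exp (q * W p)) p
      = Real.exp (q * W p) * (q * lapY W p + q ^ 2 * gradSq W p) := by
  simp_rw [lapY_eq_sum, gradSq, Finset.mul_sum, ← Finset.sum_add_distrib, Finset.mul_sum]
  refine Finset.sum_congr rfl fun i _ => ?_
  rw [show dd (eY i) (fun p => Real.exp (q * W p))
    = fun p => q * Real.exp (q * W p) * dd (eY i) W p from
    funext fun p => dd_exp_const_mul hW q _ p,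
    dd_mul (contDiff_const.mul (hW.exp_const_mul q)) (hW.dd _), dd_const_mul (hW.exp_const_mul q),
    dd_exp_const_mul hW]
  ring

theorem integral_le_setIntegral {K : Set (ℝ × Euc N)} (hK : IsCompact K) {f h : ℝ × Euc N → ℝ}
    (hf : IsCc f) (hh : Continuous h) (h0 : ∀ p, p ∉ K → f p = 0) (hle : ∀ p ∈ K, f p ≤ h p) :
    ∫ p, f p ≤ ∫ p in K, h p := by
  rw [← setIntegral_eq_integral_of_forall_compl_eq_zero h0]
  exact setIntegral_mono_on hf.integrable.integrableOn (hh.continuousOn.integrableOn_compact hK)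
    hK.measurableSet hle

theorem IsCutoff.isTest {θ θ' Λ : ℝ} {η : ℝ × Euc N → ℝ} (hη : IsCutoff θ θ' Λ η) : IsTest η :=
  ⟨hη.smooth, (isCompact_cyl θ').of_isClosed_subset (isClosed_tsupport _) hη.tsupport_subset⟩

theorem IsCutoff.eq_zero {θ θ' Λ : ℝ} {η : ℝ × Euc N → ℝ} (hη : IsCutoff θ θ' Λ η)
    {p : ℝ × Euc N} (hp : p ∉ cyl N θ') : η p = 0 :=
  image_eq_zero_of_notMem_tsupport fun h => hp (hη.tsupport_subset h)

theorem gradSq_cross_sq_le (f g : ℝ × Euc N → ℝ) (p : ℝ × Euc N) :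
    (∑ i, dd (eY i) f p * dd (eY i) g p) ^ 2 ≤ gradSq f p * gradSq g p :=
  Finset.sum_mul_sq_le_sq_mul_sq _ _ _

theorem IsCutoff.gradSq_le {θ θ' Λ : ℝ} {η : ℝ × Euc N → ℝ} (hη : IsCutoff θ θ' Λ η)
    (p : ℝ × Euc N) : gradSq η p ≤ (N - 1 : ℕ) * Λ ^ 2 := by
  calc gradSq η p ≤ ∑ _i : Fin (N - 1), Λ ^ 2 := Finset.sum_le_sum fun i _ => by
        rw [← sq_abs]
        exact pow_le_pow_left₀ (abs_nonneg _) (hη.dY_le i p) 2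
    _ = _ := by simp

/-- Integrals of functions supported in the outer cylinder. -/
theorem IsCutoff.integral_le {θ θ' Λ : ℝ} {η : ℝ × Euc N → ℝ} (hη : IsCutoff θ θ' Λ η)
    {v G : ℝ × Euc N → ℝ} (hv : Continuous v) (hG : Continuous G) (a c : ℝ)
    {f : ℝ × Euc N → ℝ} (hf : IsCc f) (h0 : ∀ p, p ∉ cyl N θ' → f p = 0)
    (hle : ∀ p ∈ cyl N θ', f p ≤ a * (η p ^ 2 * v p ^ 2 * G p) + c * v p ^ 2) :
    ∫ p, f p ≤ a * (∫ p, η p ^ 2 * v p ^ 2 * G p) + c * ∫ p in cyl N θ', v p ^ 2 := by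
  have hYcc : IsCc fun p => η p ^ 2 * v p ^ 2 * G p :=
    (hη.isTest.isCc.sq.mul_right (hv.pow 2)).mul_right hG
  have hvi : IntegrableOn (fun p => v p ^ 2) (cyl N θ') :=
    (hv.pow 2).continuousOn.integrableOn_compact (isCompact_cyl θ')
  refine (integral_le_setIntegral (isCompact_cyl θ') hf ?_ h0 hle).trans (le_of_eq ?_)
  · exact (continuous_const.mul hYcc.cont).add (continuous_const.mul (hv.pow 2))
  · rw [integral_add (hYcc.integrable.integrableOn.const_mul a) (hvi.const_mul c),
      integral_const_mul, integral_const_mul,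
      setIntegral_eq_integral_of_forall_compl_eq_zero fun p hp => by rw [hη.eq_zero hp]; ring]

set_option maxHeartbeats 1000000 in
/-- The Caccioppoli inequality for `exp (q W)`. -/
theorem caccioppoli {β : Euc N → ℝ} (hβ : ContDiff ℝ ∞ β) {M : ℝ} (hM : ∀ y, |β y| ≤ M)
    {W : ℝ × Euc N → ℝ} (hW : ContDiff ℝ ∞ W) {q : ℝ} (hq : |q| ≤ 2 * |2 * q - 1|)
    {θ θ' Λ : ℝ} {η : ℝ × Euc N → ℝ} (hη : IsCutoff θ θ' Λ η) (hΛ : 1 ≤ Λ)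
    (hH : ∀ p ∈ cyl N θ', |logOp β W p| ≤ 1) :
    q ^ 2 * ∫ p, η p ^ 2 * Real.exp (q * W p) ^ 2 * gradSq W p
      ≤ 4 * (1 + 4 * (N - 1 : ℕ) + M) * ((1 + q ^ 2) * Λ ^ 2)
        * ∫ p in cyl N θ', Real.exp (q * W p) ^ 2 := by
  have hMnn : 0 ≤ M := (abs_nonneg _).trans (hM 0)
  set v : ℝ × Euc N → ℝ := fun p => Real.exp (q * W p) with hv
  have hvs : ContDiff ℝ ∞ v := hW.exp_const_mul q
  have hvv : ContDiff ℝ ∞ fun p => v p * v p := hvs.mul hvs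
  have hηt := hη.isTest
  have hηη : IsTest fun p => η p * η p := hηt.mul_left hη.smooth
  have hT : IsTest fun p => v p * v p * (η p * η p) := hηη.mul_left hvv
  have hβc := hβ.comp_snd_euc
  set n : ℝ := ((N - 1 : ℕ) : ℝ) with hn
  set I := ∫ p in cyl N θ', v p ^ 2 with hI
  set Y := ∫ p, η p ^ 2 * v p ^ 2 * gradSq W p with hY
  have hYcc : IsCc fun p => η p ^ 2 * v p ^ 2 * gradSq W p :=
    (hηt.isCc.sq.mul_right (hvs.continuous.pow 2)).mul_right hW.continuous_gradSq
  have hY0 : 0 ≤ Y := integral_nonneg fun p => by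
    have := gradSq_nonneg W p
    positivity
  have hI0 : 0 ≤ I := integral_nonneg fun p => sq_nonneg _
  have hG := hW.continuous_gradSq
  have bd := fun a c f => hη.integral_le hvs.continuous hG a c (f := f)
  set X : ℝ × Euc N → ℝ := fun p => 2 * η p * v p ^ 2 * ∑ i, dd (eY i) η p * dd (eY i) W p with hX
  have hXcc : IsCc X := by
    have : Continuous fun p => ∑ i, dd (eY i) η p * dd (eY i) W p :=
      continuous_finsetSum _ fun i _ => ((hη.smooth.dd _).mul (hW.dd _)).continuous
    exact ((hηt.isCc.const_mul 2).mul_right (hvs.continuous.pow 2)).mul_right this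
  have e1 : ∫ p, v p * v p * (η p * η p) * lapY W p = -(∫ p, X p) - 2 * q * Y := by
    rw [integral_mul_lapY hT hW, ← integral_finsetSum _ fun i _ =>
      ((hT.dd (eY i)).isCc.mul_right (hW.dd (eY i)).continuous).integrable, ← integral_const_mul,
      ← neg_inj, neg_neg, neg_sub, sub_neg_eq_add,
      ← integral_add (hYcc.const_mul _).integrable hXcc.integrable]
    refine integral_congr_ae (Filter.Eventually.of_forall fun p => ?_)
    simp only [hX, gradSq, Finset.mul_sum, ← Finset.sum_add_distrib]
    refine Finset.sum_congr rfl fun i _ => ?_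
    rw [dd_mul hvv hηη.smooth, dd_mul hvs hvs, dd_mul hη.smooth hη.smooth, hv,
      dd_exp_const_mul hW]
    ring
  set B := ∫ p, β p.2 * η p * dd (eX N) η p * v p ^ 2 with hB
  have hBcc : IsCc fun p : ℝ × Euc N => β p.2 * η p * dd (eX N) η p * v p ^ 2 :=
    ((hηt.isCc.mul_left hβc.continuous).mul_right (hη.smooth.dd _).continuous).mul_right
      (hvs.continuous.pow 2)
  have e2 : q * ∫ p, v p * v p * (η p * η p) * (β p.2 * dX W p) = -B := by
    have := integral_mul_dd (μ := volume) (hηη.mul_left hβc) hvv (eX N)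
    rw [← mul_right_inj' (two_ne_zero (α := ℝ)), ← mul_assoc, ← integral_const_mul, hB, mul_neg,
      ← integral_const_mul]
    convert this using 1
    · refine integral_congr_ae (Filter.Eventually.of_forall fun p => ?_)
      simp only
      rw [dd_mul hvs hvs, hv, dd_exp_const_mul hW, dX_eq_dd]
      ring
    · congr 1
      refine integral_congr_ae (Filter.Eventually.of_forall fun p => ?_)
      simp only
      rw [dd_mul hβc hηη.smooth, dd_mul hη.smooth hη.smooth, dd_eX_comp_snd hβ]
      ring
  set Hh := ∫ p, v p * v p * (η p * η p) * logOp β W p with hHh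
  have hlc : Continuous (logOp β W) :=
    (hW.lapY.continuous.add (hβc.continuous.mul (hW.dd (eX N)).continuous)).add hG
  have e3 : (∫ p, v p * v p * (η p * η p) * lapY W p)
      + (∫ p, v p * v p * (η p * η p) * (β p.2 * dX W p)) + Y = Hh := by
    have j1 := (hT.isCc.mul_right hW.lapY.continuous).integrable (μ := volume)
    have j2 : Integrable fun p => v p * v p * (η p * η p) * (β p.2 * dX W p) :=
      (hT.isCc.mul_right (hβc.continuous.mul (hW.dd (eX N)).continuous)).integrable
    rw [← integral_add j1 j2, ← integral_add (j1.fun_add j2) hYcc.integrable]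
    refine integral_congr_ae (Filter.Eventually.of_forall fun p => ?_)
    simp only [logOp]
    ring
  have hηsq : ∀ p, η p ^ 2 ≤ 1 := fun p => pow_le_one₀ (hη.nonneg p) (hη.le_one p)
  have hvp : ∀ p, 0 ≤ v p ^ 2 := fun p => sq_nonneg _
  have b1 : |Hh| ≤ I := by
    have := bd 0 1 _ ((hT.isCc.mul_right hlc).abs) (fun p hp => by rw [hη.eq_zero hp]; simp)
      fun p hp => ?_
    · exact (abs_integral_le_integral_abs).trans (by linarith)
    · rw [abs_mul, abs_of_nonneg (by have := hη.nonneg p; positivity)]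
      have h1 := hH p hp
      calc v p * v p * (η p * η p) * |logOp β W p| ≤ v p * v p * (η p * η p) * 1 := by
            gcongr
            have := hη.nonneg p
            positivity
        _ = v p ^ 2 * η p ^ 2 := by ring
        _ ≤ v p ^ 2 * 1 := mul_le_mul_of_nonneg_left (hηsq p) (hvp p)
        _ = _ := by ring
  have b2 : |q * ∫ p, X p| ≤ q ^ 2 / 4 * Y + 4 * n * Λ ^ 2 * I := by
    have := bd (q ^ 2 / 4) (4 * n * Λ ^ 2) _ ((hXcc.const_mul q).abs)
      (fun p hp => by simp [hX, hη.eq_zero hp]) fun p hp => ?_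
    · rw [← integral_const_mul]
      exact (abs_integral_le_integral_abs).trans this
    · have h1 := gradSq_cross_sq_le η W p
      have h2 := hη.gradSq_le p
      have h3 := gradSq_nonneg W p
      set Z := ∑ i, dd (eY i) η p * dd (eY i) W p
      have h4 : Z ^ 2 ≤ n * Λ ^ 2 * gradSq W p := h1.trans (by gcongr)
      have e : q * X p = v p ^ 2 * (2 * q * η p * Z) := by simp only [hX]; ring
      rw [e, abs_mul, abs_of_nonneg (hvp p)]
      have h5 : |2 * q * η p * Z| ≤ q ^ 2 / 4 * (η p ^ 2 * gradSq W p) + 4 * n * Λ ^ 2 := by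
        have hn0 : 0 ≤ n := Nat.cast_nonneg _
        refine abs_le_of_sq_le_sq ?_ (by positivity)
        have h6 : (2 * q * η p * Z) ^ 2 ≤ 4 * q ^ 2 * η p ^ 2 * (n * Λ ^ 2 * gradSq W p) := by
          calc (2 * q * η p * Z) ^ 2 = 4 * q ^ 2 * η p ^ 2 * Z ^ 2 := by ring
            _ ≤ _ := by gcongr
        nlinarith [sq_nonneg (q ^ 2 / 4 * (η p ^ 2 * gradSq W p) - 4 * n * Λ ^ 2)]
      calc _ ≤ v p ^ 2 * (q ^ 2 / 4 * (η p ^ 2 * gradSq W p) + 4 * n * Λ ^ 2) :=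
            mul_le_mul_of_nonneg_left h5 (hvp p)
        _ = _ := by ring
  have b3 : |B| ≤ M * Λ * I := by
    have := bd 0 (M * Λ) _ hBcc.abs (fun p hp => by simp [hη.eq_zero hp]) fun p hp => ?_
    · exact (abs_integral_le_integral_abs).trans (by linarith)
    · rw [abs_mul, abs_of_nonneg (hvp p), abs_mul, abs_mul, zero_mul, zero_add]
      refine mul_le_mul_of_nonneg_right ?_ (hvp p)
      calc |β p.2| * |η p| * |dd (eX N) η p| ≤ M * 1 * Λ := by
            gcongr
            · exact hM _
            · rw [abs_of_nonneg (hη.nonneg p)]; exact hη.le_one p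
            · exact hη.dX_le p
        _ = _ := by ring
  have main : (2 * q ^ 2 - q) * Y = -(q * Hh) - q * (∫ p, X p) - B := by
    have := congrArg (fun x => q * x) e3
    simp only [mul_add] at this
    rw [e1, e2] at this
    linarith
  have c1 : q ^ 2 / 2 * Y ≤ |(2 * q ^ 2 - q) * Y| := by
    rw [abs_mul, abs_of_nonneg hY0]
    refine mul_le_mul_of_nonneg_right ?_ hY0
    rw [show 2 * q ^ 2 - q = q * (2 * q - 1) by ring, abs_mul, ← sq_abs]
    nlinarith [abs_nonneg q]
  have c2 : |q * Hh| ≤ (1 + q ^ 2) * I := by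
    rw [abs_mul]
    refine mul_le_mul ?_ b1 (abs_nonneg _) (by positivity)
    nlinarith [sq_nonneg (|q| - 1), sq_abs q]
  have c3 : |(2 * q ^ 2 - q) * Y| ≤ |q * Hh| + |q * ∫ p, X p| + |B| := by
    rw [main]
    refine (abs_sub _ _).trans (add_le_add ((abs_sub _ _).trans ?_) le_rfl)
    rw [abs_neg]
  have c4 : q ^ 2 * Y ≤ 4 * ((1 + q ^ 2) + 4 * n * Λ ^ 2 + M * Λ) * I := by linarith
  refine c4.trans (mul_le_mul_of_nonneg_right ?_ hI0)
  have hn0 : 0 ≤ n := Nat.cast_nonneg _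
  have hΛ2 : 1 ≤ Λ ^ 2 := one_le_pow₀ hΛ
  have hΛ3 : Λ ≤ Λ ^ 2 := by nlinarith
  have d1 : (1 + q ^ 2) ≤ (1 + q ^ 2) * Λ ^ 2 := le_mul_of_one_le_right (by positivity) hΛ2
  have d2 : Λ ^ 2 ≤ (1 + q ^ 2) * Λ ^ 2 := le_mul_of_one_le_left (by positivity) (by nlinarith)
  have d3 := mul_le_mul_of_nonneg_left (hΛ3.trans d2) hMnn
  have d4 := mul_le_mul_of_nonneg_left d2 hn0
  nlinarith

end Energy

section EnergyBound

variable {N : ℕ}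

set_option maxHeartbeats 1000000 in
/-- The localized powers satisfy an equation with one-signed defect and bounded energy. -/
theorem exists_defectEq_energy_le {β : Euc N → ℝ} (hβ : IsTest β) :
    ∃ C : ℝ, 1 ≤ C ∧ ∀ W : ℝ × Euc N → ℝ, ContDiff ℝ ∞ W → ∀ q : ℝ, |q| ≤ 2 * |2 * q - 1| →
      ∀ (θ θ' Λ : ℝ) (η : ℝ × Euc N → ℝ), IsCutoff θ θ' Λ η → 1 ≤ Λ →
      (∀ p ∈ cyl N θ', |logOp β W p| ≤ 1) →
      ∃ μ g, DefectEq β (fun p => Real.exp (q * W p) * (η p * η p)) μ g ∧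
        energy (fun p => Real.exp (q * W p) * (η p * η p)) g
          ≤ C * ((1 + q ^ 2) * Λ ^ 4) * ∫ p in cyl N θ', Real.exp (q * W p) ^ 2 := by
  obtain ⟨M, hMnn, hM⟩ := hβ.exists_abs_le
  set n : ℝ := ((N - 1 : ℕ) : ℝ) with hn
  have hn0 : 0 ≤ n := Nat.cast_nonneg _
  set C₁ := 4 * (1 + 4 * n + M) with hC₁
  have hC₁0 : 0 ≤ C₁ := by positivity
  refine ⟨(2 + 48 * n) * C₁ + 8 * n + 4 + 12 * (1 + M + n) ^ 2, ?_,
    fun W hW q hq θ θ' Λ η hη hΛ hH => ?_⟩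
  · have : 0 ≤ (2 + 48 * n) * C₁ := by positivity
    nlinarith [sq_nonneg (1 + M + n)]
  have hcac := caccioppoli hβ.smooth hM hW hq hη hΛ hH
  set v : ℝ × Euc N → ℝ := fun p => Real.exp (q * W p) with hv
  have hvs : ContDiff ℝ ∞ v := hW.exp_const_mul q
  have hv0 : ∀ p, 0 ≤ v p := fun p => (Real.exp_pos _).le
  have hηt := hη.isTest
  have hηη : IsTest fun p => η p * η p := hηt.mul_left hη.smooth
  have hw : IsTest fun p => v p * (η p * η p) := hηη.mul_left hvs
  have hβc := hβ.smooth.comp_snd_euc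
  have hG := hW.continuous_gradSq
  have hηsq : ∀ p, η p ^ 2 ≤ 1 := fun p => pow_le_one₀ (hη.nonneg p) (hη.le_one p)
  have hη4 : ∀ p, η p ^ 4 ≤ η p ^ 2 := fun p =>
    pow_le_pow_of_le_one (hη.nonneg p) (hη.le_one p) (by norm_num)
  set μ : ℝ × Euc N → ℝ := fun p => (q ^ 2 - q) * (v p * gradSq W p * (η p * η p)) with hμ
  have hμcc : IsCc μ := (hηη.isCc.mul_left (hvs.continuous.mul hG)).const_mul _
  set g : ℝ × Euc N → ℝ := fun p => lapY (fun p => v p * (η p * η p)) p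
    + β p.2 * dX (fun p => v p * (η p * η p)) p - μ p with hg
  have hgcc : IsCc g :=
    (hw.lapY.add ((hw.dd (eX N)).isCc.mul_left hβc.continuous)).sub hμcc
  have hdef : DefectEq β (fun p => v p * (η p * η p)) μ g := by
    refine ⟨hw, fun p => mul_nonneg (hv0 p) (mul_self_nonneg _), hμcc, hgcc,
      fun p => by simp only [hg]; ring, ?_⟩
    have hnn : ∀ p, 0 ≤ v p * gradSq W p * (η p * η p) := fun p =>
      mul_nonneg (mul_nonneg (hv0 p) (gradSq_nonneg W p)) (mul_self_nonneg _)
    rcases le_total 0 (q ^ 2 - q) with h | h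
    · exact Or.inl fun p => mul_nonneg h (hnn p)
    · exact Or.inr fun p => mul_nonpos_of_nonpos_of_nonneg h (hnn p)
  have hgeq : ∀ p, g p = v p * (q * logOp β W p * η p ^ 2
      + 4 * q * η p * (∑ i, dd (eY i) η p * dd (eY i) W p)
      + (2 * η p * (lapY η p + β p.2 * dd (eX N) η p) + 2 * gradSq η p)) := by
    intro p
    simp only [hg, hμ, logOp, dX_eq_dd]
    rw [lapY_mul hvs hηη.smooth, lapY_mul hη.smooth hη.smooth, dd_mul hvs hηη.smooth,
      dd_mul hη.smooth hη.smooth, hv, lapY_exp_const_mul hW, dd_exp_const_mul hW]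
    have : ∑ i, dd (eY i) (fun p => Real.exp (q * W p)) p * dd (eY i) (fun p => η p * η p) p
        = 2 * q * Real.exp (q * W p) * η p * ∑ i, dd (eY i) η p * dd (eY i) W p := by
      rw [Finset.mul_sum]
      refine Finset.sum_congr rfl fun i _ => ?_
      rw [dd_exp_const_mul hW, dd_mul hη.smooth hη.smooth]
      ring
    rw [this, show ∑ i, dd (eY i) η p * dd (eY i) η p = gradSq η p from
      Finset.sum_congr rfl fun i _ => (sq _).symm]
    ring
  refine ⟨μ, g, hdef, ?_⟩
  set I := ∫ p in cyl N θ', v p ^ 2 with hI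
  set Y := ∫ p, η p ^ 2 * v p ^ 2 * gradSq W p with hY
  have hI0 : 0 ≤ I := integral_nonneg fun p => sq_nonneg _
  have b1 : ∫ p, gradSq (fun p => v p * (η p * η p)) p ≤ 2 * q ^ 2 * Y + 8 * n * Λ ^ 2 * I := by
    have hform : ∀ p, gradSq (fun p => v p * (η p * η p)) p
        = v p ^ 2 * ∑ i, (q * η p ^ 2 * dd (eY i) W p + 2 * η p * dd (eY i) η p) ^ 2 := by
      intro p
      rw [gradSq, Finset.mul_sum]
      refine Finset.sum_congr rfl fun i _ => ?_
      rw [dd_mul hvs hηη.smooth, dd_mul hη.smooth hη.smooth, hv, dd_exp_const_mul hW]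
      ring
    refine hη.integral_le hvs.continuous hG _ _ hw.gradSq (fun p hp => ?_) fun p hp => ?_
    · rw [hform, hη.eq_zero hp]; simp
    · rw [hform]
      have h1 : ∑ i, (q * η p ^ 2 * dd (eY i) W p + 2 * η p * dd (eY i) η p) ^ 2
          ≤ ∑ i, (2 * q ^ 2 * η p ^ 2 * dd (eY i) W p ^ 2 + 8 * dd (eY i) η p ^ 2) := by
        refine Finset.sum_le_sum fun i _ => ?_
        set x := dd (eY i) W p
        set z := dd (eY i) η p
        have k1 : q ^ 2 * x ^ 2 * η p ^ 4 ≤ q ^ 2 * x ^ 2 * η p ^ 2 :=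
          mul_le_mul_of_nonneg_left (hη4 p) (by positivity)
        have k2 : z ^ 2 * η p ^ 2 ≤ z ^ 2 * 1 := by gcongr; exact hηsq p
        nlinarith [sq_nonneg (q * η p ^ 2 * x - 2 * η p * z)]
      rw [Finset.sum_add_distrib, ← Finset.mul_sum, ← Finset.mul_sum] at h1
      have h2 := hη.gradSq_le p
      have h3 : ∑ i, (q * η p ^ 2 * dd (eY i) W p + 2 * η p * dd (eY i) η p) ^ 2
          ≤ 2 * q ^ 2 * η p ^ 2 * gradSq W p + 8 * n * Λ ^ 2 := by
        unfold gradSq at h2 ⊢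
        linarith
      calc _ ≤ v p ^ 2 * (2 * q ^ 2 * η p ^ 2 * gradSq W p + 8 * n * Λ ^ 2) :=
            mul_le_mul_of_nonneg_left h3 (sq_nonneg _)
        _ = _ := by ring
  have b2 : ∫ p, (v p * (η p * η p)) ^ 2 ≤ 0 * Y + 1 * I := by
    refine hη.integral_le hvs.continuous hG _ _ hw.isCc.sq (fun p hp => ?_) fun p hp => ?_
    · rw [hη.eq_zero hp]; simp
    · calc (v p * (η p * η p)) ^ 2 = v p ^ 2 * η p ^ 4 := by ring
        _ ≤ v p ^ 2 * 1 := by gcongr; exact (hη4 p).trans (hηsq p)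
        _ = _ := by ring
  have hΛ2 : 1 ≤ Λ ^ 2 := one_le_pow₀ hΛ
  have hΛ3 : Λ ≤ Λ ^ 2 := by nlinarith
  have b3 : ∫ p, g p ^ 2 ≤ 48 * n * Λ ^ 2 * q ^ 2 * Y
      + (3 * q ^ 2 + 12 * (1 + M + n) ^ 2 * Λ ^ 4) * I := by
    refine hη.integral_le hvs.continuous hG _ _ hgcc.sq (fun p hp => ?_) fun p hp => ?_
    · have hp' : p ∉ tsupport η := fun h => hp (hη.tsupport_subset h)
      rw [hgeq, hη.eq_zero hp, gradSq]
      simp [dd_eq_zero_of_notMem hp']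
    · rw [hgeq]
      set Z := ∑ i, dd (eY i) η p * dd (eY i) W p
      set Hp := logOp β W p
      set D := lapY η p + β p.2 * dd (eX N) η p
      have hGW := gradSq_nonneg W p
      have h2 := hη.gradSq_le p
      have h4 : Z ^ 2 ≤ n * Λ ^ 2 * gradSq W p :=
        (gradSq_cross_sq_le η W p).trans (mul_le_mul_of_nonneg_right h2 hGW)
      have hH1 : Hp ^ 2 ≤ 1 := by
        rw [← sq_abs]; exact pow_le_one₀ (abs_nonneg _) (hH p hp)
      have k1 : (q * Hp * η p ^ 2) ^ 2 ≤ q ^ 2 := by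
        calc (q * Hp * η p ^ 2) ^ 2 = q ^ 2 * (Hp ^ 2 * η p ^ 4) := by ring
          _ ≤ q ^ 2 * (1 * 1) := by
              gcongr
              exact (hη4 p).trans (hηsq p)
          _ = _ := by ring
      have k2 : (4 * q * η p * Z) ^ 2 ≤ 16 * n * Λ ^ 2 * q ^ 2 * (η p ^ 2 * gradSq W p) := by
        calc (4 * q * η p * Z) ^ 2 = 16 * q ^ 2 * η p ^ 2 * Z ^ 2 := by ring
          _ ≤ 16 * q ^ 2 * η p ^ 2 * (n * Λ ^ 2 * gradSq W p) := by gcongr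
          _ = _ := by ring
      have hD : |D| ≤ (1 + M) * Λ ^ 2 := by
        have h5 : |β p.2 * dd (eX N) η p| ≤ M * Λ := by
          rw [abs_mul]
          exact mul_le_mul (hM _) (hη.dX_le p) (abs_nonneg _) hMnn
        have h6 := (abs_add_le (lapY η p) (β p.2 * dd (eX N) η p)).trans
          (add_le_add (hη.lap_le p) h5)
        refine h6.trans ?_
        calc Λ + M * Λ = (1 + M) * Λ := by ring
          _ ≤ _ := by gcongr
      have k3 : (2 * η p * D + 2 * gradSq η p) ^ 2 ≤ 4 * (1 + M + n) ^ 2 * Λ ^ 4 := by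
        have h7 : |2 * η p * D + 2 * gradSq η p| ≤ 2 * (1 + M + n) * Λ ^ 2 := by
          refine (abs_add_le _ _).trans ?_
          rw [abs_mul, abs_mul, abs_two, abs_of_nonneg (hη.nonneg p), abs_mul, abs_two,
            abs_of_nonneg (gradSq_nonneg η p)]
          have h8 : η p * |D| ≤ 1 * ((1 + M) * Λ ^ 2) :=
            mul_le_mul (hη.le_one p) hD (abs_nonneg _) zero_le_one
          linarith
        rw [← sq_abs]
        calc _ ≤ (2 * (1 + M + n) * Λ ^ 2) ^ 2 := pow_le_pow_left₀ (abs_nonneg _) h7 2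
          _ = _ := by ring
      have k4 : ∀ a b c : ℝ, (a + b + c) ^ 2 ≤ 3 * (a ^ 2 + b ^ 2 + c ^ 2) := fun a b c => by
        nlinarith [sq_nonneg (a - b), sq_nonneg (b - c), sq_nonneg (a - c)]
      rw [mul_pow]
      calc _ ≤ v p ^ 2 * (3 * (q ^ 2 + 16 * n * Λ ^ 2 * q ^ 2 * (η p ^ 2 * gradSq W p)
            + 4 * (1 + M + n) ^ 2 * Λ ^ 4)) := by
            refine mul_le_mul_of_nonneg_left ((k4 _ _ _).trans ?_) (sq_nonneg _)
            linarith
        _ = _ := by ring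
  have hL : Λ ^ 2 ≤ Λ ^ 4 := by nlinarith
  have hL1 : 1 ≤ Λ ^ 4 := hΛ2.trans hL
  set R := (1 + q ^ 2) * Λ ^ 4 with hR
  have hR1 : Λ ^ 4 ≤ R := le_mul_of_one_le_left (by positivity) (by nlinarith)
  have hR2 : 1 + q ^ 2 ≤ R := le_mul_of_one_le_right (by positivity) hL1
  have hR0 : 0 ≤ R := by positivity
  -- the terms carrying the weighted gradient
  have y1 : q ^ 2 * Y ≤ C₁ * R * I := by
    refine hcac.trans ?_
    rw [hR]; gcongr
  have y2 : Λ ^ 2 * (q ^ 2 * Y) ≤ C₁ * R * I := by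
    calc _ ≤ Λ ^ 2 * (C₁ * ((1 + q ^ 2) * Λ ^ 2) * I) := by gcongr
      _ = _ := by rw [hR]; ring
  have y3 := mul_le_mul_of_nonneg_left y2 hn0
  have z1 : n * Λ ^ 2 * I ≤ n * R * I := by gcongr; exact hL.trans hR1
  have z2 : q ^ 2 * I ≤ R * I := by gcongr; linarith
  have z3 : (1 + M + n) ^ 2 * Λ ^ 4 * I ≤ (1 + M + n) ^ 2 * R * I := by gcongr
  have z4 : I ≤ R * I := le_mul_of_one_le_left hI0 (by nlinarith)
  unfold energy
  linarith

end EnergyBound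

section Moser

variable {N : ℕ}

/-- Giusti's iteration lemma: an inequality with a contraction factor on nested intervals can be
absorbed. -/
theorem le_of_contraction_on_intervals (B : ℕ) : ∃ C : ℝ, 1 ≤ C ∧ ∀ (f : ℝ → ℝ) (a b A M : ℝ),
    a < b → 0 ≤ A → (∀ s ∈ Icc a b, f s ≤ M) →
    (∀ s t, a ≤ s → s < t → t ≤ b → f s ≤ 7 / 8 * f t + A / (t - s) ^ B) →
    f a ≤ C * (A / (b - a) ^ B) := by
  set σ : ℝ := 1 / (16 * (B + 1)) with hσ
  have hσ0 : 0 < σ := by positivity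
  have hσ1 : σ ≤ 1 / 16 := by
    rw [hσ]; apply one_div_le_one_div_of_le (by norm_num); nlinarith [Nat.cast_nonneg (α := ℝ) B]
  set τ := 1 - σ with hτ
  have hτ0 : 0 < τ := by linarith
  have hτB : 15 / 16 ≤ τ ^ B := by
    have h := one_add_mul_le_pow (a := -σ) (by linarith) B
    have h2 : (B : ℝ) * σ ≤ 1 / 16 := by
      rw [hσ, mul_one_div, div_le_div_iff₀ (by positivity) (by norm_num)]
      nlinarith [Nat.cast_nonneg (α := ℝ) B]
    have h3 : (1 + -σ) = τ := by rw [hτ]; ring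
    rw [h3] at h
    linarith
  have hC : (1 : ℝ) ≤ 15 / σ ^ B := by
    rw [le_div_iff₀ (by positivity)]
    have : σ ^ B ≤ 1 := pow_le_one₀ hσ0.le (by linarith)
    linarith
  refine ⟨15 / σ ^ B, hC, fun f a b A M hab hA hM hf => ?_⟩
  set L := b - a with hL
  have hL0 : 0 < L := by linarith
  set D := A / (σ * L) ^ B with hD
  have hD0 : 0 ≤ D := by positivity
  have hstep : ∀ k : ℕ, f a ≤ (7 / 8) ^ k * f (a + (1 - τ ^ k) * L)
      + D * ∑ i ∈ Finset.range k, (14 / 15 : ℝ) ^ i := by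
    intro k
    induction k with
    | zero => simp
    | succ k ih =>
      have hk0 : 0 < τ ^ k := by positivity
      have hk1 : τ ^ k ≤ 1 := pow_le_one₀ hτ0.le (by linarith)
      have hk2 : τ ^ (k + 1) = τ ^ k * τ := pow_succ _ _
      have h1 := hf (a + (1 - τ ^ k) * L) (a + (1 - τ ^ (k + 1)) * L) (by nlinarith) (by
        have : τ ^ k * τ < τ ^ k * 1 := mul_lt_mul_of_pos_left (by linarith) hk0
        rw [hk2]; nlinarith) (by
        have : 0 < τ ^ (k + 1) := by positivity
        nlinarith)
      have h2 : a + (1 - τ ^ (k + 1)) * L - (a + (1 - τ ^ k) * L) = τ ^ k * (σ * L) := by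
        rw [hk2, hτ]; ring
      rw [h2, mul_pow] at h1
      have h3 : (7 / 8 : ℝ) ^ k * (A / ((τ ^ k) ^ B * (σ * L) ^ B)) ≤ D * (14 / 15) ^ k := by
        have e1 : (7 / 8 : ℝ) ^ k * (A / ((τ ^ k) ^ B * (σ * L) ^ B))
            = D * ((7 / 8) / τ ^ B) ^ k := by
          rw [hD, div_pow (7 / 8) (τ ^ B) k, ← pow_mul, ← pow_mul, mul_comm k B]
          field_simp
        rw [e1]
        refine mul_le_mul_of_nonneg_left (pow_le_pow_left₀ (by positivity) ?_ k) hD0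
        rw [div_le_iff₀ (by positivity)]; linarith
      have h4 := mul_le_mul_of_nonneg_left h1 (by positivity : (0 : ℝ) ≤ (7 / 8) ^ k)
      rw [Finset.sum_range_succ, mul_add, pow_succ]
      linarith
  have hsum : ∀ k : ℕ, ∑ i ∈ Finset.range k, (14 / 15 : ℝ) ^ i ≤ 15 := by
    intro k
    have h := (geom_sum_mul (14 / 15 : ℝ) k)
    have : (0 : ℝ) < (14 / 15) ^ k := by positivity
    linarith
  have hlim : ∀ k : ℕ, f a ≤ (7 / 8) ^ k * M + D * 15 := by
    intro k
    have hk0 : 0 < τ ^ k := by positivity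
    have hk1 : τ ^ k ≤ 1 := pow_le_one₀ hτ0.le (by linarith)
    have h1 := hM (a + (1 - τ ^ k) * L) ⟨by nlinarith, by nlinarith⟩
    have h2 := mul_le_mul_of_nonneg_left h1 (by positivity : (0 : ℝ) ≤ (7 / 8) ^ k)
    have h3 := mul_le_mul_of_nonneg_left (hsum k) hD0
    linarith [hstep k]
  have ht : Filter.Tendsto (fun k : ℕ => (7 / 8 : ℝ) ^ k * M + D * 15) Filter.atTop
      (nhds (0 * M + D * 15)) :=
    ((tendsto_pow_atTop_nhds_zero_of_lt_one (by norm_num) (by norm_num)).mul_const M).add_const _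
  have h := ge_of_tendsto' ht hlim
  have e : 0 * M + D * 15 = 15 / σ ^ B * (A / L ^ B) := by
    rw [hD, mul_pow]; field_simp; ring
  linarith

/-- Integral of `exp (q W)` over a cylinder. -/
def expInt (W : ℝ × Euc N → ℝ) (q θ : ℝ) : ℝ := ∫ p in cyl N θ, Real.exp (q * W p)

theorem integrableOn_cyl {f : ℝ × Euc N → ℝ} (hf : Continuous f) (θ : ℝ) :
    IntegrableOn f (cyl N θ) :=
  hf.continuousOn.integrableOn_compact (isCompact_cyl θ)

theorem expInt_nonneg (W : ℝ × Euc N → ℝ) (q θ : ℝ) : 0 ≤ expInt W q θ :=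
  integral_nonneg fun _ => (Real.exp_pos _).le

theorem expInt_mono {W : ℝ × Euc N → ℝ} (hW : Continuous W) (q : ℝ) {θ θ' : ℝ} (h : θ ≤ θ') :
    expInt W q θ ≤ expInt W q θ' :=
  setIntegral_mono_set (integrableOn_cyl (by fun_prop) θ')
    (Filter.Eventually.of_forall fun _ => (Real.exp_pos _).le) (cyl_mono h).eventuallyLE

set_option maxHeartbeats 1000000 in
theorem HormanderBound.exists_gain {β : Euc N → ℝ} {r : ℕ} {Ls : Finset (List (Fin (N - 1)))}
    {c : ℝ} (h : HormanderBound β r Ls c) :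
    ∃ C : ℝ, 1 ≤ C ∧ ∃ b : ℕ, ∀ W : ℝ × Euc N → ℝ, ContDiff ℝ ∞ W →
      ∀ q : ℝ, |q| ≤ 2 * |2 * q - 1| → ∀ θ θ' : ℝ, 0 ≤ θ → θ < θ' → θ' ≤ 1 / 2 →
      (∀ p ∈ cyl N θ', |logOp β W p| ≤ 1) →
      expInt W (2 * q) θ ≤ 1 / 2 * expInt W (2 * q) θ'
        + C * ((1 + q ^ 2) / (θ' - θ) ^ 8) ^ b * expInt W q θ' ^ 2 := by
  obtain ⟨C, hC, b, hnash⟩ := h.exists_nash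
  obtain ⟨C', hC', hen⟩ := exists_defectEq_energy_le h.test
  obtain ⟨K, hK, hcut⟩ := exists_cutoff N
  have hbig : 1 ≤ 2 * C * C' * K ^ 4 := by
    have h1 : 1 ≤ C * C' := one_le_mul_of_one_le_of_one_le hC hC'
    have h2 : 1 ≤ K ^ 4 := one_le_pow₀ hK
    nlinarith [one_le_mul_of_one_le_of_one_le h1 h2]
  refine ⟨C * (2 * C * C' * K ^ 4) ^ b, one_le_mul_of_one_le_of_one_le hC (one_le_pow₀ hbig), b,
    fun W hW q hq θ θ' h0 hlt hhalf hH => ?_⟩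
  obtain ⟨η, hη⟩ := hcut θ θ' h0 hlt hhalf
  set δ := θ' - θ with hδ
  have hδ0 : 0 < δ := by linarith
  have hδ1 : δ ≤ 1 := by linarith
  have hΛ : 1 ≤ K / δ ^ 2 := by
    rw [le_div_iff₀ (by positivity)]
    have : δ ^ 2 ≤ 1 := pow_le_one₀ hδ0.le hδ1
    linarith
  obtain ⟨μ, g, hdef, hE⟩ := hen W hW q hq θ θ' _ η hη hΛ hH
  set v : ℝ × Euc N → ℝ := fun p => Real.exp (q * W p) with hv
  have hvc : Continuous v := by have := hW.continuous; fun_prop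
  have hv0 : ∀ p, 0 < v p := fun p => Real.exp_pos _
  set w : ℝ × Euc N → ℝ := fun p => Real.exp (q * W p) * (η p * η p) with hw
  have hwc : IsCc w := ((hη.isTest.mul_left hη.smooth).mul_left (hW.exp_const_mul q)).isCc
  have hv2 : ∀ p, Real.exp (2 * q * W p) = v p ^ 2 := by
    intro p; rw [hv, ← Real.exp_nat_mul]; congr 1; push_cast; ring
  have hexp2 : ∀ s, expInt W (2 * q) s = ∫ p in cyl N s, v p ^ 2 := by
    intro s; simp only [expInt, hv2]
  have hη01 : ∀ p, 0 ≤ η p * η p ∧ η p * η p ≤ 1 := fun p =>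
    ⟨mul_self_nonneg _, mul_le_one₀ (hη.le_one p) (hη.nonneg p) (hη.le_one p)⟩
  have hw0 : ∀ p, p ∉ cyl N θ' → w p = 0 := fun p hp => by
    simp [hw, hη.eq_zero hp]
  have hlow : ∫ p in cyl N θ, v p ^ 2 ≤ ∫ p, w p ^ 2 := by
    calc ∫ p in cyl N θ, v p ^ 2 = ∫ p in cyl N θ, w p ^ 2 := by
          refine setIntegral_congr_fun (measurableSet_cyl θ) fun p hp => ?_
          simp [hw, hv, hη.eq_one p hp]
      _ ≤ ∫ p, w p ^ 2 := setIntegral_le_integral hwc.sq.integrable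
          (Filter.Eventually.of_forall fun p => sq_nonneg _)
  have hw1 : ∫ p, w p ≤ expInt W q θ' := by
    rw [← setIntegral_eq_integral_of_forall_compl_eq_zero hw0]
    refine setIntegral_mono hwc.integrable.integrableOn (integrableOn_cyl hvc θ') fun p => ?_
    have := (hη01 p).2
    exact mul_le_of_le_one_right (hv0 p).le this
  have hw10 : 0 ≤ ∫ p, w p := integral_nonneg fun p => mul_nonneg (hv0 p).le (hη01 p).1
  have hsupp : ∀ p : ℝ × Euc N, p.2 ∉ closedBall (0 : Euc N) 2 → w p = 0 := fun p hp =>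
    hw0 p fun hp' => hp (closedBall_subset_closedBall (by linarith) hp'.2)
  set t := δ ^ 8 / (2 * C * C' * K ^ 4 * (1 + q ^ 2)) with ht
  have hq1 : 1 ≤ 1 + q ^ 2 := by nlinarith [sq_nonneg q]
  have ht0 : 0 < t := by positivity
  have ht1 : t ≤ 1 := by
    rw [ht, div_le_one (by positivity)]
    exact (pow_le_one₀ hδ0.le hδ1).trans (one_le_mul_of_one_le_of_one_le hbig hq1)
  have hN := hnash w μ g hdef hsupp t ht0 ht1
  have hE2 : C * t * energy w g ≤ 1 / 2 * expInt W (2 * q) θ' := by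
    rw [hexp2]
    calc C * t * energy w g ≤ C * t * (C' * ((1 + q ^ 2) * (K / δ ^ 2) ^ 4)
          * ∫ p in cyl N θ', v p ^ 2) := mul_le_mul_of_nonneg_left hE (by positivity)
      _ = 1 / 2 * ∫ p in cyl N θ', v p ^ 2 := by
        rw [ht]; field_simp
  have hL : C * t⁻¹ ^ b * (∫ p, w p) ^ 2 ≤
      C * (2 * C * C' * K ^ 4) ^ b * ((1 + q ^ 2) / δ ^ 8) ^ b * expInt W q θ' ^ 2 := by
    have e : t⁻¹ = (2 * C * C' * K ^ 4) * ((1 + q ^ 2) / δ ^ 8) := by rw [ht]; field_simp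
    rw [e, mul_pow, ← mul_assoc]
    exact mul_le_mul_of_nonneg_left (pow_le_pow_left₀ hw10 hw1 2) (by positivity)
  rw [hexp2 θ]
  linarith

theorem HormanderBound.exists_reverse_holder {β : Euc N → ℝ} {r : ℕ}
    {Ls : Finset (List (Fin (N - 1)))} {c : ℝ} (h : HormanderBound β r Ls c) :
    ∃ C : ℝ, 1 ≤ C ∧ ∃ b B : ℕ, ∀ W : ℝ × Euc N → ℝ, ContDiff ℝ ∞ W →
      (∀ p ∈ cyl N (1 / 2), |logOp β W p| ≤ 1) →
      ∀ q : ℝ, |q| ≤ 2 * |2 * q - 1| → ∀ θ θ' : ℝ, 0 ≤ θ → θ < θ' → θ' ≤ 1 / 2 →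
      expInt W (2 * q) θ ≤ C * (1 + q ^ 2) ^ b / (θ' - θ) ^ B * expInt W q θ' ^ 2 := by
  obtain ⟨C, hC, b, hg⟩ := h.exists_gain
  obtain ⟨C', hC', hit⟩ := le_of_contraction_on_intervals (8 * b)
  refine ⟨C' * C, one_le_mul_of_one_le_of_one_le hC' hC, b, 8 * b,
    fun W hW hH q hq θ θ' h0 hlt hhalf => ?_⟩
  have := hit (expInt W (2 * q)) θ θ' (C * (1 + q ^ 2) ^ b * expInt W q θ' ^ 2)
    (expInt W (2 * q) θ') hlt (by positivity) (fun s hs => expInt_mono hW.continuous _ hs.2)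
    (fun s t hs hst ht => by
      have h1 := hg W hW q hq s t (h0.trans hs) hst (ht.trans hhalf)
        (fun p hp => hH p (cyl_mono (ht.trans hhalf) hp))
      have h2 : expInt W q t ^ 2 ≤ expInt W q θ' ^ 2 :=
        pow_le_pow_left₀ (expInt_nonneg _ _ _) (expInt_mono hW.continuous _ ht) 2
      have hts : 0 < t - s := by linarith
      have h3 := mul_le_mul_of_nonneg_left h2
        (by positivity : 0 ≤ C * ((1 + q ^ 2) / (t - s) ^ 8) ^ b)
      have h4 : C * ((1 + q ^ 2) / (t - s) ^ 8) ^ b * expInt W q θ' ^ 2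
          = C * (1 + q ^ 2) ^ b * expInt W q θ' ^ 2 / (t - s) ^ (8 * b) := by
        rw [div_pow, ← pow_mul]; ring
      have h5 := expInt_nonneg W (2 * q) t
      linarith)
  refine this.trans (le_of_eq ?_)
  ring

/-- Exponents admissible for the Caccioppoli inequality. -/
theorem abs_le_of_le_or_ge {q : ℝ} (hq : q ≤ 2 / 5 ∨ 2 / 3 ≤ q) : |q| ≤ 2 * |2 * q - 1| := by
  rcases hq with hq | hq
  · rw [abs_le]
    have := neg_le_abs (2 * q - 1)
    constructor <;> linarith [abs_nonneg (2 * q - 1)]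
  · rw [abs_of_nonneg (by linarith), abs_of_nonneg (by linarith)]
    linarith

theorem dyadic_le_or_ge (k j : ℕ) {s : ℝ} (hs : s = 1 ∨ s = -1) :
    2 ^ j * (s / (3 * 2 ^ k)) ≤ 2 / 5 ∨ 2 / 3 ≤ 2 ^ j * (s / (3 * 2 ^ k)) := by
  have hk : (0 : ℝ) < 3 * 2 ^ k := by positivity
  rcases hs with rfl | rfl
  · rcases le_or_gt j k with h | h
    · left
      have : (2 : ℝ) ^ j ≤ 2 ^ k := pow_le_pow_right₀ (by norm_num) h
      rw [mul_one_div, div_le_iff₀ hk]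
      linarith [pow_pos (two_pos (α := ℝ)) k]
    · right
      have : (2 : ℝ) ^ (k + 1) ≤ 2 ^ j := pow_le_pow_right₀ (by norm_num) h
      rw [pow_succ] at this
      rw [mul_one_div, le_div_iff₀ hk]
      linarith [pow_pos (two_pos (α := ℝ)) k]
  · left
    have : (2 : ℝ) ^ j * (-1 / (3 * 2 ^ k)) ≤ 0 :=
      mul_nonpos_of_nonneg_of_nonpos (by positivity) (div_nonpos_of_nonpos_of_nonneg (by norm_num) hk.le)
    linarith

theorem cyl_mem_nhds {θ θ' : ℝ} (h : θ < θ') {z : ℝ × Euc N} (hz : z ∈ cyl N θ) :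
    cyl N θ' ∈ nhds z := by
  refine prod_mem_nhds (Icc_mem_nhds (by linarith [hz.1.1]) (by linarith [hz.1.2])) ?_
  refine Filter.mem_of_superset (isOpen_ball.mem_nhds ?_) ball_subset_closedBall
  exact closedBall_subset_ball (by linarith) hz.2

set_option maxHeartbeats 1000000 in
/-- Moser's local boundedness estimate for small powers. -/
theorem HormanderBound.exists_exp_le {β : Euc N → ℝ} {r : ℕ}
    {Ls : Finset (List (Fin (N - 1)))} {c : ℝ} (h : HormanderBound β r Ls c) :
    ∃ C : ℝ, 1 ≤ C ∧ ∃ B : ℕ, ∀ W : ℝ × Euc N → ℝ, ContDiff ℝ ∞ W →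
      (∀ p ∈ cyl N (1 / 2), |logOp β W p| ≤ 1) → ∀ (k : ℕ) (s : ℝ), s = 1 ∨ s = -1 →
      ∀ θ θ' : ℝ, 0 ≤ θ → θ < θ' → θ' ≤ 1 / 2 → ∀ z ∈ cyl N θ,
      Real.exp (s / (3 * 2 ^ k) * W z) ≤ C / (θ' - θ) ^ B * expInt W (s / (3 * 2 ^ k)) θ' := by
  obtain ⟨C, hC, b, B, hrev⟩ := h.exists_reverse_holder
  set A : ℝ := 4 ^ b * 2 ^ B with hA
  have hA1 : 1 ≤ A := one_le_mul_of_one_le_of_one_le (one_le_pow₀ (by norm_num))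
    (one_le_pow₀ (by norm_num))
  refine ⟨C * 2 ^ b * 4 ^ B * A, ?_, B, fun W hW hH k s hs θ θ' h0 hlt hhalf z hz => ?_⟩
  · have h2 : (1 : ℝ) ≤ 2 ^ b := one_le_pow₀ (by norm_num)
    have h4 : (1 : ℝ) ≤ 4 ^ B := one_le_pow₀ (by norm_num)
    exact one_le_mul_of_one_le_of_one_le (one_le_mul_of_one_le_of_one_le
      (one_le_mul_of_one_le_of_one_le hC h2) h4) hA1
  set q := s / (3 * 2 ^ k) with hq
  have hq1 : q ^ 2 ≤ 1 := by
    have h3 : (1 : ℝ) ≤ 3 * 2 ^ k := by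
      have : (1 : ℝ) ≤ 2 ^ k := one_le_pow₀ (by norm_num)
      linarith
    rw [hq, div_pow, div_le_one (by positivity)]
    have : s ^ 2 = 1 := by rcases hs with rfl | rfl <;> norm_num
    rw [this]; exact one_le_pow₀ h3
  set δ := θ' - θ with hδ
  have hδ0 : 0 < δ := by linarith
  have hδ1 : δ ≤ 1 := by linarith
  set K := C * 2 ^ b * 4 ^ B / δ ^ B with hK
  have hK1 : 1 ≤ K := by
    have h1 : δ ^ B ≤ 1 := pow_le_one₀ hδ0.le hδ1
    have h2 : (1 : ℝ) ≤ 2 ^ b := one_le_pow₀ (by norm_num)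
    have h4 : (1 : ℝ) ≤ 4 ^ B := one_le_pow₀ (by norm_num)
    rw [hK, le_div_iff₀ (by positivity)]
    have := one_le_mul_of_one_le_of_one_le (one_le_mul_of_one_le_of_one_le hC h2) h4
    linarith
  set ϑ : ℕ → ℝ := fun j => θ + δ / 2 + δ / 2 * (1 / 2) ^ j with hϑ
  set n : ℕ → ℝ := fun j => expInt W (2 ^ j * q) (ϑ j) with hn
  have hn0 : ∀ j, 0 ≤ n j := fun j => expInt_nonneg _ _ _
  have hstep : ∀ j, n (j + 1) ≤ K * A ^ j * n j ^ 2 := by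
    intro j
    have hp : (0 : ℝ) < (1 / 2) ^ j := by positivity
    have hp1 : (1 / 2 : ℝ) ^ j ≤ 1 := pow_le_one₀ (by norm_num) (by norm_num)
    have e1 : ϑ j - ϑ (j + 1) = δ / (4 * 2 ^ j) := by
      simp only [hϑ, pow_succ, one_div, inv_pow]; field_simp; ring
    have hpos : 0 < δ / (4 * 2 ^ j) := by positivity
    have h1 := hrev W hW hH (2 ^ j * q) (abs_le_of_le_or_ge (dyadic_le_or_ge k j hs))
      (ϑ (j + 1)) (ϑ j) (by positivity) (by linarith) (by
        simp only [hϑ]; nlinarith)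
    rw [e1] at h1
    have e2 : (2 : ℝ) * (2 ^ j * q) = 2 ^ (j + 1) * q := by ring
    rw [e2] at h1
    refine h1.trans (mul_le_mul_of_nonneg_right ?_ (sq_nonneg _))
    have h2 : 1 + (2 ^ j * q) ^ 2 ≤ 2 * 4 ^ j := by
      have : (1 : ℝ) ≤ 4 ^ j := one_le_pow₀ (by norm_num)
      have e : ((2 : ℝ) ^ j * q) ^ 2 = 4 ^ j * q ^ 2 := by
        rw [mul_pow, ← pow_mul, mul_comm j 2, pow_mul]; norm_num
      rw [e]; nlinarith
    have h3 : (1 + (2 ^ j * q) ^ 2) ^ b ≤ (2 * 4 ^ j) ^ b := pow_le_pow_left₀ (by positivity) h2 b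
    calc C * (1 + (2 ^ j * q) ^ 2) ^ b / (δ / (4 * 2 ^ j)) ^ B
        ≤ C * (2 * 4 ^ j) ^ b / (δ / (4 * 2 ^ j)) ^ B := by
          refine div_le_div_of_nonneg_right ?_ (by positivity)
          exact mul_le_mul_of_nonneg_left h3 (by linarith)
      _ = K * A ^ j := by
          rw [hK, hA, div_pow, mul_pow, mul_pow, mul_pow, ← pow_mul, ← pow_mul, ← pow_mul, ← pow_mul,
            mul_comm j b, mul_comm j B]
          field_simp
  have ha : ∀ j, K * A ^ (j + 1) * n j ≤ (K * A * n 0) ^ 2 ^ j := by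
    intro j
    induction j with
    | zero => simp
    | succ j ih =>
      have h1 := pow_le_pow_left₀ (by have := hn0 j; positivity) ih 2
      rw [← pow_mul, ← pow_succ] at h1
      refine le_trans ?_ h1
      have h2 := mul_le_mul_of_nonneg_left (hstep j) (by positivity : 0 ≤ K * A ^ (j + 1 + 1))
      refine h2.trans (le_of_eq ?_)
      ring
  have hn00 : n 0 = expInt W q θ' := by
    simp only [hn, hϑ, pow_zero, one_mul]; congr 1; rw [hδ]; ring
  have hgoal : C * 2 ^ b * 4 ^ B * A / δ ^ B * expInt W q θ' = K * A * n 0 := by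
    rw [hn00, hK]; ring
  rw [hgoal]
  by_contra! hcon
  set a := K * A * n 0 with ha0
  have ha_nn : 0 ≤ a := by have := hn0 0; positivity
  obtain ⟨κ, hκ1, hκ2⟩ := exists_between hcon
  have hκ0 : 0 < κ := by linarith
  have hcont : Continuous fun p => Real.exp (q * W p) := by have := hW.continuous; fun_prop
  have hO : {p | κ < Real.exp (q * W p)} ∩ interior (cyl N (θ + δ / 2)) ∈ nhds z :=
    Filter.inter_mem ((isOpen_lt continuous_const hcont).mem_nhds hκ2)
      (interior_mem_nhds.2 (cyl_mem_nhds (by linarith) hz))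
  set O := {p | κ < Real.exp (q * W p)} ∩ interior (cyl N (θ + δ / 2)) with hOdef
  have hOopen : IsOpen O := (isOpen_lt continuous_const hcont).inter isOpen_interior
  have hOsub : O ⊆ cyl N (θ + δ / 2) := inter_subset_right.trans interior_subset
  have hOfin : volume O ≠ ⊤ := ((measure_mono hOsub).trans_lt
    (isCompact_cyl (θ + δ / 2)).measure_lt_top).ne
  set ν := (volume O).toReal with hν
  have hν0 : 0 < ν := ENNReal.toReal_pos
    (hOopen.measure_pos volume ⟨z, mem_of_mem_nhds hO⟩).ne' hOfin
  have hlow : ∀ j, ν * κ ^ 2 ^ j ≤ a ^ 2 ^ j := by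
    intro j
    have hp : (0 : ℝ) < (1 / 2) ^ j := by positivity
    have h1 : ν * κ ^ 2 ^ j ≤ n j := by
      have hsub : O ⊆ cyl N (ϑ j) := hOsub.trans (cyl_mono (by simp only [hϑ]; nlinarith))
      have hci : Continuous fun p => Real.exp (2 ^ j * q * W p) := by
        have := hW.continuous; fun_prop
      calc ν * κ ^ 2 ^ j = ∫ _p in O, κ ^ 2 ^ j := by
            rw [setIntegral_const]; rfl
        _ ≤ ∫ p in O, Real.exp (2 ^ j * q * W p) := by
            refine setIntegral_mono_on (integrableOn_const hOfin)
              ((integrableOn_cyl hci (ϑ j)).mono_set hsub) hOopen.measurableSet fun p hp => ?_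
            have e : Real.exp (2 ^ j * q * W p) = Real.exp (q * W p) ^ 2 ^ j := by
              rw [← Real.exp_nat_mul]; congr 1; push_cast; ring
            rw [e]
            exact pow_le_pow_left₀ hκ0.le hp.1.le _
        _ ≤ n j := setIntegral_mono_set (integrableOn_cyl hci _)
            (Filter.Eventually.of_forall fun _ => (Real.exp_pos _).le) hsub.eventuallyLE
    have h2 : n j ≤ K * A ^ (j + 1) * n j :=
      le_mul_of_one_le_left (hn0 j) (one_le_mul_of_one_le_of_one_le hK1 (one_le_pow₀ hA1))
    exact h1.trans (h2.trans (ha j))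
  have ht : Filter.Tendsto (fun j : ℕ => (a / κ) ^ 2 ^ j) Filter.atTop (nhds 0) :=
    (tendsto_pow_atTop_nhds_zero_of_lt_one (by positivity) ((div_lt_one hκ0).2 hκ1)).comp
      (tendsto_pow_atTop_atTop_of_one_lt (by norm_num))
  have := ge_of_tendsto' ht fun j => by
    rw [div_pow, le_div_iff₀ (by positivity)]; exact hlow j
  linarith

end Moser

section BombieriGiusti

variable {N : ℕ}

theorem exists_dyadic_between {x : ℝ} (hx : 0 < x) (hx1 : x ≤ 1 / 3) :
    ∃ k : ℕ, x ≤ 1 / (3 * 2 ^ k) ∧ 1 / (3 * 2 ^ k) ≤ 2 * x := by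
  have hex : ∃ k : ℕ, 1 / (3 * 2 ^ k) ≤ 2 * x := by
    obtain ⟨k, hk⟩ := exists_pow_lt_of_lt_one hx (by norm_num : (1 / 2 : ℝ) < 1)
    refine ⟨k, ?_⟩
    have e : (1 : ℝ) / (3 * 2 ^ k) = 1 / 3 * (1 / 2) ^ k := by
      rw [div_pow, one_pow]; field_simp
    rw [e]
    linarith
  classical
  refine ⟨Nat.find hex, ?_, Nat.find_spec hex⟩
  rcases Nat.eq_zero_or_pos (Nat.find hex) with h0 | h0
  · rw [h0]; norm_num; linarith
  · have h1 := Nat.find_min hex (Nat.sub_lt h0 one_pos)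
    push Not at h1
    obtain ⟨m, hm⟩ := Nat.exists_eq_succ_of_ne_zero h0.ne'
    rw [hm] at h1 ⊢
    simp only [Nat.succ_eq_add_one, Nat.add_sub_cancel] at h1 ⊢
    have e : (1 : ℝ) / (3 * 2 ^ (m + 1)) = 1 / (3 * 2 ^ m) / 2 := by rw [pow_succ]; field_simp
    rw [e]; linarith

theorem cyl_nonempty {θ : ℝ} (h : 0 ≤ θ) : (cyl N θ).Nonempty :=
  ⟨(0, 0), ⟨by linarith, by linarith⟩, mem_closedBall_self (by linarith)⟩

set_option maxHeartbeats 1000000 in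
/-- The Bombieri–Giusti lemma. -/
theorem exists_le_of_exp_le (N : ℕ) (C : ℝ) (hC : 1 ≤ C) (B : ℕ) (K : ℝ) :
    ∃ M : ℝ, ∀ w : ℝ × Euc N → ℝ, Continuous w → ∫ p in cyl N (1 / 2), w p ^ 2 ≤ K →
      (∀ (k : ℕ) (θ θ' : ℝ), 0 ≤ θ → θ < θ' → θ' ≤ 1 / 2 → ∀ z ∈ cyl N θ,
        Real.exp (1 / (3 * 2 ^ k) * w z) ≤ C / (θ' - θ) ^ B * expInt w (1 / (3 * 2 ^ k)) θ') →
      ∀ z ∈ cyl N 0, w z ≤ M := by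
  obtain ⟨C', hC', hit⟩ := le_of_contraction_on_intervals (2 * B)
  set V := (volume (cyl N (1 / 2))).toReal with hV
  have hV0 : 0 ≤ V := ENNReal.toReal_nonneg
  set E := C * (V + 4 * |K|) + 12 with hE
  have hE12 : 12 ≤ E := by
    have : 0 ≤ C * (V + 4 * |K|) := by positivity
    linarith
  refine ⟨C' * (E ^ 2 / (1 / 2 - 0) ^ (2 * B)), fun w hw hK hexp z hz => ?_⟩
  have hbdd : ∀ θ, BddAbove (w '' cyl N θ) := fun θ =>
    (isCompact_cyl θ).bddAbove_image hw.continuousOn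
  have hle : ∀ θ, ∀ p ∈ cyl N θ, w p ≤ sSup (w '' cyl N θ) := fun θ p hp =>
    le_csSup (hbdd θ) (mem_image_of_mem _ hp)
  refine (hle 0 z hz).trans (hit (fun θ => sSup (w '' cyl N θ)) 0 (1 / 2) (E ^ 2)
    (sSup (w '' cyl N (1 / 2))) (by norm_num) (by positivity) (fun s hs => ?_)
    fun θ θ' h0 hlt hhalf => ?_)
  · exact csSup_le_csSup (hbdd _) ((cyl_nonempty hs.1).image _) (image_mono (cyl_mono hs.2))
  set Φ := sSup (w '' cyl N θ') with hΦ
  set δ := θ' - θ with hδ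
  have hδ0 : 0 < δ := by linarith
  have hδ1 : δ ≤ 1 := by linarith
  have hδB : δ ^ B ≤ 1 := pow_le_one₀ hδ0.le hδ1
  set T := E / δ ^ B with hT
  have hTE : E ≤ T := by
    rw [hT, le_div_iff₀ (by positivity)]; nlinarith
  have hT2 : E ^ 2 / δ ^ (2 * B) = T ^ 2 := by rw [hT, div_pow, ← pow_mul, mul_comm B 2]
  rw [hT2]
  refine csSup_le ((cyl_nonempty h0).image _) ?_
  rintro _ ⟨z, hz, rfl⟩
  have hzΦ : w z ≤ Φ := hle θ' z (cyl_mono hlt.le hz)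
  rcases le_or_gt Φ (T ^ 2) with hsmall | hbig
  · nlinarith [sq_nonneg T]
  have hT144 : 144 ≤ T ^ 2 := by nlinarith
  have hΦ0 : 0 < Φ := by linarith
  have hlog1 : 6 * Real.log Φ ≤ Φ := by
    have hs := Real.sq_sqrt hΦ0.le
    have hs12 : 12 ≤ √Φ := Real.le_sqrt_of_sq_le (by linarith)
    have h1 := Real.log_le_sub_one_of_pos (by linarith : 0 < √Φ)
    have h2 : Real.log Φ = 2 * Real.log √Φ := by
      rw [Real.log_sqrt hΦ0.le]; ring
    nlinarith
  have hlogpos : 0 < Real.log Φ := Real.log_pos (by linarith)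
  obtain ⟨k, hk1, hk2⟩ := exists_dyadic_between (x := 2 * Real.log Φ / Φ) (by positivity) (by
    rw [div_le_iff₀ hΦ0]; linarith)
  set q : ℝ := 1 / (3 * 2 ^ k) with hq
  have hq0 : 0 < q := by positivity
  rw [div_le_iff₀ hΦ0] at hk1
  have hk2' : q * Φ ≤ 4 * Real.log Φ := by
    rw [← le_div_iff₀ hΦ0]; refine hk2.trans (le_of_eq ?_); ring
  have hgi : expInt w q θ' ≤ (V + 4 * |K|) * Real.exp (q * Φ / 2) := by
    have hpt : ∀ p ∈ cyl N θ', Real.exp (q * w p)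
        ≤ Real.exp (q * Φ / 2) + (4 * Real.exp (q * Φ / 2)) * w p ^ 2 := by
      intro p hp
      rcases le_or_gt (w p) (Φ / 2) with h | h
      · have : Real.exp (q * w p) ≤ Real.exp (q * Φ / 2) := Real.exp_le_exp.2 (by nlinarith)
        have : 0 ≤ (4 * Real.exp (q * Φ / 2)) * w p ^ 2 := by positivity
        linarith
      · have h1 : Real.exp (q * w p) ≤ Real.exp (q * Φ / 2) * Real.exp (q * Φ / 2) := by
          rw [← Real.exp_add]
          refine Real.exp_le_exp.2 ?_
          have := mul_le_mul_of_nonneg_left (hle θ' p hp) hq0.le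
          linarith
        have h2 : Real.exp (q * Φ / 2) ≤ Φ ^ 2 := by
          calc Real.exp (q * Φ / 2) ≤ Real.exp (2 * Real.log Φ) := Real.exp_le_exp.2 (by linarith)
            _ = Φ ^ 2 := by rw [two_mul, Real.exp_add, Real.exp_log hΦ0]; ring
        have h3 : Φ ^ 2 ≤ 4 * w p ^ 2 := by nlinarith
        have h4 := mul_le_mul_of_nonneg_left (h2.trans h3) (Real.exp_pos (q * Φ / 2)).le
        have := Real.exp_pos (q * Φ / 2)
        linarith
    have hci : Continuous fun p => Real.exp (q * w p) := by fun_prop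
    have hcr : Continuous fun p =>
      Real.exp (q * Φ / 2) + (4 * Real.exp (q * Φ / 2)) * w p ^ 2 := by fun_prop
    calc expInt w q θ' ≤ ∫ p in cyl N θ',
          (Real.exp (q * Φ / 2) + (4 * Real.exp (q * Φ / 2)) * w p ^ 2) :=
          setIntegral_mono_on (integrableOn_cyl hci _) (integrableOn_cyl hcr _)
            (measurableSet_cyl _) hpt
      _ ≤ ∫ p in cyl N (1 / 2),
          (Real.exp (q * Φ / 2) + (4 * Real.exp (q * Φ / 2)) * w p ^ 2) :=
          setIntegral_mono_set (integrableOn_cyl hcr _)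
            (Filter.Eventually.of_forall fun p => by positivity) (cyl_mono hhalf).eventuallyLE
      _ = V * Real.exp (q * Φ / 2)
          + 4 * Real.exp (q * Φ / 2) * ∫ p in cyl N (1 / 2), w p ^ 2 := by
          rw [integral_add (integrableOn_cyl (by fun_prop) _) (integrableOn_cyl (by fun_prop) _),
            setIntegral_const, integral_const_mul]; rfl
      _ ≤ _ := by
          have := mul_le_mul_of_nonneg_left (hK.trans (le_abs_self K))
            (by positivity : 0 ≤ 4 * Real.exp (q * Φ / 2))
          linarith
  have h1 := hexp k θ θ' h0 hlt hhalf z hz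
  have h2 : Real.exp (q * w z) ≤ T * Real.exp (q * Φ / 2) := by
    refine h1.trans ?_
    calc C / δ ^ B * expInt w q θ'
        ≤ C / δ ^ B * ((V + 4 * |K|) * Real.exp (q * Φ / 2)) :=
          mul_le_mul_of_nonneg_left hgi (by positivity)
      _ = C * (V + 4 * |K|) / δ ^ B * Real.exp (q * Φ / 2) := by ring
      _ ≤ T * Real.exp (q * Φ / 2) := by
          refine mul_le_mul_of_nonneg_right ?_ (Real.exp_pos _).le
          exact div_le_div_of_nonneg_right (by linarith) (by positivity)
  have hT0 : 0 < T := by linarith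
  have h3 : q * w z ≤ Real.log T + q * Φ / 2 := by
    have := Real.log_le_log (Real.exp_pos _) h2
    rwa [Real.log_exp, Real.log_mul hT0.ne' (Real.exp_pos _).ne', Real.log_exp] at this
  have h4 : 2 * Real.log T ≤ Real.log Φ := by
    have := Real.log_le_log (by positivity) hbig.le
    rwa [Real.log_pow] at this
  have h5 : q * w z ≤ q * (3 / 4 * Φ) := by linarith
  have h6 := le_of_mul_le_mul_left h5 hq0
  nlinarith [sq_nonneg T]

end BombieriGiusti

section Poincare

variable {N : ℕ}

/-- The radial weight, positive exactly on the open ball of radius `2`. -/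
def weight (N : ℕ) (y : Euc N) : ℝ := Real.smoothTransition (4 - ‖y‖ ^ 2)

theorem weight_nonneg (y : Euc N) : 0 ≤ weight N y := Real.smoothTransition.nonneg _

theorem weight_le_one (y : Euc N) : weight N y ≤ 1 := Real.smoothTransition.le_one _

theorem weight_eq_one {y : Euc N} (hy : y ∈ closedBall (0 : Euc N) (3 / 2)) : weight N y = 1 := by
  rw [mem_closedBall_zero_iff] at hy
  exact Real.smoothTransition.one_of_one_le (by nlinarith [norm_nonneg y])

theorem weight_eq_zero {y : Euc N} (hy : y ∉ closedBall (0 : Euc N) 2) : weight N y = 0 := by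
  rw [mem_closedBall_zero_iff, not_le] at hy
  exact Real.smoothTransition.zero_of_nonpos (by nlinarith)

theorem isTest_weight : IsTest (weight N) where
  smooth := Real.smoothTransition.contDiff.comp (contDiff_const.sub (contDiff_norm_sq ℝ))
  supp := HasCompactSupport.intro (isCompact_closedBall 0 2) fun _ => weight_eq_zero

theorem weight_mul_le (y v : Euc N) {s : ℝ} (h0 : 0 ≤ s) (h1 : s ≤ 1) :
    weight N y * weight N (y + v) ≤ weight N (y + s • v) := by
  have key : min (weight N y) (weight N (y + v)) ≤ weight N (y + s • v) := by
    have hnorm : ‖y + s • v‖ ≤ max ‖y‖ ‖y + v‖ := by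
      have e : y + s • v = (1 - s) • y + s • (y + v) := by module
      rw [e]
      refine (norm_add_le _ _).trans ?_
      rw [norm_smul, norm_smul, Real.norm_of_nonneg h0, Real.norm_of_nonneg (by linarith)]
      nlinarith [le_max_left ‖y‖ ‖y + v‖, le_max_right ‖y‖ ‖y + v‖]
    rcases le_max_iff.1 hnorm with h | h
    · exact (min_le_left _ _).trans (Real.smoothTransition.monotone (by
        nlinarith [norm_nonneg (y + s • v)]))
    · exact (min_le_right _ _).trans (Real.smoothTransition.monotone (by
        nlinarith [norm_nonneg (y + s • v)]))
  refine le_trans (le_min ?_ ?_) key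
  · exact mul_le_of_le_one_right (weight_nonneg _) (weight_le_one _)
  · exact mul_le_of_le_one_left (weight_nonneg _) (weight_le_one _)

/-- Jensen's inequality for the square with respect to a weight of mass one. -/
theorem sq_integral_mul_le {X : Type*} [MeasurableSpace X] {μ : Measure X} {κ g : X → ℝ}
    (hκ : Integrable κ μ) (hκg : Integrable (fun x => κ x * g x) μ)
    (hκg2 : Integrable (fun x => κ x * g x ^ 2) μ) (h0 : ∀ x, 0 ≤ κ x) (h1 : ∫ x, κ x ∂μ = 1) :
    (∫ x, κ x * g x ∂μ) ^ 2 ≤ ∫ x, κ x * g x ^ 2 ∂μ := by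
  set a := ∫ x, κ x * g x ∂μ with ha
  have h : 0 ≤ ∫ x, κ x * (g x - a) ^ 2 ∂μ :=
    integral_nonneg fun x => mul_nonneg (h0 x) (sq_nonneg _)
  have e : ∀ x, κ x * (g x - a) ^ 2 = κ x * g x ^ 2 - 2 * a * (κ x * g x) + a ^ 2 * κ x :=
    fun x => by ring
  simp_rw [e] at h
  have hi : Integrable (fun x => κ x * g x ^ 2 - 2 * a * (κ x * g x)) μ :=
    hκg2.sub (hκg.const_mul _)
  rw [integral_add hi (hκ.const_mul _),
    integral_sub hκg2 (hκg.const_mul _), integral_const_mul, integral_const_mul, h1, ← ha] at h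
  nlinarith

/-- The squared length of the gradient. -/
def gradSqE (f : Euc N → ℝ) (y : Euc N) : ℝ := ∑ i, dd (EuclideanSpace.single i (1 : ℝ)) f y ^ 2

theorem gradSqE_nonneg (f : Euc N → ℝ) (y : Euc N) : 0 ≤ gradSqE f y :=
  Finset.sum_nonneg fun _ _ => sq_nonneg _

theorem continuous_gradSqE {f : Euc N → ℝ} (hf : ContDiff ℝ ∞ f) : Continuous (gradSqE f) :=
  continuous_finsetSum _ fun _ _ => (hf.dd _).continuous.pow 2

theorem dd_sq_le_gradSqE (f : Euc N → ℝ) (v y : Euc N) :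
    dd v f y ^ 2 ≤ ‖v‖ ^ 2 * gradSqE f y := by
  have e : dd v f y = ∑ i, v i * dd (EuclideanSpace.single i (1 : ℝ)) f y := by
    have hv : v = ∑ i, v i • EuclideanSpace.single i (1 : ℝ) := by
      ext j
      simp [Finset.sum_apply, Pi.single_apply]
    unfold dd
    conv_lhs => rw [hv]
    simp
  rw [e, EuclideanSpace.norm_sq_eq]
  simpa [gradSqE] using Finset.sum_mul_sq_le_sq_mul_sq Finset.univ (fun i => v i)
    (fun i => dd (EuclideanSpace.single i (1 : ℝ)) f y)

theorem sub_sq_le_integral {f : Euc N → ℝ} (hf : ContDiff ℝ ∞ f) (y v : Euc N) :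
    weight N y ^ 2 * weight N (y + v) ^ 2 * (f (y + v) - f y) ^ 2
      ≤ ∫ s in Icc (0 : ℝ) 1, ‖v‖ ^ 2 * (weight N (y + s • v) ^ 2 * gradSqE f (y + s • v)) := by
  have hline : Continuous fun s : ℝ => y + s • v := by fun_prop
  have hd : ∀ s : ℝ, HasDerivAt (fun s : ℝ => f (y + s • v)) (dd v f (y + s • v)) s := by
    intro s
    have h1 : HasFDerivAt f (fderiv ℝ f (y + s • v)) (y + s • v) :=
      (hf.differentiable (by simp) _).hasFDerivAt
    have h2 : HasDerivAt (fun s : ℝ => y + s • v) v s := by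
      simpa using ((hasDerivAt_id s).smul_const v).const_add y
    exact h1.comp_hasDerivAt s h2
  have hdc : Continuous fun s : ℝ => dd v f (y + s • v) := (hf.dd v).continuous.comp hline
  have hgi : ∀ {g : ℝ → ℝ}, Continuous g → IntegrableOn g (Icc 0 1) := fun hg =>
    hg.continuousOn.integrableOn_compact isCompact_Icc
  have e1 : f (y + v) - f y = ∫ s in Icc (0 : ℝ) 1, 1 * dd v f (y + s • v) := by
    have := intervalIntegral.integral_eq_sub_of_hasDerivAt (a := 0) (b := 1) (fun s _ => hd s)
      (hdc.intervalIntegrable _ _)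
    rw [intervalIntegral.integral_of_le zero_le_one, ← integral_Icc_eq_integral_Ioc] at this
    simpa using this.symm
  have e2 : (f (y + v) - f y) ^ 2 ≤ ∫ s in Icc (0 : ℝ) 1, 1 * dd v f (y + s • v) ^ 2 := by
    rw [e1]
    exact sq_integral_mul_le (hgi continuous_const) (hgi (by fun_prop)) (hgi (by fun_prop))
      (fun _ => zero_le_one) (by simp)
  refine (mul_le_mul_of_nonneg_left e2 (by positivity)).trans ?_
  have hwc := (isTest_weight (N := N)).smooth.continuous
  have hgc := continuous_gradSqE hf
  rw [← integral_const_mul]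
  refine setIntegral_mono_on (hgi (by fun_prop)) (hgi (by fun_prop)) measurableSet_Icc
    fun s hs => ?_
  have h1 := pow_le_pow_left₀ (mul_nonneg (weight_nonneg y) (weight_nonneg (y + v)))
    (weight_mul_le y v hs.1 hs.2) 2
  have h2 := dd_sq_le_gradSqE f v (y + s • v)
  have h3 := mul_le_mul h1 h2 (sq_nonneg _) (sq_nonneg _)
  calc _ = (weight N y * weight N (y + v)) ^ 2 * dd v f (y + s • v) ^ 2 := by ring
    _ ≤ _ := h3
    _ = _ := by ring

theorem integral_weight_sub_sq_le {f : Euc N → ℝ} (hf : ContDiff ℝ ∞ f) (v : Euc N) :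
    ∫ y, weight N y ^ 2 * weight N (y + v) ^ 2 * (f (y + v) - f y) ^ 2
      ≤ ‖v‖ ^ 2 * ∫ y, weight N y ^ 2 * gradSqE f y := by
  have hwc := (isTest_weight (N := N)).smooth.continuous
  have hgc := continuous_gradSqE hf
  have hfc := hf.continuous
  set h : Euc N → ℝ := fun y => weight N y ^ 2 * gradSqE f y with hh
  have hcc : IsCc h := isTest_weight.isCc.sq.mul_right hgc
  have h0 : ∀ y, 0 ≤ h y := fun y => mul_nonneg (sq_nonneg _) (gradSqE_nonneg _ _)
  have hLcc : IsCc fun y => weight N y ^ 2 * weight N (y + v) ^ 2 * (f (y + v) - f y) ^ 2 :=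
    (isTest_weight.isCc.sq.mul_right (by fun_prop)).mul_right (by fun_prop)
  rw [← integral_const_mul]
  have hI : 0 ≤ ∫ y, ‖v‖ ^ 2 * h y := integral_nonneg fun y => mul_nonneg (sq_nonneg _) (h0 y)
  rw [← ENNReal.ofReal_le_ofReal_iff hI,
    ofReal_integral_eq_lintegral_ofReal hLcc.integrable
      (Filter.Eventually.of_forall fun y => by positivity),
    ofReal_integral_eq_lintegral_ofReal (hcc.const_mul _).integrable
      (Filter.Eventually.of_forall fun y => mul_nonneg (sq_nonneg _) (h0 y))]
  calc _ ≤ ∫⁻ y, ∫⁻ s in Icc (0 : ℝ) 1, ENNReal.ofReal (‖v‖ ^ 2 * h (y + s • v)) := by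
        refine lintegral_mono fun y => ?_
        rw [← ofReal_integral_eq_lintegral_ofReal]
        · exact ENNReal.ofReal_le_ofReal (sub_sq_le_integral hf y v)
        · have := hcc.cont
          exact Continuous.integrableOn_Icc (by fun_prop)
        · exact Filter.Eventually.of_forall fun s => mul_nonneg (sq_nonneg _) (h0 _)
    _ = ∫⁻ s in Icc (0 : ℝ) 1, ∫⁻ y, ENNReal.ofReal (‖v‖ ^ 2 * h (y + s • v)) := by
        refine lintegral_lintegral_swap (Measurable.aemeasurable ?_)
        have := hcc.cont
        exact (Continuous.measurable (by fun_prop)).ennreal_ofReal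
    _ = ∫⁻ _s in Icc (0 : ℝ) 1, ∫⁻ y, ENNReal.ofReal (‖v‖ ^ 2 * h y) := by
        refine lintegral_congr fun s => ?_
        exact lintegral_add_right_eq_self (fun y => ENNReal.ofReal (‖v‖ ^ 2 * h y)) (s • v)
    _ = _ := by simp

set_option maxHeartbeats 1000000 in
/-- The weighted Poincaré inequality. -/
theorem exists_poincare {κ : Euc N → ℝ} (hκ : IsCc κ) (hκ0 : ∀ y, 0 ≤ κ y) {A : ℝ}
    (hκA : ∀ y, κ y ≤ A * weight N y ^ 2) (hκ1 : ∫ y, κ y = 1) :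
    ∃ C : ℝ, 1 ≤ C ∧ ∀ f : Euc N → ℝ, ContDiff ℝ ∞ f →
      ∫ y, weight N y ^ 2 * (f y - ∫ z, κ z * f z) ^ 2
        ≤ C * ∫ y, weight N y ^ 2 * gradSqE f y := by
  have hwc := (isTest_weight (N := N)).smooth.continuous
  set V := (volume (closedBall (0 : Euc N) 4)).toReal with hV
  refine ⟨|A| * (V * 16) + 1,
    by have : 0 ≤ V := ENNReal.toReal_nonneg; linarith [show 0 ≤ |A| * (V * 16) by positivity],
    fun f hf => ?_⟩
  have hfc := hf.continuous
  have hκc := hκ.cont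
  set G := ∫ y, weight N y ^ 2 * gradSqE f y with hG
  have hG0 : 0 ≤ G := integral_nonneg fun y => mul_nonneg (sq_nonneg _) (gradSqE_nonneg _ _)
  set k : Euc N × Euc N → ℝ := fun p =>
    weight N p.1 ^ 2 * weight N (p.1 + p.2) ^ 2 * (f (p.1 + p.2) - f p.1) ^ 2 with hk
  have hk0 : ∀ p, 0 ≤ k p := fun p => by positivity
  have hkz : ∀ p : Euc N × Euc N, p ∉ closedBall (0 : Euc N) 2 ×ˢ closedBall (0 : Euc N) 4 → k p = 0 := by
    intro p hp
    by_cases h1 : p.1 ∈ closedBall (0 : Euc N) 2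
    · by_cases h2 : p.1 + p.2 ∈ closedBall (0 : Euc N) 2
      · refine absurd ⟨h1, ?_⟩ hp
        rw [mem_closedBall_zero_iff] at *
        have := norm_sub_le (p.1 + p.2) p.1
        rw [add_sub_cancel_left] at this
        linarith
      · simp [hk, weight_eq_zero h2]
    · simp [hk, weight_eq_zero h1]
  have hkcc : IsCc k := IsCc.of_compact (by fun_prop)
    ((isCompact_closedBall _ _).prod (isCompact_closedBall _ _)) hkz
  have hki : Integrable k (volume.prod volume) := hkcc.integrable
  have hstep : ∀ y, weight N y ^ 2 * (f y - ∫ z, κ z * f z) ^ 2 ≤ |A| * ∫ v, k (y, v) := by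
    intro y
    have e : f y - ∫ z, κ z * f z = ∫ z, κ z * (f y - f z) := by
      simp_rw [mul_sub]
      rw [integral_sub (hκ.mul_right continuous_const).integrable (hκ.mul_right hfc).integrable,
        integral_mul_const, hκ1, one_mul]
    rw [e]
    have h1 := sq_integral_mul_le (μ := volume) (g := fun z => f y - f z) hκ.integrable
      (hκ.mul_right (by fun_prop)).integrable (hκ.mul_right (by fun_prop)).integrable hκ0 hκ1
    have h2 := mul_le_mul_of_nonneg_left h1 (sq_nonneg (weight N y))
    refine h2.trans ?_
    rw [← integral_const_mul, ← integral_const_mul,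
      ← integral_add_left_eq_self (fun z => weight N y ^ 2 * (κ z * (f y - f z) ^ 2)) y]
    have hl : IsCc fun z => weight N y ^ 2 * (κ z * (f y - f z) ^ 2) :=
      (hκ.mul_right (by fun_prop)).const_mul _
    have hr : IsCc fun v => k (y, v) := IsCc.of_compact (hkcc.cont.comp (by fun_prop))
      (isCompact_closedBall (0 : Euc N) 4) fun v hv => hkz _ fun h => hv h.2
    refine integral_mono (hl.integrable.comp_add_left y) (hr.const_mul _).integrable fun v => ?_
    · have h3 : κ (y + v) ≤ |A| * weight N (y + v) ^ 2 := (hκA _).trans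
        (mul_le_mul_of_nonneg_right (le_abs_self A) (sq_nonneg _))
      have h4 := mul_le_mul_of_nonneg_left h3
        (by positivity : 0 ≤ weight N y ^ 2 * (f y - f (y + v)) ^ 2)
      calc _ = weight N y ^ 2 * (f y - f (y + v)) ^ 2 * κ (y + v) := by ring
        _ ≤ _ := h4
        _ = _ := by simp only [hk]; ring
  have hLcc : IsCc fun y => weight N y ^ 2 * (f y - ∫ z, κ z * f z) ^ 2 :=
    isTest_weight.isCc.sq.mul_right (by fun_prop)
  calc ∫ y, weight N y ^ 2 * (f y - ∫ z, κ z * f z) ^ 2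
      ≤ ∫ y, |A| * ∫ v, k (y, v) :=
        integral_mono hLcc.integrable (hki.integral_prod_left.const_mul _) hstep
    _ = |A| * ∫ v, ∫ y, k (y, v) := by
        rw [integral_const_mul, integral_integral_swap hki]
    _ = |A| * ∫ v in closedBall (0 : Euc N) 4, ∫ y, k (y, v) := by
        rw [setIntegral_eq_integral_of_forall_compl_eq_zero fun v hv => ?_]
        simp [hkz (_, v) fun h => hv h.2]
    _ ≤ |A| * ∫ _v in closedBall (0 : Euc N) 4, 16 * G := by
        refine mul_le_mul_of_nonneg_left ?_ (abs_nonneg A)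
        refine setIntegral_mono_on hki.integral_prod_right.integrableOn
          (integrableOn_const measure_closedBall_lt_top.ne) measurableSet_closedBall fun v hv => ?_
        refine (integral_weight_sub_sq_le hf v).trans (mul_le_mul_of_nonneg_right ?_ hG0)
        rw [mem_closedBall_zero_iff] at hv
        nlinarith [norm_nonneg v]
    _ = |A| * (V * (16 * G)) := by rw [setIntegral_const]; rfl
    _ ≤ _ := by linarith

end Poincare

section Slices

variable {N : ℕ}

/-- The weighted integral of `F` over the slice at abscissa `x`. -/
def slice (κ : Euc N → ℝ) (F : ℝ × Euc N → ℝ) (x : ℝ) : ℝ := ∫ y, κ y * F (x, y)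

theorem continuous_slice {κ : Euc N → ℝ} (hκ : IsCc κ) {F : ℝ × Euc N → ℝ} (hF : Continuous F) :
    Continuous (slice κ F) := by
  have e : slice κ F = fun x => ∫ y in tsupport κ, κ y * F (x, y) := by
    funext x
    rw [setIntegral_eq_integral_of_forall_compl_eq_zero fun y hy => by
      rw [image_eq_zero_of_notMem_tsupport hy, zero_mul]]
    rfl
  rw [e]
  have := hκ.cont
  exact continuous_parametric_integral_of_continuous (f := fun x y => κ y * F (x, y))
    (by unfold Function.uncurry; fun_prop) hκ.supp

theorem IsCc.mul_slice {κ : Euc N → ℝ} (hκ : IsCc κ) {F : ℝ × Euc N → ℝ} (hF : Continuous F)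
    (x : ℝ) : IsCc fun y => κ y * F (x, y) := hκ.mul_right (by fun_prop)

theorem hasDerivAt_slice {κ : Euc N → ℝ} (hκ : IsCc κ) {F : ℝ × Euc N → ℝ} (hF : ContDiff ℝ ∞ F)
    (x : ℝ) : HasDerivAt (slice κ F) (slice κ (dd (eX N) F) x) x := by
  have hFc := hF.continuous
  have hdc := (hF.dd (eX N)).continuous
  obtain ⟨M, hM⟩ := ((isCompact_closedBall x 1).prod hκ.supp).exists_bound_of_continuousOn
    hdc.continuousOn
  refine (hasDerivAt_integral_of_dominated_loc_of_deriv_le (bound := fun y => |κ y| * M)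
    (F := fun x y => κ y * F (x, y)) (F' := fun x y => κ y * dd (eX N) F (x, y))
    (ball_mem_nhds x one_pos) (Filter.Eventually.of_forall fun t => ?_) ?_ ?_ ?_ ?_ ?_).2
  · exact (hκ.mul_slice hFc t).integrable.aestronglyMeasurable
  · exact (hκ.mul_slice hFc x).integrable
  · exact (hκ.mul_slice hdc x).integrable.aestronglyMeasurable
  · refine Filter.Eventually.of_forall fun y t ht => ?_
    rw [norm_mul, Real.norm_eq_abs]
    by_cases hy : y ∈ tsupport κ
    · exact mul_le_mul_of_nonneg_left (hM (t, y) ⟨ball_subset_closedBall ht, hy⟩) (abs_nonneg _)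
    · simp [image_eq_zero_of_notMem_tsupport hy]
  · exact (hκ.abs.mul_right continuous_const).integrable
  · refine Filter.Eventually.of_forall fun y t _ => ?_
    have h1 : HasFDerivAt F (fderiv ℝ F (t, y)) (t, y) :=
      (hF.differentiable (by simp) _).hasFDerivAt
    have h2 : HasDerivAt (fun s : ℝ => (s, y)) (eX N) t :=
      (hasDerivAt_id t).prodMk (hasDerivAt_const t y)
    exact (h1.comp_hasDerivAt t h2).const_mul (κ y)

theorem dd_slice {W : ℝ × Euc N → ℝ} (hW : ContDiff ℝ ∞ W) (i : Fin (N - 1)) (x : ℝ) (y : Euc N) :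
    dd (EuclideanSpace.single i (1 : ℝ)) (fun z => W (x, z)) y = dd (eY i) W (x, y) := by
  unfold dd
  have h1 : HasFDerivAt W (fderiv ℝ W (x, y)) (x, y) := (hW.differentiable (by simp) _).hasFDerivAt
  have h2 := h1.comp y ((hasFDerivAt_const x y).prodMk (hasFDerivAt_id y))
  rw [show (fun z => W (x, z)) = W ∘ fun z => (x, z) from rfl, h2.fderiv]
  simp [eY]

theorem ContDiff.slice_snd {W : ℝ × Euc N → ℝ} (hW : ContDiff ℝ ∞ W) (x : ℝ) :
    ContDiff ℝ ∞ fun y => W (x, y) := hW.comp (contDiff_const.prodMk contDiff_id)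

theorem gradSqE_slice {W : ℝ × Euc N → ℝ} (hW : ContDiff ℝ ∞ W) (x : ℝ) (y : Euc N) :
    gradSqE (fun z => W (x, z)) y = gradSq W (x, y) := by
  simp only [gradSqE, gradSq, dd_slice hW]

set_option maxHeartbeats 1000000 in
/-- Testing the equation for the logarithm on a slice. -/
theorem abs_slice_add_slice_le {β σ : Euc N → ℝ} (hβ : Continuous β) (hσ : IsTest σ)
    (hσ0 : ∀ y, y ∉ closedBall (0 : Euc N) 2 → σ y = 0) {W : ℝ × Euc N → ℝ} (hW : ContDiff ℝ ∞ W)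
    {x : ℝ} (hx : ∀ y ∈ closedBall (0 : Euc N) 2, |logOp β W (x, y)| ≤ 1) :
    |slice (fun y => σ y ^ 2 * β y) (dd (eX N) W) x + slice (fun y => σ y ^ 2) (gradSq W) x|
      ≤ (∫ y, σ y ^ 2 + 2 * gradSqE σ y) + 1 / 2 * slice (fun y => σ y ^ 2) (gradSq W) x := by
  have hs2 : IsTest fun y => σ y * σ y := hσ.mul_left hσ.smooth
  have hs2' := hσ.isCc.sq
  have hgc := hW.continuous_gradSq
  have hlc := hW.lapY.continuous
  have hxc := (hW.dd (eX N)).continuous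
  have hlap : ∫ y, σ y ^ 2 * lapY W (x, y)
      = ∫ y, -(2 * σ y * ∑ i, dd (EuclideanSpace.single i (1 : ℝ)) σ y * dd (eY i) W (x, y)) := by
    calc ∫ y, σ y ^ 2 * lapY W (x, y)
        = ∫ y, ∑ i, σ y * σ y * dd (EuclideanSpace.single i (1 : ℝ))
            (fun z => dd (eY i) W (x, z)) y := by
          refine integral_congr_ae (Filter.Eventually.of_forall fun y => ?_)
          simp only [lapY_eq_sum, Finset.mul_sum, dd_slice (hW.dd (eY _)), pow_two]
      _ = ∑ i, ∫ y, σ y * σ y * dd (EuclideanSpace.single i (1 : ℝ))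
            (fun z => dd (eY i) W (x, z)) y :=
          integral_finsetSum _ fun i _ => (hs2.isCc.mul_right
            (((hW.dd (eY i)).slice_snd x).dd _).continuous).integrable
      _ = ∑ i, ∫ y, -(dd (EuclideanSpace.single i (1 : ℝ)) (fun z => σ z * σ z) y
            * dd (eY i) W (x, y)) := by
          refine Finset.sum_congr rfl fun i _ => ?_
          rw [integral_mul_dd hs2 ((hW.dd (eY i)).slice_snd x), integral_neg]
      _ = ∫ y, ∑ i, -(dd (EuclideanSpace.single i (1 : ℝ)) (fun z => σ z * σ z) y
            * dd (eY i) W (x, y)) :=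
          (integral_finsetSum _ fun i _ => ((hs2.dd _).isCc.mul_right
            ((hW.dd (eY i)).slice_snd x).continuous).neg.integrable).symm
      _ = _ := by
          refine integral_congr_ae (Filter.Eventually.of_forall fun y => ?_)
          simp only [dd_mul hσ.smooth hσ.smooth, Finset.mul_sum, ← Finset.sum_neg_distrib]
          exact Finset.sum_congr rfl fun i _ => by ring
  set X : Euc N → ℝ := fun y =>
    2 * σ y * ∑ i, dd (EuclideanSpace.single i (1 : ℝ)) σ y * dd (eY i) W (x, y) with hX
  have hXcc : IsCc X := by
    have : IsCc fun y => 2 * σ y := hσ.isCc.const_mul 2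
    refine this.mul_right (continuous_finsetSum _ fun i _ => ?_)
    exact (hσ.dd _).smooth.continuous.mul ((hW.dd (eY i)).slice_snd x).continuous
  have hTcc : IsCc fun y => σ y ^ 2 * β y * dd (eX N) W (x, y) :=
    (hs2'.mul_right hβ).mul_right (by fun_prop)
  have hDcc : IsCc fun y => σ y ^ 2 * gradSq W (x, y) := hs2'.mul_slice hgc x
  have hLcc : IsCc fun y => σ y ^ 2 * lapY W (x, y) := hs2'.mul_slice hlc x
  have hHcc : IsCc fun y => σ y ^ 2 * logOp β W (x, y) := by
    have e : (fun y => σ y ^ 2 * logOp β W (x, y)) = fun y => (σ y ^ 2 * lapY W (x, y)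
        + σ y ^ 2 * β y * dd (eX N) W (x, y)) + σ y ^ 2 * gradSq W (x, y) := by
      funext y; simp only [logOp, dX_eq_dd]; ring
    rw [e]; exact (hLcc.add hTcc).add hDcc
  have hsum : slice (fun y => σ y ^ 2 * β y) (dd (eX N) W) x
      + slice (fun y => σ y ^ 2) (gradSq W) x
      = ∫ y, (σ y ^ 2 * logOp β W (x, y) + X y) := by
    have e : ∀ y, σ y ^ 2 * logOp β W (x, y) = (σ y ^ 2 * β y * dd (eX N) W (x, y)
        + σ y ^ 2 * gradSq W (x, y)) + σ y ^ 2 * lapY W (x, y) := by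
      intro y; simp only [logOp, dX_eq_dd]; ring
    rw [integral_add hHcc.integrable hXcc.integrable]
    simp_rw [e]
    rw [integral_add (hTcc.add hDcc).integrable hLcc.integrable,
      integral_add hTcc.integrable hDcc.integrable, hlap, integral_neg]
    simp only [slice]
    ring
  rw [hsum]
  have hgE : IsCc (gradSqE σ) := IsCc.sum _ fun i _ => (hσ.dd _).isCc.sq
  have hR : IsCc fun y => σ y ^ 2 + 2 * gradSqE σ y := hs2'.add (hgE.const_mul 2)
  have hbound : (∫ y, σ y ^ 2 + 2 * gradSqE σ y) + 1 / 2 * slice (fun y => σ y ^ 2) (gradSq W) x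
      = ∫ y, ((σ y ^ 2 + 2 * gradSqE σ y) + 1 / 2 * (σ y ^ 2 * gradSq W (x, y))) := by
    rw [integral_add hR.integrable (hDcc.const_mul _).integrable, integral_const_mul]; rfl
  rw [hbound]
  refine (abs_integral_le_integral_abs).trans (integral_mono (hHcc.add hXcc).abs.integrable
    (hR.add (hDcc.const_mul _)).integrable fun y => ?_)
  have h1 : |σ y ^ 2 * logOp β W (x, y)| ≤ σ y ^ 2 := by
    by_cases hy : y ∈ closedBall (0 : Euc N) 2
    · rw [abs_mul (σ y ^ 2), abs_of_nonneg (sq_nonneg _)]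
      exact mul_le_of_le_one_right (sq_nonneg _) (hx y hy)
    · simp [hσ0 y hy]
  have h2 : |X y| ≤ 2 * gradSqE σ y + 1 / 2 * (σ y ^ 2 * gradSq W (x, y)) := by
    have key : ∀ s : ℝ, s = 1 ∨ s = -1 →
        s * X y ≤ 2 * gradSqE σ y + 1 / 2 * (σ y ^ 2 * gradSq W (x, y)) := by
      intro s hs
      have hs2 : s ^ 2 = 1 := by rcases hs with rfl | rfl <;> norm_num
      simp only [hX, gradSqE, gradSq, Finset.mul_sum, ← Finset.sum_add_distrib]
      refine Finset.sum_le_sum fun i _ => ?_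
      set a := dd (EuclideanSpace.single i (1 : ℝ)) σ y
      set d := dd (eY i) W (x, y)
      have h := sq_nonneg (2 * a - s * σ y * d)
      have e : (s * σ y * d) ^ 2 = σ y ^ 2 * d ^ 2 := by rw [mul_pow, mul_pow, hs2]; ring
      nlinarith
    refine abs_le.2 ⟨?_, ?_⟩
    · linarith [key (-1) (Or.inr rfl)]
    · linarith [key 1 (Or.inl rfl)]
  have h3 := abs_add_le (σ y ^ 2 * logOp β W (x, y)) (X y)
  simp only
  linarith

end Slices

section LogEstimate

variable {N : ℕ}

theorem exists_signed_bump {β : Euc N → ℝ} (hβ : Continuous β) (s : ℝ) {y₀ : Euc N}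
    (hy : y₀ ∈ ball (0 : Euc N) 1) (h : 0 < s * β y₀) :
    ∃ b : Euc N → ℝ, IsTest b ∧ (∀ y, 0 ≤ b y) ∧ (∀ y, b y ≤ weight N y) ∧
      (∀ y, 0 ≤ s * (b y ^ 2 * β y)) ∧ 0 < s * ∫ y, b y ^ 2 * β y := by
  have hU : {y | 0 < s * β y} ∩ ball (0 : Euc N) 1 ∈ nhds y₀ :=
    ((isOpen_lt continuous_const (continuous_const.mul hβ)).inter isOpen_ball).mem_nhds ⟨h, hy⟩
  obtain ⟨b, hbs, hbc, hb, hbr, hb1⟩ := exists_contDiff_tsupport_subset (n := ⊤) hU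
  have hr : ∀ y, b y ∈ Icc (0 : ℝ) 1 := fun y => hbr (mem_range_self y)
  have hT : IsTest b := ⟨hb, hbc⟩
  have hnn : ∀ y, 0 ≤ s * (b y ^ 2 * β y) := fun y => by
    by_cases hm : y ∈ tsupport b
    · have : 0 < s * β y := (hbs hm).1
      have e : s * (b y ^ 2 * β y) = b y ^ 2 * (s * β y) := by ring
      rw [e]; positivity
    · simp [image_eq_zero_of_notMem_tsupport hm]
  refine ⟨b, hT, fun y => (hr y).1, fun y => ?_, hnn, ?_⟩
  · by_cases hm : y ∈ tsupport b
    · have := (hbs hm).2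
      rw [weight_eq_one (closedBall_subset_closedBall (by norm_num) (ball_subset_closedBall this))]
      exact (hr y).2
    · rw [image_eq_zero_of_notMem_tsupport hm]; exact weight_nonneg y
  · rw [← integral_const_mul]
    have hcc : IsCc fun y => s * (b y ^ 2 * β y) := (hT.isCc.sq.mul_right hβ).const_mul s
    refine hcc.cont.integral_pos_of_hasCompactSupport_nonneg_nonzero hcc.supp hnn (x := y₀) ?_
    simp only [hb1]
    linarith

/-- If `Q` decreases at least at the rate `D / 2`, up to a constant, while `Q ^ 2` is controlled
by `D`, then the mass of `D` on a shorter interval is bounded. -/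
theorem integral_le_of_hasDerivAt {D Q Q' : ℝ → ℝ} {C₁ C₂ : ℝ} (hC₁ : 0 ≤ C₁) (hC₂ : 0 < C₂)
    (hD : Continuous D) (hD0 : ∀ x, 0 ≤ D x) (hQ : ∀ x, HasDerivAt Q (Q' x) x)
    (hQ' : Continuous Q') (h₁ : ∀ x ∈ Icc (-2 : ℝ) 3, Q' x + 1 / 2 * D x ≤ C₁)
    (h₂ : ∀ x, Q x ^ 2 ≤ C₂ * D x) :
    ∫ x in Icc (-1 : ℝ) 2, D x ≤ 500 * C₂ + 250 * C₁ := by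
  have hQc : Continuous Q := continuous_iff_continuousAt.2 fun x => (hQ x).continuousAt
  set χ : ℝ → ℝ := fun x => (x + 2) * (3 - x) with hχ
  have hd : ∀ x, HasDerivAt (fun x => χ x ^ 2 * Q x)
      (2 * χ x * (1 - 2 * x) * Q x + χ x ^ 2 * Q' x) x := by
    intro x
    have h1 : HasDerivAt χ (1 - 2 * x) x := by
      have := ((hasDerivAt_id x).add_const 2).mul ((hasDerivAt_id x).const_sub 3)
      refine this.congr_deriv ?_
      simp only [id]; ring
    refine ((h1.pow 2).mul (hQ x)).congr_deriv ?_
    simp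
  have hχc : Continuous χ := by fun_prop
  have hgi : ∫ x in Icc (-2 : ℝ) 3, (2 * χ x * (1 - 2 * x) * Q x + χ x ^ 2 * Q' x) = 0 := by
    have := intervalIntegral.integral_eq_sub_of_hasDerivAt (a := -2) (b := 3) (fun x _ => hd x)
      (Continuous.intervalIntegrable (by fun_prop) _ _)
    rw [intervalIntegral.integral_of_le (by norm_num), ← integral_Icc_eq_integral_Ioc] at this
    rw [this]; simp [hχ]
  have hon : ∀ {g : ℝ → ℝ} {a b : ℝ}, Continuous g → IntegrableOn g (Icc a b) := fun hg =>
    hg.continuousOn.integrableOn_compact isCompact_Icc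
  have hpt : ∀ x ∈ Icc (-2 : ℝ) 3, 1 / 4 * (χ x ^ 2 * D x)
      ≤ (100 * C₂ + 40 * C₁) - (2 * χ x * (1 - 2 * x) * Q x + χ x ^ 2 * Q' x) := by
    intro x hx
    have hχ0 : 0 ≤ χ x := mul_nonneg (by linarith [hx.1]) (by linarith [hx.2])
    have hχ1 : χ x ^ 2 ≤ 40 := by
      have : χ x ≤ 25 / 4 := by simp only [hχ]; nlinarith [sq_nonneg (x - 1 / 2)]
      nlinarith
    have hx' : (1 - 2 * x) ^ 2 ≤ 25 := by nlinarith [hx.1, hx.2]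
    have h3 : χ x ^ 2 * (Q' x + 1 / 2 * D x) ≤ χ x ^ 2 * C₁ :=
      mul_le_mul_of_nonneg_left (h₁ x hx) (sq_nonneg _)
    have h4 : χ x ^ 2 * C₁ ≤ 40 * C₁ := mul_le_mul_of_nonneg_right hχ1 hC₁
    have h5 : C₂ * (2 * χ x * (1 - 2 * x) * Q x)
        ≤ C₂ * (1 / 4 * (χ x ^ 2 * D x) + 4 * C₂ * (1 - 2 * x) ^ 2) := by
      have := sq_nonneg (1 / 2 * (χ x * Q x) - 2 * C₂ * (1 - 2 * x))
      have h6 : χ x ^ 2 * Q x ^ 2 ≤ χ x ^ 2 * (C₂ * D x) :=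
        mul_le_mul_of_nonneg_left (h₂ x) (sq_nonneg _)
      nlinarith
    have h7 := le_of_mul_le_mul_left h5 hC₂
    have h8 : 4 * C₂ * (1 - 2 * x) ^ 2 ≤ 4 * C₂ * 25 :=
      mul_le_mul_of_nonneg_left hx' (by linarith)
    nlinarith
  have h1 : ∫ x in Icc (-2 : ℝ) 3, 1 / 4 * (χ x ^ 2 * D x) ≤ 5 * (100 * C₂ + 40 * C₁) := by
    refine (setIntegral_mono_on (hon (by fun_prop)) (hon (by fun_prop)) measurableSet_Icc
      hpt).trans_eq ?_
    rw [integral_sub (hon continuous_const) (hon (by fun_prop)), hgi]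
    simp
    norm_num
  have h2 : ∫ x in Icc (-1 : ℝ) 2, 4 * D x ≤ ∫ x in Icc (-2 : ℝ) 3, 1 / 4 * (χ x ^ 2 * D x) := by
    refine (setIntegral_mono_on (hon (by fun_prop)) (hon (by fun_prop)) measurableSet_Icc
      fun x hx => ?_).trans (setIntegral_mono_set (hon (by fun_prop))
        (Filter.Eventually.of_forall fun x => ?_)
        (Icc_subset_Icc (by norm_num) (by norm_num)).eventuallyLE)
    · have : 4 ≤ χ x := by simp only [hχ]; nlinarith [hx.1, hx.2]
      have : 16 ≤ χ x ^ 2 := by nlinarith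
      nlinarith [mul_le_mul_of_nonneg_right this (hD0 x)]
    · exact mul_nonneg (by norm_num) (mul_nonneg (sq_nonneg _) (hD0 x))
  rw [integral_const_mul] at h2
  linarith

theorem abs_sub_le_of_abs_deriv_le {D P P' : ℝ → ℝ} {C K : ℝ} (hD : Continuous D)
    (hP : ∀ x, HasDerivAt P (P' x) x) (hP' : Continuous P') (hC : 0 ≤ C)
    (h : ∀ x ∈ Icc (-1 : ℝ) 2, |P' x| ≤ C * (1 + D x)) (hK : ∫ x in Icc (-1 : ℝ) 2, D x ≤ K) :
    ∀ x ∈ Icc (-1 : ℝ) 2, |P x - P 0| ≤ C * (3 + K) := by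
  intro x hx
  have hon : ∀ {g : ℝ → ℝ}, Continuous g → IntegrableOn g (Icc (-1) 2) := fun hg =>
    hg.continuousOn.integrableOn_compact isCompact_Icc
  have h0 : (0 : ℝ) ∈ Icc (-1 : ℝ) 2 := by constructor <;> norm_num
  have hsub : uIoc 0 x ⊆ Icc (-1 : ℝ) 2 :=
    uIoc_subset_uIcc.trans (uIcc_subset_Icc h0 hx)
  rw [← intervalIntegral.integral_eq_sub_of_hasDerivAt (fun x _ => hP x)
    (hP'.intervalIntegrable _ _)]
  calc |∫ y in (0 : ℝ)..x, P' y| ≤ ∫ y in uIoc 0 x, |P' y| := by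
        simpa only [Real.norm_eq_abs] using
          intervalIntegral.norm_integral_le_integral_norm_uIoc (f := P') (a := 0) (b := x)
            (μ := volume)
    _ ≤ ∫ y in Icc (-1 : ℝ) 2, |P' y| := setIntegral_mono_set (hon hP'.abs)
        (Filter.Eventually.of_forall fun _ => abs_nonneg _) hsub.eventuallyLE
    _ ≤ ∫ y in Icc (-1 : ℝ) 2, C * (1 + D y) :=
        setIntegral_mono_on (hon hP'.abs) (hon (by fun_prop)) measurableSet_Icc h
    _ = C * (3 + ∫ y in Icc (-1 : ℝ) 2, D y) := by
        rw [integral_const_mul, integral_add (hon continuous_const) (hon hD)]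
        simp
        norm_num
    _ ≤ _ := mul_le_mul_of_nonneg_left (by linarith) hC

theorem integral_weight_sq_pos : 0 < ∫ y, weight N y ^ 2 := by
  have h := (isTest_weight (N := N)).isCc.sq
  refine h.cont.integral_pos_of_hasCompactSupport_nonneg_nonzero h.supp
    (fun y => sq_nonneg _) (x := 0) ?_
  simp [weight_eq_one (N := N) (y := 0) (by simp; norm_num)]

/-- The Cauchy–Schwarz inequality against the weight. -/
theorem sq_integral_le_weight {h g : Euc N → ℝ} (hh : Continuous h) (hg : Continuous g) {M : ℝ}
    (hM : 0 < M) (hle : ∀ y, |h y| ≤ M * weight N y ^ 2) :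
    (∫ y, h y * g y) ^ 2
      ≤ M ^ 2 * (∫ y, weight N y ^ 2) * ∫ y, weight N y ^ 2 * g y ^ 2 := by
  have hw := (isTest_weight (N := N)).isCc.sq
  have hhcc : IsCc h := IsCc.of_compact hh (isCompact_closedBall 0 2) fun y hy => by
    have := hle y
    rw [weight_eq_zero hy] at this
    simpa using this
  set m := ∫ y, weight N y ^ 2 with hm
  have hmp : 0 < m := integral_weight_sq_pos
  set Q := ∫ y, h y * g y with hQ
  have key : ∀ t : ℝ, 2 * t * Q ≤ M ^ 2 * t ^ 2 * m + ∫ y, weight N y ^ 2 * g y ^ 2 := by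
    intro t
    rw [hQ, hm, ← integral_const_mul, ← integral_const_mul,
      ← integral_add (hw.const_mul _).integrable (hw.mul_right (by fun_prop)).integrable]
    refine integral_mono ((hhcc.mul_right hg).const_mul _).integrable
      ((hw.const_mul _).add (hw.mul_right (by fun_prop))).integrable fun y => ?_
    have h1 : 2 * t * (h y * g y) ≤ 2 * (|t| * |g y|) * |h y| := by
      refine (le_abs_self _).trans_eq ?_
      rw [abs_mul, abs_mul, abs_mul (h y)]; simp; ring
    have h2 : 2 * (|t| * |g y|) * |h y| ≤ 2 * (|t| * |g y|) * (M * weight N y ^ 2) :=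
      mul_le_mul_of_nonneg_left (hle y) (by positivity)
    have h3 : 2 * (|t| * |g y|) * M ≤ M ^ 2 * t ^ 2 + g y ^ 2 := by
      nlinarith [sq_nonneg (M * |t| - |g y|), sq_abs t, sq_abs (g y)]
    have h4 := mul_le_mul_of_nonneg_right h3 (sq_nonneg (weight N y))
    simp only
    linarith
  have h := key (Q / (M ^ 2 * m))
  have hpos : 0 < M ^ 2 * m := by positivity
  have e : M ^ 2 * (Q / (M ^ 2 * m)) ^ 2 * m = Q ^ 2 / (M ^ 2 * m) := by field_simp
  have e2 : 2 * (Q / (M ^ 2 * m)) * Q = 2 * (Q ^ 2 / (M ^ 2 * m)) := by ring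
  rw [e, e2] at h
  have h' : Q ^ 2 / (M ^ 2 * m) ≤ ∫ y, weight N y ^ 2 * g y ^ 2 := by linarith
  rwa [div_le_iff₀' hpos] at h'

/-- A perturbation of the weight for which `β` has mean zero. -/
theorem exists_balanced_weight {β : Euc N → ℝ} (hβ : Continuous β)
    (hneg : ∃ y ∈ ball (0 : Euc N) 1, β y < 0) (hpos : ∃ y ∈ ball (0 : Euc N) 1, 0 < β y) :
    ∃ b : Euc N → ℝ, ∃ t : ℝ, IsTest b ∧ (∀ y, 0 ≤ b y) ∧ (∀ y, b y ≤ weight N y) ∧ 0 ≤ t ∧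
      ∫ y, (weight N y ^ 2 * β y + t * (b y ^ 2 * β y)) = 0 := by
  have hw := (isTest_weight (N := N)).isCc.sq.mul_right hβ
  set I := ∫ y, weight N y ^ 2 * β y with hI
  have main : ∀ s : ℝ, s * s = 1 → 0 ≤ -s * I → (∃ y ∈ ball (0 : Euc N) 1, 0 < s * β y) →
      ∃ b : Euc N → ℝ, ∃ t : ℝ, IsTest b ∧ (∀ y, 0 ≤ b y) ∧ (∀ y, b y ≤ weight N y) ∧ 0 ≤ t ∧
      ∫ y, (weight N y ^ 2 * β y + t * (b y ^ 2 * β y)) = 0 := by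
    rintro s hs hsI ⟨y₀, hy₀, hy⟩
    obtain ⟨b, hb, hb0, hb1, -, hbp⟩ := exists_signed_bump hβ s hy₀ hy
    set J := ∫ y, b y ^ 2 * β y with hJ
    have hJ0 : J ≠ 0 := by rintro h; simp [h] at hbp
    refine ⟨b, -s * I / (s * J), hb, hb0, hb1, div_nonneg hsI hbp.le, ?_⟩
    rw [integral_add hw.integrable ((hb.isCc.sq.mul_right hβ).const_mul _).integrable,
      integral_const_mul, ← hI, ← hJ]
    have hs0 : s ≠ 0 := by rintro rfl; simp at hs
    field_simp
    ring
  obtain ⟨y₁, hy₁, h₁⟩ := hneg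
  obtain ⟨y₂, hy₂, h₂⟩ := hpos
  rcases le_total 0 I with h | h
  · exact main (-1) (by norm_num) (by linarith) ⟨y₁, hy₁, by linarith⟩
  · exact main 1 (by norm_num) (by linarith) ⟨y₂, hy₂, by linarith⟩

end LogEstimate

section LogEstimateMain

variable {N : ℕ}

theorem slice_const_mul (c : ℝ) (κ : Euc N → ℝ) (F : ℝ × Euc N → ℝ) (x : ℝ) :
    slice (fun y => c * κ y) F x = c * slice κ F x := by
  simp only [slice, mul_assoc, integral_const_mul]

theorem slice_add {κ ν : Euc N → ℝ} (hκ : IsCc κ) (hν : IsCc ν) {F : ℝ × Euc N → ℝ}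
    (hF : Continuous F) (x : ℝ) :
    slice (fun y => κ y + ν y) F x = slice κ F x + slice ν F x := by
  simp only [slice, add_mul]
  exact integral_add (hκ.mul_slice hF x).integrable (hν.mul_slice hF x).integrable

theorem slice_mono {κ ν : Euc N → ℝ} (hκ : IsCc κ) (hν : IsCc ν) {F : ℝ × Euc N → ℝ}
    (hF : Continuous F) (h : ∀ y, κ y ≤ ν y) (hF0 : ∀ p, 0 ≤ F p) (x : ℝ) :
    slice κ F x ≤ slice ν F x :=
  integral_mono (hκ.mul_slice hF x).integrable (hν.mul_slice hF x).integrable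
    fun y => mul_le_mul_of_nonneg_right (h y) (hF0 _)

theorem slice_nonneg {κ : Euc N → ℝ} {F : ℝ × Euc N → ℝ} (h : ∀ y, 0 ≤ κ y) (hF0 : ∀ p, 0 ≤ F p)
    (x : ℝ) : 0 ≤ slice κ F x := integral_nonneg fun y => mul_nonneg (h y) (hF0 _)

set_option maxHeartbeats 2000000 in
/-- Logarithms of positive almost-solutions have bounded mean oscillation. -/
theorem exists_log_estimate {β : Euc N → ℝ} (hβ : IsTest β)
    (hneg : ∃ y ∈ ball (0 : Euc N) 1, β y < 0) (hpos : ∃ y ∈ ball (0 : Euc N) 1, 0 < β y) :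
    ∃ K : ℝ, ∀ W : ℝ × Euc N → ℝ, ContDiff ℝ ∞ W →
      (∀ p ∈ Icc (-2 : ℝ) 3 ×ˢ closedBall (0 : Euc N) 2, |logOp β W p| ≤ 1) →
      ∃ c : ℝ, ∫ p in cyl N (1 / 2), (W p - c) ^ 2 ≤ K := by
  have hβc := hβ.smooth.continuous
  obtain ⟨M, hM0, hM⟩ := hβ.exists_abs_le
  have hw := isTest_weight (N := N)
  have hw2 := hw.isCc.sq
  obtain ⟨b, t, hb, hb0, hbw, ht, hbal⟩ := exists_balanced_weight hβc hneg hpos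
  obtain ⟨y₀, hy₀, hy₀p⟩ := hpos
  obtain ⟨d, hd, hd0, hdw, hdβ, hdp⟩ := exists_signed_bump hβc 1 hy₀ (by simpa using hy₀p)
  simp only [one_mul] at hdβ hdp
  set J := ∫ y, d y ^ 2 * β y with hJ
  have hd2 : IsCc fun y => d y ^ 2 * β y := hd.isCc.sq.mul_right hβc
  have hb2 : IsCc fun y => b y ^ 2 * β y := hb.isCc.sq.mul_right hβc
  have hw2β : IsCc fun y => weight N y ^ 2 * β y := hw2.mul_right hβc
  have hsqle : ∀ {f : Euc N → ℝ}, (∀ y, 0 ≤ f y) → (∀ y, f y ≤ weight N y) →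
      ∀ y, f y ^ 2 ≤ weight N y ^ 2 := fun h0 h1 y => pow_le_pow_left₀ (h0 y) (h1 y) 2
  have hzero : ∀ {f : Euc N → ℝ}, (∀ y, 0 ≤ f y) → (∀ y, f y ≤ weight N y) →
      ∀ y, y ∉ closedBall (0 : Euc N) 2 → f y = 0 := fun {f} h0 h1 y hy =>
    le_antisymm (by simpa [weight_eq_zero hy] using h1 y) (h0 y)
  set κ : Euc N → ℝ := fun y => J⁻¹ * (d y ^ 2 * β y) with hκ
  have hκcc : IsCc κ := hd2.const_mul _
  have hκ0 : ∀ y, 0 ≤ κ y := fun y => mul_nonneg (inv_nonneg.2 hdp.le) (hdβ y)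
  have hκA : ∀ y, κ y ≤ J⁻¹ * M * weight N y ^ 2 := fun y => by
    have h1 : d y ^ 2 * β y ≤ weight N y ^ 2 * M :=
      (mul_le_mul_of_nonneg_left ((le_abs_self _).trans (hM y)) (sq_nonneg _)).trans
        (mul_le_mul_of_nonneg_right (hsqle hd0 hdw y) hM0)
    have := mul_le_mul_of_nonneg_left h1 (inv_nonneg.2 hdp.le)
    simp only [hκ]; linarith
  have hκ1 : ∫ y, κ y = 1 := by
    simp only [hκ]; rw [integral_const_mul]; exact inv_mul_cancel₀ hdp.ne'
  obtain ⟨CP, hCP, hpoin⟩ := exists_poincare hκcc hκ0 hκA hκ1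
  set h : Euc N → ℝ := fun y => weight N y ^ 2 * β y + t * (b y ^ 2 * β y) with hh
  have hhcc : IsCc h := hw2β.add (hb2.const_mul t)
  set Mh := (1 + t) * (M + 1) with hMh
  have hMhp : 0 < Mh := by positivity
  have hhle : ∀ y, |h y| ≤ Mh * weight N y ^ 2 := fun y => by
    have e : h y = (weight N y ^ 2 + t * b y ^ 2) * β y := by simp only [hh]; ring
    have h1 : weight N y ^ 2 + t * b y ^ 2 ≤ (1 + t) * weight N y ^ 2 := by
      have := mul_le_mul_of_nonneg_left (hsqle hb0 hbw y) ht
      linarith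
    have h2 : 0 ≤ weight N y ^ 2 + t * b y ^ 2 := by positivity
    rw [e, abs_mul, abs_of_nonneg h2]
    calc _ ≤ (1 + t) * weight N y ^ 2 * (M + 1) :=
          mul_le_mul h1 (by linarith [hM y]) (abs_nonneg _) (by positivity)
      _ = _ := by simp only [hMh]; ring
  set A : (Euc N → ℝ) → ℝ := fun σ => ∫ y, σ y ^ 2 + 2 * gradSqE σ y with hA
  have hA0 : ∀ σ, 0 ≤ A σ := fun σ => integral_nonneg fun y =>
    add_nonneg (sq_nonneg _) (mul_nonneg zero_le_two (gradSqE_nonneg _ _))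
  set m := ∫ y, weight N y ^ 2 with hm
  have hmp : 0 < m := integral_weight_sq_pos
  set C₁ := A (weight N) + t * A b with hC₁
  have hC₁0 : 0 ≤ C₁ := add_nonneg (hA0 _) (mul_nonneg ht (hA0 _))
  set C₂ := Mh ^ 2 * m * CP with hC₂
  have hC₂p : 0 < C₂ := by positivity
  set K₁ := 500 * C₂ + 250 * C₁ with hK₁
  have hK₁0 : 0 ≤ K₁ := by positivity
  set C₃ := J⁻¹ * (A d + 3 / 2) with hC₃
  have hC₃0 : 0 ≤ C₃ := mul_nonneg (inv_nonneg.2 hdp.le) (by linarith [hA0 d])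
  set C₄ := C₃ * (3 + K₁) with hC₄
  refine ⟨2 * CP * K₁ + 2 * C₄ ^ 2 * m * 3, fun W hW hlog => ⟨slice κ W 0, ?_⟩⟩
  have hWc := hW.continuous
  have hWX := (hW.dd (eX N)).continuous
  have hgc := hW.continuous_gradSq
  set D := slice (fun y => weight N y ^ 2) (gradSq W) with hD
  have hDc : Continuous D := continuous_slice hw2 hgc
  have hD0 : ∀ x, 0 ≤ D x := slice_nonneg (fun y => sq_nonneg _) (gradSq_nonneg W)
  have hlog' : ∀ x ∈ Icc (-2 : ℝ) 3, ∀ y ∈ closedBall (0 : Euc N) 2, |logOp β W (x, y)| ≤ 1 :=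
    fun x hx y hy => hlog _ ⟨hx, hy⟩
  have hP : ∀ x, ∫ y, weight N y ^ 2 * (W (x, y) - slice κ W x) ^ 2 ≤ CP * D x := by
    intro x
    have := hpoin _ (hW.slice_snd x)
    simp only [gradSqE_slice hW] at this
    exact this
  have hDest : ∫ x in Icc (-1 : ℝ) 2, D x ≤ K₁ := by
    refine integral_le_of_hasDerivAt hC₁0 hC₂p hDc hD0 (fun x => hasDerivAt_slice hhcc hW x)
      (continuous_slice hhcc hWX) (fun x hx => ?_) (fun x => ?_)
    · have e : slice h (dd (eX N) W) x = slice (fun y => weight N y ^ 2 * β y) (dd (eX N) W) x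
          + t * slice (fun y => b y ^ 2 * β y) (dd (eX N) W) x := by
        rw [← slice_const_mul, ← slice_add hw2β (hb2.const_mul t) hWX]
      have h1 := (abs_le.1 (abs_slice_add_slice_le hβc hw (fun y => weight_eq_zero) hW
        (hlog' x hx))).2
      have h2 := (abs_le.1 (abs_slice_add_slice_le hβc hb (hzero hb0 hbw) hW (hlog' x hx))).2
      have h3 : 0 ≤ slice (fun y => b y ^ 2) (gradSq W) x :=
        slice_nonneg (fun y => sq_nonneg _) (gradSq_nonneg W) x
      have h4 : slice (fun y => b y ^ 2 * β y) (dd (eX N) W) x ≤ A b := by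
        simp only [hA]; linarith
      have h5 := mul_le_mul_of_nonneg_left h4 ht
      have h6 : slice (fun y => weight N y ^ 2 * β y) (dd (eX N) W) x + 1 / 2 * D x
          ≤ A (weight N) := by
        simp only [hA, hD]; linarith
      rw [e]
      linarith
    · have e : slice h W x = ∫ y, h y * (W (x, y) - slice κ W x) := by
        have hi := (hhcc.mul_slice hWc x).integrable (μ := volume)
        have hi2 := (hhcc.mul_right (continuous_const (y := slice κ W x))).integrable (μ := volume)
        simp only [mul_sub]
        rw [integral_sub hi hi2, integral_mul_const]
        have : ∫ y, h y = 0 := hbal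
        rw [this, zero_mul, sub_zero]
        rfl
      rw [e]
      refine (sq_integral_le_weight hhcc.cont (by fun_prop) hMhp hhle).trans ?_
      simp only [hC₂, mul_assoc]
      refine mul_le_mul_of_nonneg_left ?_ (sq_nonneg _)
      exact mul_le_mul_of_nonneg_left (hP x) hmp.le
  have hPest : ∀ x ∈ Icc (-1 : ℝ) 2, |slice κ W x - slice κ W 0| ≤ C₄ := by
    refine abs_sub_le_of_abs_deriv_le hDc (fun x => hasDerivAt_slice hκcc hW x)
      (continuous_slice hκcc hWX) hC₃0 (fun x hx => ?_) hDest
    have hx' : x ∈ Icc (-2 : ℝ) 3 := ⟨by linarith [hx.1], by linarith [hx.2]⟩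
    have h1 := abs_slice_add_slice_le hβc hd (hzero hd0 hdw) hW (hlog' x hx')
    have h2 : 0 ≤ slice (fun y => d y ^ 2) (gradSq W) x :=
      slice_nonneg (fun y => sq_nonneg _) (gradSq_nonneg W) x
    have h3 : slice (fun y => d y ^ 2) (gradSq W) x ≤ D x :=
      slice_mono hd.isCc.sq hw2 hgc (hsqle hd0 hdw) (gradSq_nonneg W) x
    have h4 : |slice (fun y => d y ^ 2 * β y) (dd (eX N) W) x| ≤ A d + 3 / 2 * D x := by
      have h1' := abs_le.1 h1
      simp only [hA]
      refine abs_le.2 ⟨?_, ?_⟩ <;> linarith [h1'.1, h1'.2]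
    simp only [hκ]
    rw [slice_const_mul, abs_mul, abs_of_nonneg (inv_nonneg.2 hdp.le), hC₃, mul_assoc]
    refine mul_le_mul_of_nonneg_left ?_ (inv_nonneg.2 hdp.le)
    nlinarith [hD0 x, hA0 d, mul_nonneg (hA0 d) (hD0 x)]
  set c := slice κ W 0 with hc
  have hslice : ∀ x ∈ Icc (-1 : ℝ) 2, ∫ y in closedBall (0 : Euc N) (3 / 2), (W (x, y) - c) ^ 2
      ≤ 2 * CP * D x + 2 * C₄ ^ 2 * m := by
    intro x hx
    have hcc : IsCc fun y => weight N y ^ 2 * (W (x, y) - c) ^ 2 := hw2.mul_right (by fun_prop)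
    have hcc2 : IsCc fun y => weight N y ^ 2 * (W (x, y) - slice κ W x) ^ 2 :=
      hw2.mul_right (by fun_prop)
    calc ∫ y in closedBall (0 : Euc N) (3 / 2), (W (x, y) - c) ^ 2
        = ∫ y in closedBall (0 : Euc N) (3 / 2), weight N y ^ 2 * (W (x, y) - c) ^ 2 :=
          setIntegral_congr_fun measurableSet_closedBall fun y hy => by
            simp [weight_eq_one hy]
      _ ≤ ∫ y, weight N y ^ 2 * (W (x, y) - c) ^ 2 :=
          setIntegral_le_integral hcc.integrable (Filter.Eventually.of_forall fun y => by
            positivity)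
      _ ≤ ∫ y, (2 * (weight N y ^ 2 * (W (x, y) - slice κ W x) ^ 2)
            + 2 * C₄ ^ 2 * weight N y ^ 2) := by
          refine integral_mono hcc.integrable
            ((hcc2.const_mul 2).add (hw2.const_mul _)).integrable fun y => ?_
          have h1 : (slice κ W x - c) ^ 2 ≤ C₄ ^ 2 :=
            sq_le_sq' (abs_le.1 (hPest x hx)).1 (abs_le.1 (hPest x hx)).2
          have h2 : (W (x, y) - c) ^ 2 ≤ 2 * (W (x, y) - slice κ W x) ^ 2 + 2 * C₄ ^ 2 := by
            nlinarith [sq_nonneg ((W (x, y) - slice κ W x) - (slice κ W x - c))]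
          have h3 := mul_le_mul_of_nonneg_left h2 (sq_nonneg (weight N y))
          simp only
          linarith
      _ = 2 * (∫ y, weight N y ^ 2 * (W (x, y) - slice κ W x) ^ 2) + 2 * C₄ ^ 2 * m := by
          rw [integral_add (hcc2.const_mul 2).integrable (hw2.const_mul _).integrable,
            integral_const_mul, integral_const_mul]
      _ ≤ _ := by linarith [hP x]
  have hon : ∀ {g : ℝ → ℝ}, Continuous g → IntegrableOn g (Icc (-1) 2) := fun hg =>
    hg.continuousOn.integrableOn_compact isCompact_Icc
  have hsub : cyl N (1 / 2) ⊆ Icc (-1 : ℝ) 2 ×ˢ closedBall (0 : Euc N) (3 / 2) := by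
    refine prod_mono (Icc_subset_Icc (by norm_num) (by norm_num)) ?_
    exact closedBall_subset_closedBall (by norm_num)
  have hbig : IntegrableOn (fun p => (W p - c) ^ 2)
      (Icc (-1 : ℝ) 2 ×ˢ closedBall (0 : Euc N) (3 / 2)) :=
    ContinuousOn.integrableOn_compact (isCompact_Icc.prod (isCompact_closedBall _ _))
      (by fun_prop)
  refine (setIntegral_mono_set hbig (Filter.Eventually.of_forall fun p => sq_nonneg _)
    hsub.eventuallyLE).trans ?_
  rw [Measure.volume_eq_prod] at hbig ⊢
  rw [setIntegral_prod _ hbig]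
  calc _ ≤ ∫ x in Icc (-1 : ℝ) 2, (2 * CP * D x + 2 * C₄ ^ 2 * m) := by
        have hprod : Integrable (fun p => (W p - c) ^ 2)
            ((volume.restrict (Icc (-1 : ℝ) 2)).prod
              (volume.restrict (closedBall (0 : Euc N) (3 / 2)))) := by
          rw [Measure.prod_restrict]; exact hbig
        exact setIntegral_mono_on hprod.integral_prod_left (hon (by fun_prop))
          measurableSet_Icc hslice
    _ = 2 * CP * (∫ x in Icc (-1 : ℝ) 2, D x) + 2 * C₄ ^ 2 * m * 3 := by
        rw [integral_add (hon (by fun_prop)) (hon continuous_const), integral_const_mul,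
          setIntegral_const, Real.volume_real_Icc_of_le (by norm_num), smul_eq_mul]
        ring
    _ ≤ _ := by
        have := mul_le_mul_of_nonneg_left hDest (show 0 ≤ 2 * CP by linarith)
        linarith

end LogEstimateMain

section SmoothHarnack

variable {N : ℕ}

/-- The Harnack inequality for smooth positive functions satisfying the differential inequality. -/
theorem HormanderBound.exists_harnack {β : Euc N → ℝ} {r : ℕ}
    {Ls : Finset (List (Fin (N - 1)))} {c : ℝ} (h : HormanderBound β r Ls c)
    (hneg : ∃ y ∈ ball (0 : Euc N) 1, β y < 0) (hpos : ∃ y ∈ ball (0 : Euc N) 1, 0 < β y) :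
    ∃ C : ℝ, 0 < C ∧ ∀ U : ℝ × Euc N → ℝ, ContDiff ℝ ∞ U → (∀ p, 0 < U p) →
      (∀ p ∈ Icc (-2 : ℝ) 3 ×ˢ closedBall (0 : Euc N) 2, |lapY U p + β p.2 * dX U p| ≤ U p) →
      ∀ p ∈ cyl N 0, ∀ q ∈ cyl N 0, U p ≤ C * U q := by
  obtain ⟨C, hC, B, hexp⟩ := h.exists_exp_le
  obtain ⟨K, hK⟩ := exists_log_estimate h.test hneg hpos
  obtain ⟨M, hM⟩ := exists_le_of_exp_le N C hC B K
  refine ⟨Real.exp (2 * M), Real.exp_pos _, fun U hU hU0 hLU p hp q hq => ?_⟩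
  set W : ℝ × Euc N → ℝ := fun p => Real.log (U p) with hWdef
  have hW : ContDiff ℝ ∞ W := hU.log fun p => (hU0 p).ne'
  have hUW : (fun p => Real.exp (1 * W p)) = U := by
    funext p; simp [hWdef, Real.exp_log (hU0 p)]
  have hop : ∀ p, lapY U p + β p.2 * dX U p = U p * logOp β W p := by
    intro p
    rw [← hUW, dX_eq_dd, lapY_exp_const_mul hW, dd_exp_const_mul hW]
    simp only [logOp, dX_eq_dd]
    ring
  have hlog : ∀ p ∈ Icc (-2 : ℝ) 3 ×ˢ closedBall (0 : Euc N) 2, |logOp β W p| ≤ 1 := by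
    intro p hp
    have h1 := hLU p hp
    rw [hop, abs_mul, abs_of_pos (hU0 p)] at h1
    exact le_of_mul_le_mul_left (by linarith) (hU0 p)
  have hsub : cyl N (1 / 2) ⊆ Icc (-2 : ℝ) 3 ×ˢ closedBall (0 : Euc N) 2 :=
    prod_mono (Icc_subset_Icc (by norm_num) (by norm_num))
      (closedBall_subset_closedBall (by norm_num))
  obtain ⟨a, ha⟩ := hK W hW hlog
  have hWc := hW.continuous
  have key : ∀ s : ℝ, s = 1 ∨ s = -1 → ∀ z ∈ cyl N 0, s * (W z - a) ≤ M := by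
    intro s hs
    refine hM (fun z => s * (W z - a)) (by fun_prop) ?_ ?_
    · have e : ∀ p, (s * (W p - a)) ^ 2 = (W p - a) ^ 2 := fun p => by
        rcases hs with rfl | rfl <;> ring
      simpa only [e] using ha
    · intro k θ θ' h0 hlt hhalf z hz
      have h1 := hexp W hW (fun p hp => hlog p (hsub hp)) k s hs θ θ' h0 hlt hhalf z hz
      have e : ∀ x, Real.exp (1 / (3 * 2 ^ k) * (s * (W x - a)))
          = Real.exp (-(s / (3 * 2 ^ k)) * a) * Real.exp (s / (3 * 2 ^ k) * W x) := fun x => by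
        rw [← Real.exp_add]; congr 1; ring
      simp only [expInt, e]
      rw [integral_const_mul]
      have h2 := mul_le_mul_of_nonneg_left h1 (Real.exp_pos (-(s / (3 * 2 ^ k)) * a)).le
      simp only [expInt] at h2
      linarith
  have h1 := key 1 (Or.inl rfl) p hp
  have h2 := key (-1) (Or.inr rfl) q hq
  have h3 : W p ≤ 2 * M + W q := by linarith
  have h4 := Real.exp_le_exp.2 h3
  rw [Real.exp_add] at h4
  simpa [hWdef, Real.exp_log (hU0 _)] using h4

end SmoothHarnack

section Extension

variable {N : ℕ}

theorem length_multiIndexList {r : ℕ} (ζ : Fin (N - 1) → Fin (r + 1)) :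
    (multiIndexList ζ).length = ∑ i, (ζ i : ℕ) := by
  simp [multiIndexList, List.length_flatMap, Fin.sum_univ_def]

theorem partialsAlong_eqOn {β β' : Euc N → ℝ} {O : Set (Euc N)} (hO : IsOpen O)
    (h : EqOn β β' O) : ∀ l, EqOn (partialsAlong β l) (partialsAlong β' l) O
  | [] => h
  | i :: l => fun y hy => by
    have e : partialsAlong β l =ᶠ[nhds y] partialsAlong β' l := by
      filter_upwards [hO.mem_nhds hy] with z hz using partialsAlong_eqOn hO h l hz
    simp only [partialsAlong, e.fderiv_eq]

/-- A function smooth on a ball agrees on a smaller ball with a test function. -/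
theorem exists_isTest_eqOn {β : Euc N → ℝ} (hβ : ContDiffOn ℝ (⊤ : ℕ∞) β (ball (0 : Euc N) 3)) :
    ∃ β' : Euc N → ℝ, IsTest β' ∧ EqOn β β' (ball 0 (5 / 2)) := by
  let χ : ContDiffBump (0 : Euc N) := ⟨5 / 2, 11 / 4, by norm_num, by norm_num⟩
  have hsupp : tsupport χ ⊆ ball (0 : Euc N) 3 := by
    rw [χ.tsupport_eq]
    exact closedBall_subset_ball (by norm_num [χ])
  refine ⟨fun y => χ y * β y, ⟨contDiff_iff_contDiffAt.2 fun y => ?_,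
    χ.hasCompactSupport.mul_right⟩, fun y hy => ?_⟩
  · by_cases hy : y ∈ ball (0 : Euc N) 3
    · exact χ.contDiff.contDiffAt.mul (hβ.contDiffAt (isOpen_ball.mem_nhds hy))
    · have e : (fun y => χ y * β y) =ᶠ[nhds y] fun _ => 0 := by
        filter_upwards [(isClosed_tsupport χ).isOpen_compl.mem_nhds fun h => hy (hsupp h)] with z hz
        rw [image_eq_zero_of_notMem_tsupport hz, zero_mul]
      exact contDiffAt_const.congr_of_eventuallyEq e
  · simp [χ.one_of_mem_closedBall (ball_subset_closedBall hy)]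

theorem exists_hormanderBound {r : ℕ} {β : Euc N → ℝ}
    (hβ : ContDiffOn ℝ (⊤ : ℕ∞) β (ball (0 : Euc N) 3))
    (hhor : ∀ y ∈ ball (0 : Euc N) 3, 0 < hormanderSum N r β y) :
    ∃ (β' : Euc N → ℝ) (Ls : Finset (List (Fin (N - 1)))) (c : ℝ),
      HormanderBound β' r Ls c ∧ EqOn β β' (ball 0 (5 / 2)) := by
  obtain ⟨β', hT, heq⟩ := exists_isTest_eqOn hβ
  set Z := Finset.univ.filter (fun ζ : Fin (N - 1) → Fin (r + 1) => ∑ i, (ζ i : ℕ) ≤ r) with hZ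
  classical
  set Ls := Z.image multiIndexList with hLs
  have hc : Continuous fun y => ∑ l ∈ Ls, partialsAlong β' l y ^ 2 :=
    continuous_finsetSum _ fun l _ => (hT.partialsAlong l).smooth.continuous.pow 2
  obtain ⟨y₀, hy₀, hmin⟩ := (isCompact_closedBall (0 : Euc N) 2).exists_isMinOn ⟨0, by simp⟩
    hc.continuousOn
  refine ⟨β', Ls, ∑ l ∈ Ls, partialsAlong β' l y₀ ^ 2, ⟨hT, ?_, ?_, fun y hy => hmin hy⟩, heq⟩
  · intro l hl
    obtain ⟨ζ, hζ, rfl⟩ := Finset.mem_image.1 hl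
    rw [length_multiIndexList]
    exact (Finset.mem_filter.1 hζ).2
  · have h := hhor y₀ (closedBall_subset_ball (by norm_num) hy₀)
    obtain ⟨ζ, hζ, hne⟩ := Finset.exists_ne_zero_of_sum_ne_zero h.ne'
    rw [partialsAlong_eqOn isOpen_ball heq _ (closedBall_subset_ball (by norm_num) hy₀)] at hne
    refine Finset.sum_pos' (fun l _ => sq_nonneg _)
      ⟨multiIndexList ζ, Finset.mem_image_of_mem _ hζ, ?_⟩
    have : partialsAlong β' (multiIndexList ζ) y₀ ≠ 0 := by simpa using hne
    positivity

end Extension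

section Mollification

variable {N : ℕ}

/-- The mollification of `v` by the kernel `ψ`. -/
def moll (v ψ : ℝ × Euc N → ℝ) (p : ℝ × Euc N) : ℝ := ∫ q, v q * ψ (p - q)

theorem moll_eq_convolution (v ψ : ℝ × Euc N → ℝ) :
    moll v ψ = convolution v ψ (ContinuousLinearMap.mul ℝ ℝ) volume := rfl

theorem contDiff_moll {v ψ : ℝ × Euc N → ℝ} (hv : Integrable v) (hψ : IsTest ψ) :
    ContDiff ℝ ∞ (moll v ψ) := by
  rw [moll_eq_convolution]
  exact hψ.supp.contDiff_convolution_right _ hv.locallyIntegrable hψ.smooth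

theorem dd_moll {v ψ : ℝ × Euc N → ℝ} (hv : Integrable v) (hψ : IsTest ψ) (w : ℝ × Euc N) :
    dd w (moll v ψ) = moll v (dd w ψ) := by
  funext p
  have h1 : ContDiff ℝ 1 ψ := hψ.smooth.of_le (by exact_mod_cast le_top)
  have h := hψ.supp.hasFDerivAt_convolution_right (ContinuousLinearMap.mul ℝ ℝ) (μ := volume)
    hv.locallyIntegrable h1 p
  rw [moll_eq_convolution, dd, h.fderiv, convolution_precompR_apply _ hv.locallyIntegrable
    (hψ.supp.fderiv ℝ) (h1.continuous_fderiv (by simp))]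
  rfl

theorem integrable_mul_kernel {v ψ : ℝ × Euc N → ℝ} (hv : Integrable v) (hψ : IsCc ψ)
    (p : ℝ × Euc N) : Integrable fun q => v q * ψ (p - q) := by
  obtain ⟨M, hM⟩ := hψ.supp.exists_bound_of_continuous hψ.cont
  have := hψ.cont
  exact hv.mul_bdd (c := M) (Continuous.aestronglyMeasurable (f := fun q => ψ (p - q)) (by fun_prop))
    (Filter.Eventually.of_forall fun q => hM _)

theorem lapY_moll {v ψ : ℝ × Euc N → ℝ} (hv : Integrable v) (hψ : IsTest ψ) :
    lapY (moll v ψ) = moll v (lapY ψ) := by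
  funext p
  simp only [lapY_eq_sum, dd_moll hv hψ, dd_moll hv (hψ.dd _), moll, Finset.mul_sum]
  exact (integral_finsetSum _ fun i _ =>
    integrable_mul_kernel hv ((hψ.dd _).dd _).isCc p).symm

theorem dd_comp_sub {f : ℝ × Euc N → ℝ} (hf : ContDiff ℝ ∞ f) (v p q : ℝ × Euc N) :
    dd v (fun z => f (p - z)) q = -dd v f (p - q) := by
  have h : HasFDerivAt (fun z => f (p - z)) _ q :=
    (hf.differentiable (by simp) (p - q)).hasFDerivAt.comp q ((hasFDerivAt_id q).const_sub p)
  rw [dd, h.fderiv]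
  simp [dd]

theorem IsTest.comp_sub {ψ : ℝ × Euc N → ℝ} (hψ : IsTest ψ) (p : ℝ × Euc N) :
    IsTest fun q => ψ (p - q) :=
  ⟨hψ.smooth.comp (contDiff_const.sub contDiff_id),
    hψ.supp.comp_homeomorph (Homeomorph.subLeft p)⟩

theorem lapY_comp_sub {ψ : ℝ × Euc N → ℝ} (hψ : ContDiff ℝ ∞ ψ) (p q : ℝ × Euc N) :
    lapY (fun z => ψ (p - z)) q = lapY ψ (p - q) := by
  simp only [lapY_eq_sum]
  refine Finset.sum_congr rfl fun i _ => ?_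
  rw [show dd (eY i) (fun z => ψ (p - z)) = fun z => -dd (eY i) ψ (p - z) from
    funext fun z => dd_comp_sub hψ _ p z]
  have := dd_comp_sub (hψ.dd (eY i)).neg (eY i) p q
  rw [this]
  unfold dd
  rw [fderiv_fun_neg]
  simp

/-- A smooth kernel concentrated near the origin, much more so in the `y` directions. -/
structure IsKernel (ψ : ℝ × Euc N → ℝ) (ε h : ℝ) : Prop where
  test : IsTest ψ
  nonneg : ∀ p, 0 ≤ ψ p
  integral_eq_one : ∫ p, ψ p = 1
  le : h ≤ ε
  tsupport_subset : tsupport ψ ⊆ closedBall (0 : ℝ) ε ×ˢ closedBall (0 : Euc N) h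

theorem exists_isKernel {ε δ : ℝ} (hε : 0 < ε) (hδ : 0 < δ) :
    ∃ (ψ : ℝ × Euc N → ℝ) (h : ℝ), 0 < h ∧ IsKernel ψ ε h ∧ h * ∫ p, |dd (eX N) ψ p| ≤ δ := by
  let ρ : ContDiffBump (0 : ℝ) := ⟨ε / 2, ε, by linarith, by linarith⟩
  set R := ρ.normed volume with hR
  have hRs : ContDiff ℝ ∞ R := ρ.contDiff_normed
  set I := ∫ x, |dd (1 : ℝ) R x| with hI
  have hI0 : 0 ≤ I := integral_nonneg fun _ => abs_nonneg _
  set h := min ε (δ / (I + 1)) with hh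
  have hh0 : 0 < h := lt_min hε (by positivity)
  let χ : ContDiffBump (0 : Euc N) := ⟨h / 2, h, by linarith, by linarith⟩
  set X := χ.normed volume with hX
  have hXs : ContDiff ℝ ∞ X := χ.contDiff_normed
  have hsub : tsupport (fun p : ℝ × Euc N => R p.1 * X p.2)
      ⊆ closedBall (0 : ℝ) ε ×ˢ closedBall (0 : Euc N) h := by
    refine closure_minimal (fun p hp => ?_) (isClosed_closedBall.prod isClosed_closedBall)
    have h1 : R p.1 ≠ 0 := left_ne_zero_of_mul hp
    have h2 : X p.2 ≠ 0 := right_ne_zero_of_mul hp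
    refine ⟨?_, ?_⟩
    · have := subset_tsupport R h1
      rwa [hR, ρ.tsupport_normed_eq] at this
    · have := subset_tsupport X h2
      rwa [hX, χ.tsupport_normed_eq] at this
  have hsm : ContDiff ℝ ∞ fun p : ℝ × Euc N => R p.1 * X p.2 :=
    (hRs.comp contDiff_fst).mul (hXs.comp contDiff_snd)
  refine ⟨fun p => R p.1 * X p.2, h, hh0, ⟨⟨hsm, ?_⟩, fun p => mul_nonneg (ρ.nonneg_normed _)
    (χ.nonneg_normed _), ?_, min_le_left _ _, hsub⟩, ?_⟩
  · exact ((isCompact_closedBall _ _).prod (isCompact_closedBall _ _)).of_isClosed_subset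
      (isClosed_tsupport _) hsub
  · rw [Measure.volume_eq_prod, integral_prod_mul, hR, hX, ρ.integral_normed, χ.integral_normed,
      one_mul]
  · have e : ∀ p : ℝ × Euc N, |dd (eX N) (fun p => R p.1 * X p.2) p|
        = |dd (1 : ℝ) R p.1| * X p.2 := by
      intro p
      have h1 : HasFDerivAt (fun p : ℝ × Euc N => R p.1) _ p :=
        (hRs.differentiable (by simp) p.1).hasFDerivAt.comp p hasFDerivAt_fst
      have h2 : HasFDerivAt (fun p : ℝ × Euc N => X p.2) _ p :=
        (hXs.differentiable (by simp) p.2).hasFDerivAt.comp p hasFDerivAt_snd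
      have h3 : dd (eX N) (fun p : ℝ × Euc N => R p.1 * X p.2) p = dd (1 : ℝ) R p.1 * X p.2 := by
        rw [dd, (h1.fun_mul h2).fderiv]
        simp [eX, dd, mul_comm]
      rw [h3, abs_mul, abs_of_nonneg (show 0 ≤ X p.2 from χ.nonneg_normed _)]
    simp_rw [e]
    rw [Measure.volume_eq_prod, integral_prod_mul (fun x => |dd (1 : ℝ) R x|) X, hX,
      χ.integral_normed, mul_one, ← hI]
    calc h * I ≤ δ / (I + 1) * I := mul_le_mul_of_nonneg_right (min_le_right _ _) hI0
      _ ≤ δ := by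
        rw [div_mul_eq_mul_div, div_le_iff₀ (by positivity)]
        nlinarith

end Mollification

section Reduction

variable {N : ℕ}

theorem IsKernel.abs_moll_sub_le {ψ v : ℝ × Euc N → ℝ} {ε h : ℝ} (hψ : IsKernel ψ ε h)
    (hv : Integrable v) {p : ℝ × Euc N} {a η : ℝ}
    (hclose : ∀ q, dist q p ≤ ε → |v q - a| ≤ η) : |moll v ψ p - a| ≤ η := by
  have hgi : Integrable fun q => ψ (p - q) := (hψ.test.comp_sub p).isCc.integrable
  have hone : ∫ q, ψ (p - q) = 1 := by
    rw [integral_sub_left_eq_self]; exact hψ.integral_eq_one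
  have hvi := integrable_mul_kernel hv hψ.test.isCc p
  have e : moll v ψ p - a = ∫ q, (v q * ψ (p - q) - a * ψ (p - q)) := by
    rw [integral_sub hvi (hgi.const_mul a), integral_const_mul, hone, mul_one]; rfl
  rw [e]
  have hle : ∀ q, |v q * ψ (p - q) - a * ψ (p - q)| ≤ η * ψ (p - q) := by
    intro q
    rw [← sub_mul, abs_mul, abs_of_nonneg (hψ.nonneg _)]
    by_cases hq : p - q ∈ tsupport ψ
    · refine mul_le_mul_of_nonneg_right (hclose q ?_) (hψ.nonneg _)
      have h1 := hψ.tsupport_subset hq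
      rw [dist_comm, dist_eq_norm, Prod.norm_def]
      have h2 := mem_closedBall_zero_iff.1 h1.1
      have h3 := mem_closedBall_zero_iff.1 h1.2
      exact max_le h2 (h3.trans hψ.le)
    · simp [image_eq_zero_of_notMem_tsupport hq]
  calc _ ≤ ∫ q, |v q * ψ (p - q) - a * ψ (p - q)| := abs_integral_le_integral_abs
    _ ≤ ∫ q, η * ψ (p - q) := integral_mono (hvi.sub (hgi.const_mul a)).abs (hgi.const_mul η) hle
    _ = η := by rw [integral_const_mul, hone, mul_one]

theorem measurableSet_cylD : MeasurableSet (cylD N) := measurableSet_Ioo.prod measurableSet_ball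

theorem isOpen_cylD : IsOpen (cylD N) := isOpen_Ioo.prod isOpen_ball

theorem integrable_indicator_cylD {u : ℝ × Euc N → ℝ} (hu : ContinuousOn u (cylD N))
    (h0 : ∀ p ∈ cylD N, 0 ≤ u p) {K : ℝ} (hK : ∀ p ∈ cylD N, u p ≤ K) :
    Integrable ((cylD N).indicator u) := by
  rw [integrable_indicator_iff measurableSet_cylD]
  have hfin : volume (cylD N) ≠ ⊤ := by
    have : cylD N ⊆ Icc (-5 : ℝ) 6 ×ˢ closedBall (0 : Euc N) 3 :=
      prod_mono Ioo_subset_Icc_self ball_subset_closedBall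
    exact ((measure_mono this).trans_lt
      (isCompact_Icc.prod (isCompact_closedBall _ _)).measure_lt_top).ne
  refine IntegrableOn.of_bound hfin.lt_top (hu.aestronglyMeasurable measurableSet_cylD) K ?_
  filter_upwards [ae_restrict_mem measurableSet_cylD] with p hp
  rw [Real.norm_of_nonneg (h0 p hp)]
  exact hK p hp

set_option maxHeartbeats 1000000 in
/-- The mollification of a distributional solution almost satisfies the differential inequality. -/
theorem IsKernel.abs_op_moll_le {β β' : Euc N → ℝ} (hβ' : IsTest β')
    (heq : EqOn β β' (ball 0 (5 / 2))) {L : NNReal} (hL : LipschitzWith L β')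
    {γ : ℝ × Euc N → ℝ} (hγm : Measurable γ)
    (hγ : ∀ᵐ p ∂(volume.restrict (cylD N)), |γ p| ≤ 1)
    {u : ℝ × Euc N → ℝ} (hu : ContinuousOn u (cylD N)) (h0 : ∀ p ∈ cylD N, 0 ≤ u p)
    {K : ℝ} (hK : ∀ p ∈ cylD N, u p ≤ K) (hsol : IsDistribSolution (cylD N) β γ u)
    {ψ : ℝ × Euc N → ℝ} {ε h : ℝ} (hψ : IsKernel ψ ε h) (hh : 0 < h) (hε : ε ≤ 1 / 4)
    {p : ℝ × Euc N} (hp : p ∈ Icc (-2 : ℝ) 3 ×ˢ closedBall (0 : Euc N) 2) :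
    |lapY (moll ((cylD N).indicator u) ψ) p + β' p.2 * dX (moll ((cylD N).indicator u) ψ) p|
      ≤ moll ((cylD N).indicator u) ψ p + |K| * L * (h * ∫ q, |dd (eX N) ψ q|) := by
  have hv := integrable_indicator_cylD hu h0 hK
  set v := (cylD N).indicator u with hvdef
  set g := (cylD N).indicator γ with hg
  have hv0 : ∀ q, 0 ≤ v q := fun q => indicator_nonneg h0 q
  have hvK : ∀ q, v q ≤ |K| := fun q => by
    by_cases hq : q ∈ cylD N
    · rw [hvdef, indicator_of_mem hq]; exact (hK q hq).trans (le_abs_self K)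
    · rw [hvdef, indicator_of_notMem hq]; exact abs_nonneg K
  have hg1 : ∀ᵐ q, |g q| ≤ 1 := by
    rw [ae_restrict_iff' measurableSet_cylD] at hγ
    filter_upwards [hγ] with q hq
    by_cases hqS : q ∈ cylD N
    · rw [hg, indicator_of_mem hqS]; exact hq hqS
    · rw [hg, indicator_of_notMem hqS]; simp
  have hgm : Measurable g := hγm.indicator measurableSet_cylD
  obtain ⟨M, -, hM⟩ := hβ'.exists_abs_le
  have hβc := hβ'.smooth.continuous
  have hX := hψ.test.dd (eX N)
  have iL := integrable_mul_kernel hv hψ.test.lapY p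
  have iX := integrable_mul_kernel hv hX.isCc p
  have iψ := integrable_mul_kernel hv hψ.test.isCc p
  have iβX : Integrable fun q => β' q.2 * (v q * dd (eX N) ψ (p - q)) :=
    iX.bdd_mul (c := M) (Continuous.aestronglyMeasurable (f := fun q : ℝ × Euc N => β' q.2)
      (by fun_prop)) (Filter.Eventually.of_forall fun q => hM q.2)
  have iγ : Integrable fun q => g q * (v q * ψ (p - q)) :=
    iψ.bdd_mul (c := 1) hgm.aestronglyMeasurable hg1
  have hmem : ∀ q, p - q ∈ tsupport ψ → ‖(p - q).1‖ ≤ ε ∧ ‖(p - q).2‖ ≤ h := fun q hq => by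
    have h1 := hψ.tsupport_subset hq
    exact ⟨mem_closedBall_zero_iff.1 h1.1, mem_closedBall_zero_iff.1 h1.2⟩
  have hp2 : ‖p.2‖ ≤ 2 := mem_closedBall_zero_iff.1 hp.2
  have hball : ∀ q, p - q ∈ tsupport ψ → ‖q.2‖ < 5 / 2 := fun q hq => by
    have h1 := (hmem q hq).2
    have h2 : ‖q.2‖ ≤ ‖p.2‖ + ‖(p - q).2‖ := by
      have : q.2 = p.2 - (p - q).2 := by simp
      calc ‖q.2‖ = ‖p.2 - (p - q).2‖ := by rw [← this]
        _ ≤ _ := norm_sub_le _ _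
    linarith [hψ.le]
  have hsub : tsupport (fun q => ψ (p - q)) ⊆ cylD N := by
    have hpre : tsupport (fun q => ψ (p - q)) ⊆ (fun q => p - q) ⁻¹' tsupport ψ :=
      tsupport_comp_subset_preimage ψ (by fun_prop)
    intro q hq
    have hq' : p - q ∈ tsupport ψ := hpre hq
    have h1 := abs_le.1 (show |p.1 - q.1| ≤ ε from (hmem q hq').1)
    have h2 := hball q hq'
    refine ⟨⟨?_, ?_⟩, mem_ball_zero_iff.2 (by linarith)⟩
    · linarith [hp.1.1, h1.2]
    · linarith [hp.1.2, h1.1]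
  have hT := hψ.test.comp_sub p
  have hzero : ∫ q, (v q * lapY ψ (p - q) + β' q.2 * (v q * dd (eX N) ψ (p - q))
      + g q * (v q * ψ (p - q))) = 0 := by
    rw [← hsol _ hT.smooth hT.supp hsub, ← integral_indicator measurableSet_cylD]
    refine integral_congr_ae (Filter.Eventually.of_forall fun q => ?_)
    by_cases hq : q ∈ cylD N
    · simp only [hvdef, hg, indicator_of_mem hq]
      rw [lapY_comp_sub hψ.test.smooth, dX_eq_dd, dd_comp_sub hψ.test.smooth]
      have hβeq : β' q.2 * dd (eX N) ψ (p - q) = β q.2 * dd (eX N) ψ (p - q) := by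
        by_cases hqt : p - q ∈ tsupport ψ
        · rw [heq (mem_ball_zero_iff.2 (hball q hqt))]
        · rw [dd_eq_zero_of_notMem hqt]; simp
      linear_combination u q * hβeq
    · simp [hvdef, indicator_of_notMem hq]
  have i3 : Integrable fun q => v q * lapY ψ (p - q) + β' q.2 * (v q * dd (eX N) ψ (p - q)) :=
    iL.add iβX
  have hlhs : lapY (moll v ψ) p + β' p.2 * dX (moll v ψ) p
      = ∫ q, ((β' p.2 - β' q.2) * (v q * dd (eX N) ψ (p - q)) - g q * (v q * ψ (p - q))) := by
    have e : ∀ q, (β' p.2 - β' q.2) * (v q * dd (eX N) ψ (p - q)) - g q * (v q * ψ (p - q))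
        = (v q * lapY ψ (p - q) + β' p.2 * (v q * dd (eX N) ψ (p - q)))
          - (v q * lapY ψ (p - q) + β' q.2 * (v q * dd (eX N) ψ (p - q))
            + g q * (v q * ψ (p - q))) := fun q => by ring
    have i1 : Integrable fun q => v q * lapY ψ (p - q) + β' p.2 * (v q * dd (eX N) ψ (p - q)) :=
      iL.add (iX.const_mul _)
    have i2 : Integrable fun q => v q * lapY ψ (p - q) + β' q.2 * (v q * dd (eX N) ψ (p - q))
        + g q * (v q * ψ (p - q)) := i3.add iγ
    simp_rw [e]
    rw [integral_sub i1 i2, hzero, sub_zero, integral_add iL (iX.const_mul _),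
      integral_const_mul, lapY_moll hv hψ.test, dX_eq_dd, dd_moll hv hψ.test]
    rfl
  rw [hlhs]
  have iabs : Integrable fun q => |dd (eX N) ψ (p - q)| := (hX.comp_sub p).isCc.abs.integrable
  have iR : Integrable fun q => v q * ψ (p - q) + |K| * L * h * |dd (eX N) ψ (p - q)| :=
    iψ.add (iabs.const_mul _)
  have iD : Integrable fun q => (β' p.2 - β' q.2) * (v q * dd (eX N) ψ (p - q))
      - g q * (v q * ψ (p - q)) := by
    simp_rw [sub_mul]
    exact ((iX.const_mul _).sub iβX).sub iγ
  calc _ ≤ ∫ q, |(β' p.2 - β' q.2) * (v q * dd (eX N) ψ (p - q)) - g q * (v q * ψ (p - q))| :=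
        abs_integral_le_integral_abs
    _ ≤ ∫ q, (v q * ψ (p - q) + |K| * L * h * |dd (eX N) ψ (p - q)|) := by
        refine integral_mono_ae iD.abs iR ?_
        filter_upwards [hg1] with q hq
        have hvψ : 0 ≤ v q * ψ (p - q) := mul_nonneg (hv0 q) (hψ.nonneg _)
        have h1 : |g q * (v q * ψ (p - q))| ≤ v q * ψ (p - q) := by
          rw [abs_mul, abs_of_nonneg hvψ]
          exact mul_le_of_le_one_left hvψ hq
        have h2 : |(β' p.2 - β' q.2) * (v q * dd (eX N) ψ (p - q))|
            ≤ |K| * L * h * |dd (eX N) ψ (p - q)| := by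
          by_cases hqt : p - q ∈ tsupport ψ
          · have h3 : |β' p.2 - β' q.2| ≤ L * h := by
              have h4 := hL.dist_le_mul p.2 q.2
              rw [Real.dist_eq, dist_eq_norm] at h4
              exact h4.trans (mul_le_mul_of_nonneg_left (hmem q hqt).2 L.2)
            rw [abs_mul, abs_mul (v q), abs_of_nonneg (hv0 q), ← mul_assoc]
            refine mul_le_mul_of_nonneg_right ?_ (abs_nonneg _)
            calc |β' p.2 - β' q.2| * v q ≤ L * h * |K| :=
                  mul_le_mul h3 (hvK q) (hv0 q) (mul_nonneg L.2 hh.le)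
              _ = _ := by ring
          · rw [dd_eq_zero_of_notMem hqt]; simp
        exact (abs_sub _ _).trans (by linarith)
    _ = _ := by
        rw [integral_add iψ (iabs.const_mul _), integral_const_mul,
          integral_sub_left_eq_self (fun q => |dd (eX N) ψ q|) volume p, mul_assoc (|K| * L)]
        rfl

end Reduction

/-- In the normalized setting, if `β` moreover satisfies Hörmander's condition
`Σ_{0≤|ζ|≤r} |D^ζ β(y)| > 0` on `B_3(0)` for some `r ∈ ℕ`, then there is `C > 0`, depending
only on `N`, `r` and `β` (in particular not on `γ` or `u`), such that
`sup_{[0,1]×B_1(0)} u ≤ C · inf_{[0,1]×B_1(0)} u`. -/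
theorem harnack_normalized
    (N r : ℕ) (hN : 2 ≤ N)
    (β : Euc N → ℝ) (hβsmooth : ContDiffOn ℝ (⊤ : ℕ∞) β (ball (0 : Euc N) 3))
    (hβbdd : ∀ k : ℕ, ∃ M : ℝ, ∀ y ∈ ball (0 : Euc N) 3,
      ‖iteratedFDerivWithin ℝ k β (ball (0 : Euc N) 3) y‖ ≤ M)
    (hβneg : ∃ y ∈ ball (0 : Euc N) 1, β y < 0)
    (hβpos : ∃ y ∈ ball (0 : Euc N) 1, 0 < β y)
    (hβhor : ∀ y ∈ ball (0 : Euc N) 3, 0 < hormanderSum N r β y) :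
    ∃ C > (0 : ℝ),
      ∀ γ : ℝ × Euc N → ℝ, Measurable γ →
        (∀ᵐ p ∂(volume.restrict (cylD N)), |γ p| ≤ 1) →
      ∀ u : ℝ × Euc N → ℝ, ContinuousOn u (cylD N) →
        (∀ p ∈ cylD N, 0 ≤ u p) →
        (∃ K : ℝ, ∀ p ∈ cylD N, u p ≤ K) →
        IsDistribSolution (cylD N) β γ u →
        sSup (u '' (Icc (0 : ℝ) 1 ×ˢ ball (0 : Euc N) 1))
          ≤ C * sInf (u '' (Icc (0 : ℝ) 1 ×ˢ ball (0 : Euc N) 1)) := by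
  obtain ⟨β', Ls, c, hH, heq⟩ := exists_hormanderBound hβsmooth hβhor
  have hsub1 : ball (0 : Euc N) 1 ⊆ ball 0 (5 / 2) := ball_subset_ball (by norm_num)
  obtain ⟨y₁, hy₁, hneg⟩ := hβneg
  obtain ⟨y₂, hy₂, hpos⟩ := hβpos
  rw [heq (hsub1 hy₁)] at hneg
  rw [heq (hsub1 hy₂)] at hpos
  obtain ⟨C, hC, hharnack⟩ := hH.exists_harnack ⟨y₁, hy₁, hneg⟩ ⟨y₂, hy₂, hpos⟩
  obtain ⟨L, hL⟩ := hH.test.smooth.lipschitzWith_of_hasCompactSupport hH.test.supp (by simp)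
  refine ⟨C, hC, fun γ hγm hγ u hu h0 ⟨K, hK⟩ hsol => ?_⟩
  have hv := integrable_indicator_cylD hu h0 hK
  have hcyl : Icc (0 : ℝ) 1 ×ˢ ball (0 : Euc N) 1 ⊆ cyl N 0 := by
    refine prod_mono (Icc_subset_Icc (by norm_num) (by norm_num)) ?_
    exact ball_subset_closedBall.trans (closedBall_subset_closedBall (by norm_num))
  have hD : Icc (0 : ℝ) 1 ×ˢ ball (0 : Euc N) 1 ⊆ cylD N := by
    refine prod_mono (fun x hx => ⟨by linarith [hx.1], by linarith [hx.2]⟩) ?_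
    exact ball_subset_ball (by norm_num)
  have hnear : ∀ p ∈ cylD N, ∀ η > (0 : ℝ), ∃ ε > (0 : ℝ), ∀ q, dist q p ≤ ε →
      |(cylD N).indicator u q - u p| ≤ η := by
    intro p hp η hη
    have hcont : ContinuousAt ((cylD N).indicator u) p := by
      refine (hu.continuousAt (isOpen_cylD.mem_nhds hp)).congr ?_
      filter_upwards [isOpen_cylD.mem_nhds hp] with q hq
      rw [indicator_of_mem hq]
    obtain ⟨ε, hε, h⟩ := Metric.continuousAt_iff.1 hcont η hη
    refine ⟨ε / 2, by linarith, fun q hq => ?_⟩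
    have := h (show dist q p < ε by linarith)
    rw [indicator_of_mem hp, Real.dist_eq] at this
    exact this.le
  have hpair : ∀ p ∈ Icc (0 : ℝ) 1 ×ˢ ball (0 : Euc N) 1,
      ∀ q ∈ Icc (0 : ℝ) 1 ×ˢ ball (0 : Euc N) 1, u p ≤ C * u q := by
    intro p hp q hq
    refine le_of_forall_pos_le_add fun e he => ?_
    set η := e / (2 * C) with hη
    have hη0 : 0 < η := by positivity
    obtain ⟨ε₁, hε₁, hn₁⟩ := hnear p (hD hp) η hη0
    obtain ⟨ε₂, hε₂, hn₂⟩ := hnear q (hD hq) η hη0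
    set ε := min (1 / 4) (min ε₁ ε₂) with hε
    have hε0 : 0 < ε := lt_min (by norm_num) (lt_min hε₁ hε₂)
    have hle₁ : ε ≤ ε₁ := (min_le_right _ _).trans (min_le_left _ _)
    have hle₂ : ε ≤ ε₂ := (min_le_right _ _).trans (min_le_right _ _)
    have hKL : 0 ≤ |K| * (L : ℝ) := mul_nonneg (abs_nonneg K) L.2
    obtain ⟨ψ, h, hh, hψ, hsmall⟩ := exists_isKernel (N := N) (δ := η / (|K| * L + 1)) hε0
      (by positivity)
    have hsmall' : |K| * L * (h * ∫ z, |dd (eX N) ψ z|) ≤ η := by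
      refine (mul_le_mul_of_nonneg_left hsmall hKL).trans ?_
      rw [mul_div_assoc', div_le_iff₀ (by positivity)]
      nlinarith
    set v := moll ((cylD N).indicator u) ψ with hvdef
    have hvs : ContDiff ℝ ∞ v := contDiff_moll hv hψ.test
    have hv0 : ∀ z, 0 ≤ v z := fun z => integral_nonneg fun z' =>
      mul_nonneg (indicator_nonneg h0 z') (hψ.nonneg _)
    have hdd : ∀ w, dd w (fun z => v z + η) = dd w v := fun w => by
      funext z
      rw [dd_add hvs contDiff_const, dd_const, add_zero]
    have hmain := hharnack (fun z => v z + η) (hvs.add contDiff_const)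
      (fun z => add_pos_of_nonneg_of_pos (hv0 z) hη0) (fun z hz => ?_) p (hcyl hp) q (hcyl hq)
    · have h1 := abs_le.1 (hψ.abs_moll_sub_le hv fun z hz => hn₁ z (hz.trans hle₁))
      have h2 := abs_le.1 (hψ.abs_moll_sub_le hv fun z hz => hn₂ z (hz.trans hle₂))
      have h3 : C * (v q + η) ≤ C * (u q + 2 * η) :=
        mul_le_mul_of_nonneg_left (by linarith [h2.2]) hC.le
      have h4 : C * (2 * η) = e := by rw [hη]; field_simp
      linarith [h1.1]
    · have h1 := hψ.abs_op_moll_le hH.test heq hL hγm hγ hu h0 hK hsol hh (min_le_left _ _) hz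
      have e1 : lapY (fun z => v z + η) z = lapY v z := by simp only [lapY_eq_sum, hdd]
      have e2 : dX (fun z => v z + η) z = dX v z := by simp only [dX_eq_dd, hdd]
      rw [e1, e2]
      linarith
  have hne : (u '' (Icc (0 : ℝ) 1 ×ˢ ball (0 : Euc N) 1)).Nonempty :=
    ⟨u (0, 0), (0, 0), by simp, rfl⟩
  refine csSup_le hne ?_
  rintro _ ⟨p, hp, rfl⟩
  rw [← div_le_iff₀' hC]
  refine le_csInf hne ?_
  rintro _ ⟨q, hq, rfl⟩
  rw [div_le_iff₀' hC]
  exact hpair p hp q hq
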